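/- arXiv:2105.13874 — 2 statements merged into one kernel-verified Lean document; each statement's English description precedes it below -/
import Mathlib

section
/- Let A ⊆ H be an affine commutative-by-finite Hopf algebra. Then: (i) if g ∼ h in G_H then ĝ = ĥ; (ii) k̂G_H = ⊕_{g ∈ G_H/∼} ĝ; (iii) k̂G_H is a subcoalgebra of H° and each ĝ is a subcoalgebra of k̂G_H; (iv) for each g ∈ G_H, ĝ contains ⊕_{h∼g} (H/Hm_h)*, and (H/Hm_g)* contains H̄*Π°(χ_g) + Π°(χ_g)H̄*; (v) S°(ĝ) = ĝ⁻¹ where S° is the antipode of H°; (vi) k̂G_H ∩ W(H°) = H̄* = 1̂ (the component of the identity of G_H). -/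
open TensorProduct LinearMap Coalgebra

namespace Paper

noncomputable section

variable (k : Type) [Field k]

section Coalg

variable {C : Type} [AddCommMonoid C] [Module k C] [Coalgebra k C]

/-- Convolution product on the linear dual of a coalgebra. -/
noncomputable def conv (f g : Module.Dual k C) : Module.Dual k C :=
  (TensorProduct.lid k k).toLinearMap ∘ₗ TensorProduct.map f g ∘ₗ Coalgebra.comul

/-- The unit of the convolution algebra on the dual: the counit. -/
noncomputable def convOne : Module.Dual k C := Coalgebra.counit

/-- Iterated convolution power. -/
noncomputable def convPow (f : Module.Dual k C) : ℕ → Module.Dual k C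
  | 0 => convOne k
  | n + 1 => conv k f (convPow f n)

end Coalg

/-- The finite dual of an algebra: functionals vanishing on a two-sided ideal
of finite codimension. -/
def finDual (H : Type) [Ring H] [Algebra k H] : Set (Module.Dual k H) :=
  {f | ∃ I : Submodule k H, (∀ (h : H), ∀ x ∈ I, h * x ∈ I ∧ x * h ∈ I) ∧
    I ≤ LinearMap.ker f ∧ FiniteDimensional k (H ⧸ I)}

section Hopf

variable (H : Type) [Ring H] [HopfAlgebra k H]

/-- Left adjoint action `(ad_ℓ h)(a) = Σ h₁ a S(h₂)`. -/
noncomputable def adl (h a : H) : H :=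
  TensorProduct.lift (((LinearMap.mul k H).comp (LinearMap.mulRight k a)).compl₂
    (HopfAlgebra.antipode (R := k))) (Coalgebra.comul h)

/-- Right adjoint action `(ad_r h)(a) = Σ S(h₁) a h₂`. -/
noncomputable def adr (h a : H) : H :=
  TensorProduct.lift ((LinearMap.mul k H).comp ((LinearMap.mulRight k a) ∘ₗ
    (HopfAlgebra.antipode (R := k)))) (Coalgebra.comul h)

/-- Left adjoint action on the dual: `(ad_ℓ φ)(f) = Σ φ₁ f S°(φ₂)`, i.e.
`h ↦ Σ φ(h₁ S(h₃)) f(h₂)`. -/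
noncomputable def adld (φ f : Module.Dual k H) : Module.Dual k H :=
  (TensorProduct.lid k k).toLinearMap ∘ₗ
    TensorProduct.map (φ ∘ₗ LinearMap.mul' k H ∘ₗ
      (HopfAlgebra.antipode (R := k)).lTensor H) f ∘ₗ
    (TensorProduct.assoc k H H H).symm.toLinearMap ∘ₗ
    ((TensorProduct.comm k H H).toLinearMap.lTensor H) ∘ₗ
    ((Coalgebra.comul (R := k) (A := H)).lTensor H) ∘ₗ
    Coalgebra.comul

/-- Right adjoint action on the dual: `(ad_r φ)(f) = Σ S°(φ₁) f φ₂`, i.e.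
`h ↦ Σ φ(S(h₁) h₃) f(h₂)`. -/
noncomputable def adrd (φ f : Module.Dual k H) : Module.Dual k H :=
  (TensorProduct.lid k k).toLinearMap ∘ₗ
    TensorProduct.map (φ ∘ₗ LinearMap.mul' k H ∘ₗ
      (HopfAlgebra.antipode (R := k)).rTensor H) f ∘ₗ
    (TensorProduct.assoc k H H H).symm.toLinearMap ∘ₗ
    ((TensorProduct.comm k H H).toLinearMap.lTensor H) ∘ₗ
    ((Coalgebra.comul (R := k) (A := H)).lTensor H) ∘ₗ
    Coalgebra.comul

/-- A submodule is a subcoalgebra if its image under `comul` lies in `V ⊗ V`. -/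
def IsSubcoalgebra (V : Submodule k H) : Prop :=
  ∀ x ∈ V, Coalgebra.comul (R := k) x ∈
    LinearMap.range (TensorProduct.map V.subtype V.subtype)

/-- A Hopf algebra is pointed if every simple subcoalgebra is one-dimensional. -/
def IsPointedHopf : Prop :=
  ∀ V : Submodule k H, IsSubcoalgebra k H V → V ≠ ⊥ →
    (∀ W : Submodule k H, W ≤ V → IsSubcoalgebra k H W → W = ⊥ ∨ W = V) →
    Module.finrank k ↥V = 1

/-- A coideal: `ε(X) = 0` and `Δ(X) ⊆ X ⊗ H + H ⊗ X`. -/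
def IsCoideal (X : Submodule k H) : Prop :=
  (∀ x ∈ X, Coalgebra.counit (R := k) x = 0) ∧
  (∀ x ∈ X, Coalgebra.comul (R := k) x ∈
    LinearMap.range (TensorProduct.map X.subtype (LinearMap.id (M := H))) ⊔
    LinearMap.range (TensorProduct.map (LinearMap.id (M := H)) X.subtype))

/-- `S` is a Hopf subalgebra of the finite dual `H°` (with its convolution
product; closure under the coproduct is expressed in pairing form). -/
def IsHopfSubalgSet (S : Set (Module.Dual k H)) : Prop :=
  S ⊆ finDual k H ∧ convOne k ∈ S ∧
  (∀ f g, f ∈ S → g ∈ S → f + g ∈ S ∧ conv k f g ∈ S) ∧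
  (∀ (c : k), ∀ f ∈ S, c • f ∈ S) ∧
  (∀ f ∈ S, f ∘ₗ HopfAlgebra.antipode (R := k) ∈ S) ∧
  (∀ f ∈ S, ∃ (n : ℕ) (s t : Fin n → Module.Dual k H),
    (∀ i, s i ∈ S ∧ t i ∈ S) ∧ ∀ x y : H, f (x * y) = ∑ i, s i x * t i y)

end Hopf

section Ext

variable (A : Type) [CommRing A] [HopfAlgebra k A]
variable (H : Type) [Ring H] [HopfAlgebra k H]

/-- The submodule `A⁺H` of `H` (image of the augmentation ideal times `H`). -/
def augHIdeal (ι : A →ₗ[k] H) : Submodule k H :=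
  Submodule.span k
    {x : H | ∃ (a : A) (h : H), Coalgebra.counit (R := k) a = 0 ∧ x = ι a * h}

/-- The subset of the dual of `H` corresponding to `H̄* = (H/A⁺H)*`:
functionals vanishing on `A⁺H`. -/
def hbarStar (ι : A →ₗ[k] H) : Set (Module.Dual k H) :=
  {f | ∀ x ∈ augHIdeal k A H ι, f x = 0}

/-- The tangential component `W(H°)`. -/
def tangential (ι : A →ₗ[k] H) : Set (Module.Dual k H) :=
  {f | f ∈ finDual k H ∧ ∃ n : ℕ, 0 < n ∧ ∀ x ∈ (augHIdeal k A H ι) ^ n, f x = 0}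

/-- The augmentation ideal of the commutative Hopf algebra `A`. -/
def augIdeal : Ideal A := RingHom.ker (Bialgebra.counitAlgHom k A)

/-- The irreducible component `A'` of `A°` containing the counit:
functionals vanishing on a power of the augmentation ideal. -/
def Aprime : Set (Module.Dual k A) :=
  {f | ∃ n : ℕ, 0 < n ∧ ∀ x ∈ (augIdeal k A) ^ n, f x = 0}

/-- The Lie algebra `𝔤` of `G_H`: primitive functionals on `A`. -/
def gLie : Set (Module.Dual k A) :=
  {f | f 1 = 0 ∧ ∀ x y : A, f (x * y) =
    f x * Coalgebra.counit (R := k) y + Coalgebra.counit (R := k) x * f y}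

/-- An ideal of `A` is `H̄`-stable if it is stable under the (left) adjoint
action of `H` on `A` (which factors through `H̄`). -/
def IsHStable (ι : A →ₗ[k] H) (I : Ideal A) : Prop :=
  ∀ (h : H), ∀ a ∈ I, ∃ b ∈ I, ι b = adl k H h (ι a)

/-- `mc` is the `H̄`-core of `m`: the largest `H̄`-stable ideal of `A`
contained in `m`. -/
def IsCore (ι : A →ₗ[k] H) (m mc : Ideal A) : Prop :=
  IsHStable k A H ι mc ∧ mc ≤ m ∧
    ∀ I : Ideal A, IsHStable k A H ι I → I ≤ m → I ≤ mc

/-- The submodule `H·J` of `H`, for an ideal `J` of `A`. -/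
def leftMul (ι : A →ₗ[k] H) (J : Ideal A) : Submodule k H :=
  Submodule.span k {x : H | ∃ (h : H), ∃ a ∈ J, x = h * ι a}

/-- The submodule `J·H` of `H`, for an ideal `J` of `A`. -/
def rightMul (ι : A →ₗ[k] H) (J : Ideal A) : Submodule k H :=
  Submodule.span k {x : H | ∃ (h : H), ∃ a ∈ J, x = ι a * h}

/-- The subcoalgebra `ĝ := (H/H m_g^{(H̄)})*` of `H°`, as a submodule of the dual. -/
def ghat (ι : A →ₗ[k] H) (core : Ideal A → Ideal A) (g : A →ₐ[k] k) :
    Submodule k (Module.Dual k H) :=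
  (leftMul k A H ι (core (RingHom.ker g))).dualAnnihilator

/-- The character component `k̂G_H` of `H°`. -/
def charComp (ι : A →ₗ[k] H) (core : Ideal A → Ideal A) :
    Set (Module.Dual k H) :=
  {f | ∃ s : Finset (A →ₐ[k] k), s.Nonempty ∧
    ∀ x ∈ ⨅ g ∈ s, leftMul k A H ι (core (RingHom.ker g)), f x = 0}

/-- Hypothesis (OrbSemi): all orbit algebras `A/m^{(H̄)}` are semisimple. -/
def OrbSemi (core : Ideal A → Ideal A) : Prop :=
  ∀ m : Ideal A, m.IsMaximal → IsSemisimpleRing (A ⧸ core m)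

/-- Restriction of functionals along `ι` : the map `ι° : H° → A°`. -/
def iotaDual (ι : A →ₗ[k] H) (f : Module.Dual k H) : Module.Dual k A := f ∘ₗ ι

/-- Coextension of functionals along the projection `Π : H → A`:
the map `Π° : A° → H°`. -/
def PiDual (p : H →ₗ[k] A) (α : Module.Dual k A) : Module.Dual k H := α ∘ₗ p

/-- `A ⊆ H` is an affine commutative-by-finite Hopf algebra, where the
inclusion of the commutative normal Hopf subalgebra `A` is recorded by the
injective Hopf algebra map `ι`. -/
structure CommByFinite (ι : A →ₗ[k] H) : Prop where
  ι_inj : Function.Injective ι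
  ι_one : ι 1 = 1
  ι_mul : ∀ a b : A, ι (a * b) = ι a * ι b
  ι_comul : ∀ a : A,
    Coalgebra.comul (R := k) (ι a) = TensorProduct.map ι ι (Coalgebra.comul a)
  ι_counit : ∀ a : A,
    Coalgebra.counit (R := k) (ι a) = Coalgebra.counit (R := k) a
  ι_antipode : ∀ a : A,
    ι (HopfAlgebra.antipode (R := k) a) = HopfAlgebra.antipode (R := k) (ι a)
  affine : ∃ s : Finset A, Algebra.adjoin k (s : Set A) = ⊤
  normal_left : ∀ (h : H) (a : A), adl k H h (ι a) ∈ Set.range ι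
  normal_right : ∀ (h : H) (a : A), adr k H h (ι a) ∈ Set.range ι
  finiteOver : ∃ s : Finset H,
    Submodule.span k {x : H | ∃ (a : A), ∃ y ∈ s, x = ι a * y} = ⊤

/-- The standing hypothesis: `A` is semiprime (reduced) or central in `H`,
or `H` is pointed. -/
def StandingHyp (ι : A →ₗ[k] H) : Prop :=
  IsReduced A ∨ (∀ (a : A) (h : H), ι a * h = h * ι a) ∨ IsPointedHopf k H

/-- `Π : H → A` is the projection of a direct sum decomposition
`H = A ⊕ X` of right `A`-modules. -/
structure IsSplitting (ι : A →ₗ[k] H) (p : H →ₗ[k] A) : Prop where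
  left_inv : ∀ a : A, p (ι a) = a
  right_linear : ∀ (h : H) (a : A), p (h * ι a) = p h * a

/-- Hypothesis (CoSplit) for a given splitting `Π`: the complement
`X = ker Π` is a coideal of `H`. -/
def CoSplit (p : H →ₗ[k] A) : Prop := IsCoideal k H (LinearMap.ker p)

end Ext

section Quot

variable (A : Type) [CommRing A] [HopfAlgebra k A]
variable (H : Type) [Ring H] [HopfAlgebra k H]
variable (Hb : Type) [Ring Hb] [HopfAlgebra k Hb]

/-- `π : H → H̄` realises `H̄` as the quotient Hopf algebra `H/A⁺H`. -/
structure IsHbarQuotient (ι : A →ₗ[k] H) (π : H →ₗ[k] Hb) : Prop where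
  π_surj : Function.Surjective π
  π_one : π 1 = 1
  π_mul : ∀ x y : H, π (x * y) = π x * π y
  π_comul : ∀ x : H,
    Coalgebra.comul (R := k) (π x) = TensorProduct.map π π (Coalgebra.comul x)
  π_counit : ∀ x : H,
    Coalgebra.counit (R := k) (π x) = Coalgebra.counit (R := k) x
  π_antipode : ∀ x : H,
    π (HopfAlgebra.antipode (R := k) x) = HopfAlgebra.antipode (R := k) (π x)
  π_ker : LinearMap.ker π = augHIdeal k A H ι
  findim : FiniteDimensional k Hb

/-- Composition with `π` : the map `π° : H̄* → H°`. -/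
def piDual (π : H →ₗ[k] Hb) (β : Module.Dual k Hb) : Module.Dual k H := β ∘ₗ π

end Quot

end

end Paper


namespace Paper12
open WithConv HopfAlgebra

section conv
variable {k : Type} [Field k] {H : Type} [Ring H] [HopfAlgebra k H]

lemma conv_apply {C M : Type} [AddCommMonoid C] [Module k C] [Coalgebra k C] [Ring M] [Algebra k M]
    (f g : C →ₗ[k] M) (x : C) :
    (toConv f * toConv g : WithConv (C →ₗ[k] M)).ofConv x
      = ∑ i ∈ (ℛ k x).index, f ((ℛ k x).left i) * g ((ℛ k x).right i) := by
  simpa using (ℛ k x).convMul_apply (toConv f) (toConv g)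

noncomputable def adlL (a : H) : H →ₗ[k] H :=
  TensorProduct.lift (((LinearMap.mul k H).comp (LinearMap.mulRight k a)).compl₂
    (HopfAlgebra.antipode (R := k))) ∘ₗ Coalgebra.comul

noncomputable def adrL (a : H) : H →ₗ[k] H :=
  TensorProduct.lift ((LinearMap.mul k H).comp ((LinearMap.mulRight k a) ∘ₗ
    (HopfAlgebra.antipode (R := k)))) ∘ₗ Coalgebra.comul

lemma adlL_apply (h a : H) : adlL (k := k) a h = Paper.adl k H h a := rfl

lemma adrL_apply (h a : H) : adrL (k := k) a h = Paper.adr k H h a := rfl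

lemma adlL_conv (a : H) : toConv (adlL (k := k) a) =
    toConv (LinearMap.mulRight k a) * toConv (antipode k) := by
  apply WithConv.ext
  rw [LinearMap.convMul_def]
  change _ = LinearMap.mul' k H ∘ₗ (TensorProduct.map _ _ ∘ₗ _)
  rw [← LinearMap.comp_assoc]
  unfold adlL
  change _ ∘ₗ comul = _
  congr 1
  apply TensorProduct.ext'
  intro x y
  simp

lemma adrL_conv (a : H) : toConv (adrL (k := k) a) =
    toConv (antipode k) * toConv (LinearMap.mulLeft k a) := by
  apply WithConv.ext
  rw [LinearMap.convMul_def]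
  change _ = LinearMap.mul' k H ∘ₗ (TensorProduct.map _ _ ∘ₗ _)
  rw [← LinearMap.comp_assoc]
  unfold adrL
  change _ ∘ₗ comul = _
  congr 1
  apply TensorProduct.ext'
  intro x y
  simp [mul_assoc]

lemma adl_id (a : H) : toConv (adlL (k := k) a) * toConv LinearMap.id =
    toConv (LinearMap.mulRight k a) := by
  rw [adlL_conv, mul_assoc, LinearMap.antipode_mul_id, mul_one]

lemma id_adr (a : H) : toConv LinearMap.id * toConv (adrL (k := k) a) =
    toConv (LinearMap.mulLeft k a) := by
  rw [adrL_conv, ← mul_assoc, LinearMap.id_mul_antipode, one_mul]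

lemma mul_eq_adl (h a : H) : h * a = ∑ i ∈ (ℛ k h).index,
    Paper.adl k H ((ℛ k h).left i) a * (ℛ k h).right i := by
  have := congr(($(adl_id (k := k) a)).ofConv h)
  rw [conv_apply] at this
  simpa [adlL_apply, adrL_apply] using this.symm

lemma mul_eq_adr (h a : H) : a * h = ∑ i ∈ (ℛ k h).index,
    (ℛ k h).left i * Paper.adr k H ((ℛ k h).right i) a := by
  have := congr(($(id_adr (k := k) a)).ofConv h)
  rw [conv_apply] at this
  simpa [adlL_apply, adrL_apply] using this.symm

lemma adl_eq (h a : H) : Paper.adl k H h a = ∑ i ∈ (ℛ k h).index,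
    (ℛ k h).left i * a * antipode k ((ℛ k h).right i) := by
  have := congr(($(adlL_conv (k := k) a)).ofConv h)
  rw [conv_apply] at this
  simpa [adlL_apply, adrL_apply] using this

lemma adr_eq (h a : H) : Paper.adr k H h a = ∑ i ∈ (ℛ k h).index,
    antipode k ((ℛ k h).left i) * (a * (ℛ k h).right i) := by
  have := congr(($(adrL_conv (k := k) a)).ofConv h)
  rw [conv_apply] at this
  simpa [adlL_apply, adrL_apply] using this

/-- antipode is an anti-coalgebra map -/
lemma comul_antipode : (comul ∘ₗ antipode k : H →ₗ[k] H ⊗[k] H) =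
    TensorProduct.map (antipode k) (antipode k) ∘ₗ (TensorProduct.comm k H H).toLinearMap ∘ₗ comul := by
  let i1 : H →ₐ[k] H ⊗[k] H := Algebra.TensorProduct.includeLeft
  let i2 : H →ₐ[k] H ⊗[k] H := Algebra.TensorProduct.includeRight
  have key : ∀ (i : H →ₐ[k] H ⊗[k] H) (f g : H →ₗ[k] H), toConv f * toConv g = 1 →
      toConv (i.toLinearMap ∘ₗ f) * toConv (i.toLinearMap ∘ₗ g) = 1 := by
    intro i f g hfg
    apply WithConv.ext; ext x
    have := congr(i (($hfg).ofConv x))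
    rw [conv_apply] at this ⊢
    simpa [adlL_apply, adrL_apply] using this
  have hd : toConv (comul : H →ₗ[k] H ⊗[k] H) = toConv (i1.toLinearMap ∘ₗ LinearMap.id) *
      toConv (i2.toLinearMap ∘ₗ LinearMap.id) := by
    apply WithConv.ext; ext x
    rw [conv_apply]
    simp [i1, i2, (ℛ k x).eq]
  have hG : toConv (TensorProduct.map (antipode k) (antipode k) ∘ₗ
      (TensorProduct.comm k H H).toLinearMap ∘ₗ comul) = toConv (i2.toLinearMap ∘ₗ antipode k) *
      toConv (i1.toLinearMap ∘ₗ antipode k) := by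
    apply WithConv.ext; ext x
    rw [conv_apply]
    conv_lhs => simp only [ofConv_toConv, LinearMap.comp_apply]
    rw [← (ℛ k x).eq]
    simp [i1, i2, map_sum]
  have h1 := LinearMap.comul_right_inv (R := k) (C := H)
  have h2 : toConv (TensorProduct.map (antipode k) (antipode k) ∘ₗ
      (TensorProduct.comm k H H).toLinearMap ∘ₗ comul) * toConv (comul : H →ₗ[k] H ⊗[k] H) = 1 := by
    rw [hG, hd, mul_assoc, ← mul_assoc (toConv (i1.toLinearMap ∘ₗ antipode k)),
      key i1 _ _ (LinearMap.antipode_mul_id), one_mul, key i2 _ _ (LinearMap.antipode_mul_id)]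
  exact (congr(($(left_inv_eq_right_inv h2 h1)).ofConv)).symm

end conv

/-- On a commutative Hopf algebra the antipode is an involution. -/
lemma antipode_invol {k : Type} [Field k] {A : Type} [CommRing A] [HopfAlgebra k A] (a : A) :
    antipode k (antipode k a) = a := by
  have h1 : toConv (antipode k (A := A)) * toConv (antipode k ∘ₗ antipode k) = 1 := by
    apply WithConv.ext; ext x
    have := congr(antipode k (($(LinearMap.id_mul_antipode (R := k) (C := A))).ofConv x))
    rw [conv_apply] at this ⊢
    simpa [antipode_mul_distrib, Algebra.algebraMap_eq_smul_one] using this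
  have h2 := LinearMap.id_mul_antipode (R := k) (C := A)
  exact (congr(($(left_inv_eq_right_inv h2 h1)).ofConv a)).symm

section LS
variable {k : Type} [Field k] {H : Type} [Ring H] [HopfAlgebra k H]

def IsCo (f : H →ₗ[k] H) : Prop :=
  comul ∘ₗ f = TensorProduct.map f f ∘ₗ comul ∧ counit ∘ₗ f = (counit : H →ₗ[k] k)

def IsAntiCo (f : H →ₗ[k] H) : Prop :=
  comul ∘ₗ f = TensorProduct.map f f ∘ₗ (TensorProduct.comm k H H).toLinearMap ∘ₗ comul ∧
    counit ∘ₗ f = (counit : H →ₗ[k] k)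

lemma isCo_id : IsCo (LinearMap.id : H →ₗ[k] H) := ⟨by simp, by simp⟩

lemma IsCo.anti {f : H →ₗ[k] H} (hf : IsCo f) : IsAntiCo (antipode k ∘ₗ f) := by
  refine ⟨?_, ?_⟩
  · rw [← LinearMap.comp_assoc, comul_antipode, LinearMap.comp_assoc, LinearMap.comp_assoc, hf.1]
    ext x
    simp only [LinearMap.comp_apply]
    generalize comul (R := k) x = z
    induction z using TensorProduct.induction_on with
    | zero => simp
    | tmul a b => simp
    | add a b ha hb => simp only [map_add, ha, hb]
  · rw [← LinearMap.comp_assoc, counit_comp_antipode, hf.2]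

lemma IsAntiCo.co {f : H →ₗ[k] H} (hf : IsAntiCo f) : IsCo (antipode k ∘ₗ f) := by
  refine ⟨?_, ?_⟩
  · rw [← LinearMap.comp_assoc, comul_antipode, LinearMap.comp_assoc, LinearMap.comp_assoc, hf.1]
    ext x
    simp only [LinearMap.comp_apply]
    generalize comul (R := k) x = z
    induction z using TensorProduct.induction_on with
    | zero => simp
    | tmul a b => simp
    | add a b ha hb => simp only [map_add, ha, hb]
  · rw [← LinearMap.comp_assoc, counit_comp_antipode, hf.2]

lemma IsCo.cancel {f g : H →ₗ[k] H} (hf : IsCo f) (hg : IsCo g)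
    (h : antipode k ∘ₗ f = antipode k ∘ₗ g) : f = g := by
  have key : ∀ f : H →ₗ[k] H, IsCo f → toConv f * toConv (antipode k ∘ₗ f) = 1 ∧
      toConv (antipode k ∘ₗ f) * toConv f = 1 := by
    intro f hf
    constructor
    · apply WithConv.ext; ext x
      have h1 := mul_antipode_lTensor_comul_apply (R := k) (f x)
      have h2 : comul (R := k) (f x) = TensorProduct.map f f (comul x) := congr($(hf.1) x)
      have h3 : counit (R := k) (f x) = counit x := congr($(hf.2) x)
      rw [h2, h3, ← (ℛ k x).eq] at h1
      rw [conv_apply]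
      simpa [map_sum] using h1
    · apply WithConv.ext; ext x
      have h1 := mul_antipode_rTensor_comul_apply (R := k) (f x)
      have h2 : comul (R := k) (f x) = TensorProduct.map f f (comul x) := congr($(hf.1) x)
      have h3 : counit (R := k) (f x) = counit x := congr($(hf.2) x)
      rw [h2, h3, ← (ℛ k x).eq] at h1
      rw [conv_apply]
      simpa [map_sum] using h1
  have h2 := (key g hg).2
  rw [← h] at h2
  exact congr(($(left_inv_eq_right_inv (key f hf).1 h2)).ofConv)

lemma IsAntiCo.cancel {f g : H →ₗ[k] H} (hf : IsAntiCo f) (hg : IsAntiCo g)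
    (h : antipode k ∘ₗ f = antipode k ∘ₗ g) : f = g := by
  let o : H →ₗ[k] Hᵐᵒᵖ := (MulOpposite.opLinearEquiv k).toLinearMap
  have key : ∀ f : H →ₗ[k] H, IsAntiCo f →
      toConv (o ∘ₗ f) * toConv (o ∘ₗ antipode k ∘ₗ f) = 1 ∧
      toConv (o ∘ₗ antipode k ∘ₗ f) * toConv (o ∘ₗ f) = 1 := by
    intro f hf
    have h2 : ∀ x, comul (R := k) (f x) = TensorProduct.map f f (TensorProduct.comm k H H (comul x)) :=
      fun x => congr($(hf.1) x)
    have h3 : ∀ x, counit (R := k) (f x) = counit x := fun x => congr($(hf.2) x)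
    constructor
    · apply WithConv.ext; ext x
      have h1 := mul_antipode_rTensor_comul_apply (R := k) (f x)
      rw [h2, h3, ← (ℛ k x).eq] at h1
      rw [conv_apply]
      simpa [map_sum, o] using congr(MulOpposite.op $h1)
    · apply WithConv.ext; ext x
      have h1 := mul_antipode_lTensor_comul_apply (R := k) (f x)
      rw [h2, h3, ← (ℛ k x).eq] at h1
      rw [conv_apply]
      simpa [map_sum, o] using congr(MulOpposite.op $h1)
  have h2 := (key g hg).2
  rw [← h] at h2
  have h3 := congr(($(left_inv_eq_right_inv (key f hf).1 h2)).ofConv)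
  ext x
  exact MulOpposite.op_injective congr($h3 x)

/-- the square of the antipode -/
noncomputable def S2 : Module.End k H := antipode k ∘ₗ antipode k

lemma S2_pow_co (n : ℕ) {f : H →ₗ[k] H} (hf : IsCo f) :
    IsCo (((S2 : Module.End k H) ^ n) ∘ₗ f) := by
  induction n with
  | zero => exact hf
  | succ n ih =>
    rw [pow_succ']
    exact ih.anti.co

lemma S2_pow_cancel (n : ℕ) {f g : H →ₗ[k] H} (hf : IsCo f) (hg : IsCo g)
    (h : ((S2 : Module.End k H) ^ n) ∘ₗ f = ((S2 : Module.End k H) ^ n) ∘ₗ g) : f = g := by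
  induction n with
  | zero => exact h
  | succ n ih =>
    apply ih
    rw [pow_succ'] at h
    exact (S2_pow_co n hf).cancel (S2_pow_co n hg)
      ((S2_pow_co n hf).anti.cancel (S2_pow_co n hg).anti h)

lemma exists_drazin {V : Type} [AddCommGroup V] [Module k V] [FiniteDimensional k V]
    (s : Module.End k V) : ∃ (n : ℕ) (u : Module.End k V), 0 < n ∧ Commute s u ∧
      s ^ n = u * (s ^ n * s ^ n) := by
  let R := Algebra.adjoin k {s}
  let _ : CommRing R := Algebra.adjoinCommRingOfComm k (by
    intro a ha b hb; simp only [Set.mem_singleton_iff] at ha hb; rw [ha, hb])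
  have : IsArtinianRing R := by
    have : IsArtinian k R := inferInstance
    exact isArtinian_of_tower k this
  let r : R := ⟨s, Algebra.subset_adjoin rfl⟩
  obtain ⟨n0, y, hy⟩ := IsArtinian.exists_pow_succ_smul_dvd r (1 : R)
  obtain ⟨n, hn⟩ : ∃ n, n = n0 + 1 := ⟨_, rfl⟩
  have hy1 : r ^ n = r ^ n * (r * y) := by
    simp only [smul_eq_mul, mul_one, Nat.succ_eq_add_one] at hy
    rw [hn, ← mul_assoc, ← pow_succ]
    calc r ^ (n0 + 1) = r * r ^ n0 := pow_succ' _ _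
      _ = r * (r ^ (n0 + 1) * y) := by rw [hy]
      _ = _ := by ring
  have hy2 : ∀ m, r ^ n = r ^ n * (r * y) ^ m := by
    intro m
    induction m with
    | zero => simp
    | succ m ih => rw [pow_succ, ← mul_assoc, ← ih, ← hy1]
  have hy3 : r ^ n = y ^ n * (r ^ n * r ^ n) := by
    have := hy2 n
    rw [mul_pow] at this
    calc r ^ n = _ := this
      _ = _ := by ring
  refine ⟨n, ((y ^ n : R) : Module.End k V), by omega, ?_, ?_⟩
  · have := mul_comm r (y ^ n)
    exact congr(($this : Module.End k V))
  · exact congr(($hy3 : Module.End k V))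

theorem antipode_surj_of_finite [FiniteDimensional k H] :
    Function.Surjective (antipode k : H →ₗ[k] H) := by
  obtain ⟨n, u, h0, hc, hu⟩ := exists_drazin (S2 : Module.End k H)
  set T : Module.End k H := S2 ^ n with hT
  have hc : T * u = u * T := (hc.pow_left n)
  have hTco : IsCo T := by simpa using S2_pow_co n (isCo_id (k := k) (H := H))
  have hTc : ∀ x, comul (R := k) (T x) = TensorProduct.map T T (comul x) := fun x => congr($(hTco.1) x)
  have e1 : ∀ x, T (u (T x)) = T x := by
    intro x
    have := congr($hu x)
    have h2 := congr($hc (T x))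
    simp only [Module.End.mul_apply] at this h2
    rw [h2, ← this]
  have e2 : ∀ x, u (T x) = T (u x) := fun x => congr($hc.symm x)
  have eco : IsCo (u ∘ₗ T) := by
    constructor
    · ext x
      simp only [LinearMap.comp_apply]
      have a1 : TensorProduct.map (u ∘ₗ T) (u ∘ₗ T) (comul x)
          = TensorProduct.map u u (comul (R := k) (T x)) := by
        rw [hTc, TensorProduct.map_map]
      have h3 : u ∘ₗ (T ∘ₗ T) = T := hu.symm
      have a2 : T x = T (T (u x)) := by rw [← e2, e1]
      rw [a1, a2, hTc, hTc, TensorProduct.map_map, TensorProduct.map_map, LinearMap.comp_assoc,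
        h3, ← hTc]
      exact congr(comul (R := k) ($h3 (u x)))
    · ext x
      have h3 : ∀ x, counit (R := k) (T x) = counit x := fun x => congr($(hTco.2) x)
      simp only [LinearMap.comp_apply]
      rw [← h3 (u (T x)), e1, h3]
  have : u ∘ₗ T = LinearMap.id := by
    apply S2_pow_cancel n eco isCo_id
    ext x
    exact e1 x
  have hTinj : Function.Injective (T : H →ₗ[k] H) := by
    intro x y hxy
    have h1 := congr($this x)
    have h2 := congr($this y)
    simp only [LinearMap.comp_apply, LinearMap.id_apply] at h1 h2
    rw [← h1, ← h2, hxy]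
  have hinj : Function.Injective (antipode k : H →ₗ[k] H) := by
    rw [← LinearMap.ker_eq_bot, LinearMap.ker_eq_bot']
    intro x hx
    obtain ⟨m, rfl⟩ := Nat.exists_eq_succ_of_ne_zero h0.ne'
    apply hTinj
    rw [hT, pow_succ]
    simp [S2, hx]
  exact LinearMap.injective_iff_surjective.mp hinj

end LS

section Ideals
open Paper
variable {k : Type} [Field k] {A : Type} [CommRing A] [HopfAlgebra k A]
  {H : Type} [Ring H] [HopfAlgebra k H] {ι : A →ₗ[k] H} {p : H →ₗ[k] A}

/-- two-sided ideal, as a subspace -/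
def IsTwo (I : Submodule k H) : Prop := ∀ (h : H), ∀ x ∈ I, h * x ∈ I ∧ x * h ∈ I

lemma mem_leftMul {J : Ideal A} (h : H) {a : A} (ha : a ∈ J) : h * ι a ∈ leftMul k A H ι J :=
  Submodule.subset_span ⟨h, a, ha, rfl⟩

lemma mem_rightMul {J : Ideal A} (h : H) {a : A} (ha : a ∈ J) : ι a * h ∈ rightMul k A H ι J :=
  Submodule.subset_span ⟨h, a, ha, rfl⟩

lemma leftMul_le {J : Ideal A} {M : Submodule k H} (hM : ∀ h : H, ∀ a ∈ J, h * ι a ∈ M) :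
    leftMul k A H ι J ≤ M := by
  apply Submodule.span_le.mpr
  rintro _ ⟨h, a, ha, rfl⟩
  exact hM h a ha

lemma rightMul_le {J : Ideal A} {M : Submodule k H} (hM : ∀ h : H, ∀ a ∈ J, ι a * h ∈ M) :
    rightMul k A H ι J ≤ M := by
  apply Submodule.span_le.mpr
  rintro _ ⟨h, a, ha, rfl⟩
  exact hM h a ha

lemma leftMul_mono {J K : Ideal A} (h : J ≤ K) : leftMul k A H ι J ≤ leftMul k A H ι K :=
  leftMul_le fun x _ ha => mem_leftMul x (h ha)

lemma leftMul_mul_left (J : Ideal A) (h : H) {x : H} (hx : x ∈ leftMul k A H ι J) :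
    h * x ∈ leftMul k A H ι J := by
  have : leftMul k A H ι J ≤ (leftMul k A H ι J).comap (LinearMap.mulLeft k h) := by
    apply leftMul_le
    intro y a ha
    simp only [Submodule.mem_comap, LinearMap.mulLeft_apply, ← mul_assoc]
    exact mem_leftMul _ ha
  exact this hx

lemma rightMul_mul_right (J : Ideal A) (h : H) {x : H} (hx : x ∈ rightMul k A H ι J) :
    x * h ∈ rightMul k A H ι J := by
  have : rightMul k A H ι J ≤ (rightMul k A H ι J).comap (LinearMap.mulRight k h) := by
    apply rightMul_le
    intro y a ha
    simp only [Submodule.mem_comap, LinearMap.mulRight_apply, mul_assoc]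
    exact mem_rightMul _ ha
  exact this hx

lemma leftMul_contract (hp : IsSplitting k A H ι p) {J : Ideal A} {a : A}
    (ha : ι a ∈ leftMul k A H ι J) : a ∈ J := by
  have : leftMul k A H ι J ≤ (J.restrictScalars k).comap p := by
    apply leftMul_le
    intro y b hb
    simp only [Submodule.mem_comap, hp.right_linear, Submodule.restrictScalars_mem]
    exact J.mul_mem_left _ hb
  simpa [hp.left_inv] using this ha

/-- antipode of `A` as ring hom -/
noncomputable def SA (k A : Type) [Field k] [CommRing A] [HopfAlgebra k A] : A →+* A where
  toFun := antipode k
  map_one' := antipode_one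
  map_mul' := antipode_mul_distrib
  map_zero' := map_zero _
  map_add' := map_add _

lemma SA_apply (a : A) : SA k A a = antipode k a := rfl
lemma SA_SA (a : A) : SA k A (SA k A a) = a := antipode_invol a

lemma rightMul_contract (hC : CommByFinite k A H ι) (hp : IsSplitting k A H ι p) {J : Ideal A} {a : A}
    (ha : ι a ∈ rightMul k A H ι J) : a ∈ J := by
  have : rightMul k A H ι J ≤ (leftMul k A H ι (J.comap (SA k A))).comap (antipode k) := by
    apply rightMul_le
    intro y b hb
    simp only [Submodule.mem_comap, antipode_mul_antidistrib, ← hC.ι_antipode]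
    apply mem_leftMul
    rw [Ideal.mem_comap]
    change SA k A (SA k A b) ∈ J
    rwa [SA_SA]
  have h2 := this ha
  simp only [Submodule.mem_comap, ← hC.ι_antipode] at h2
  have h3 := leftMul_contract hp h2
  rw [Ideal.mem_comap] at h3
  change SA k A (SA k A a) ∈ J at h3
  rwa [SA_SA] at h3

/-- contraction of a two-sided ideal -/
def contract (hC : CommByFinite k A H ι) (I : Submodule k H) (hI : IsTwo I) : Ideal A where
  carrier := {a | ι a ∈ I}
  add_mem' := fun ha hb => by simp only [Set.mem_ofPred_eq, map_add] at *; exact I.add_mem ha hb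
  zero_mem' := by simp
  smul_mem' := fun c a ha => by
    simp only [Set.mem_ofPred_eq, smul_eq_mul, hC.ι_mul] at *
    exact (hI _ _ ha).1

lemma mem_contract {hC : CommByFinite k A H ι} {I : Submodule k H} {hI : IsTwo I} {a : A} :
    a ∈ contract hC I hI ↔ ι a ∈ I := Iff.rfl

lemma contract_stable (hC : CommByFinite k A H ι) (I : Submodule k H) (hI : IsTwo I) :
    IsHStable k A H ι (contract hC I hI) := by
  intro h a ha
  obtain ⟨b, hb⟩ := hC.normal_left h a
  refine ⟨b, ?_, hb⟩
  rw [mem_contract, hb, adl_eq]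
  exact I.sum_mem fun i _ => (hI _ _ (hI _ _ ha).1).2

lemma contract_adr (hC : CommByFinite k A H ι) (I : Submodule k H) (hI : IsTwo I)
    (h : H) {a : A} (ha : a ∈ contract hC I hI) :
    ∃ b ∈ contract hC I hI, ι b = adr k H h (ι a) := by
  obtain ⟨b, hb⟩ := hC.normal_right h a
  refine ⟨b, ?_, hb⟩
  rw [mem_contract, hb, adr_eq]
  exact I.sum_mem fun i _ => (hI _ _ (hI _ _ ha).2).1

lemma rightMul_two {J : Ideal A} (hJ : IsHStable k A H ι J) : IsTwo (rightMul k A H ι J) := by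
  intro h x hx
  refine ⟨?_, rightMul_mul_right J h hx⟩
  have : rightMul k A H ι J ≤ (rightMul k A H ι J).comap (LinearMap.mulLeft k h) := by
    apply rightMul_le
    intro y a ha
    simp only [Submodule.mem_comap, LinearMap.mulLeft_apply, ← mul_assoc]
    apply rightMul_mul_right
    rw [mul_eq_adl (k := k) h (ι a)]
    refine Submodule.sum_mem _ fun i _ => ?_
    obtain ⟨b, hb, hb2⟩ := hJ ((ℛ k h).left i) a ha
    rw [← hb2]
    exact mem_rightMul _ hb
  exact this hx

lemma contract_rightMul (hC : CommByFinite k A H ι) (hp : IsSplitting k A H ι p) {J : Ideal A}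
    (hJ : IsHStable k A H ι J) : contract hC _ (rightMul_two hJ) = J := by
  ext a
  rw [mem_contract]
  refine ⟨rightMul_contract hC hp, fun ha => ?_⟩
  simpa using mem_rightMul (k := k) (ι := ι) (1 : H) ha

lemma leftMul_eq (hC : CommByFinite k A H ι) (hp : IsSplitting k A H ι p) {J : Ideal A}
    (hJ : IsHStable k A H ι J) : leftMul k A H ι J = rightMul k A H ι J := by
  apply le_antisymm
  · apply leftMul_le
    intro h a ha
    refine (rightMul_two hJ h _ ?_).1
    simpa using mem_rightMul (k := k) (ι := ι) (1 : H) ha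
  · apply rightMul_le
    intro h a ha
    rw [mul_eq_adr (k := k) h (ι a)]
    refine Submodule.sum_mem _ fun i _ => ?_
    rw [← contract_rightMul hC hp hJ] at ha
    obtain ⟨b, hb, hb2⟩ := contract_adr hC _ _ ((ℛ k h).right i) ha
    rw [contract_rightMul hC hp hJ] at hb
    rw [← hb2]
    exact mem_leftMul _ hb

lemma leftMul_two (hC : CommByFinite k A H ι) (hp : IsSplitting k A H ι p) {J : Ideal A}
    (hJ : IsHStable k A H ι J) : IsTwo (leftMul k A H ι J) := by
  rw [leftMul_eq hC hp hJ]; exact rightMul_two hJ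

lemma finite_rightMul (hC : CommByFinite k A H ι) {J : Ideal A}
    (hJ : FiniteDimensional k (A ⧸ J.restrictScalars k)) :
    FiniteDimensional k (H ⧸ rightMul k A H ι J) := by
  obtain ⟨s, hs⟩ := hC.finiteOver
  let φ : H → (A ⧸ J.restrictScalars k) →ₗ[k] (H ⧸ rightMul k A H ι J) := fun y =>
    (J.restrictScalars k).mapQ (rightMul k A H ι J) (LinearMap.mulRight k y ∘ₗ ι)
      (fun a ha => mem_rightMul y ha)
  have h1 : FiniteDimensional k (⨆ y ∈ s, LinearMap.range (φ y) : Submodule k _) :=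
    by rw [← Finset.sup_eq_iSup]; exact Submodule.finiteDimensional_finset_sup s _
  have h2 : (⨆ y ∈ s, LinearMap.range (φ y) : Submodule k _) = ⊤ := by
    rw [eq_top_iff, ← Submodule.range_mkQ, LinearMap.range_eq_map, ← hs, Submodule.map_le_iff_le_comap,
      Submodule.span_le]
    rintro _ ⟨a, y, hy, rfl⟩
    refine Submodule.mem_iSup_of_mem y (Submodule.mem_iSup_of_mem hy ⟨Submodule.Quotient.mk a, rfl⟩)
  rw [h2] at h1
  exact Module.Finite.equiv (Submodule.topEquiv)

lemma finite_of_le {V : Type} [AddCommGroup V] [Module k V] {M N : Submodule k V} (h : M ≤ N)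
    (hM : FiniteDimensional k (V ⧸ M)) : FiniteDimensional k (V ⧸ N) :=
  Module.Finite.of_surjective (Submodule.factor h) (Submodule.factor_surjective h)

lemma core_finite (hC : CommByFinite k A H ι) (hp : IsSplitting k A H ι p) (g : A →ₐ[k] k)
    {J : Ideal A} (hJ : IsCore k A H ι (RingHom.ker g) J) :
    FiniteDimensional k (A ⧸ J.restrictScalars k) := by
  have h1 : FiniteDimensional k (A ⧸ (RingHom.ker g).restrictScalars k) := by
    have : (RingHom.ker g).restrictScalars k = LinearMap.ker g.toLinearMap := rfl
    rw [this]
    exact Module.Finite.equiv (g.toLinearMap.quotKerEquivRange).symm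
  have h2 := finite_rightMul hC h1
  set M := rightMul k A H ι (RingHom.ker g) with hM
  let R : H →ₗ[k] Module.End k (H ⧸ M) :=
    { toFun := fun x => M.mapQ M (LinearMap.mulRight k x) (fun y hy => rightMul_mul_right _ x hy)
      map_add' := fun x y => by
        ext z
        change (Submodule.Quotient.mk (z * (x + y)) : H ⧸ M) = Submodule.Quotient.mk (z * x + z * y)
        rw [mul_add]
      map_smul' := fun c y => by
        ext z
        change (Submodule.Quotient.mk (z * (c • y)) : H ⧸ M) = Submodule.Quotient.mk (c • (z * y))
        rw [mul_smul_comm] }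
  have hR : ∀ x, x ∈ LinearMap.ker R ↔ ∀ h : H, h * x ∈ M := by
    intro x
    rw [LinearMap.mem_ker]
    constructor
    · intro hx h
      have := congr($hx (Submodule.Quotient.mk h))
      exact (Submodule.Quotient.mk_eq_zero M).mp this
    · intro hx
      ext h
      exact (Submodule.Quotient.mk_eq_zero M).mpr (hx h)
  have hI : IsTwo (LinearMap.ker R) := by
    intro h x hx
    rw [hR] at hx
    simp only [hR]
    refine ⟨fun y => ?_, fun y => ?_⟩
    · rw [← mul_assoc]; exact hx _
    · rw [← mul_assoc]; exact rightMul_mul_right _ _ (hx _)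
  have h3 : FiniteDimensional k (H ⧸ LinearMap.ker R) := Module.Finite.equiv (R.quotKerEquivRange).symm
  have h4 : contract hC _ hI ≤ J := by
    apply hJ.2.2 _ (contract_stable hC _ hI)
    intro a ha
    rw [mem_contract, hR] at ha
    apply rightMul_contract hC hp (k := k) (H := H) (ι := ι)
    simpa using ha 1
  have h5 : FiniteDimensional k (A ⧸ (contract hC _ hI).restrictScalars k) := by
    have : (contract hC _ hI).restrictScalars k = LinearMap.ker ((LinearMap.ker R).mkQ ∘ₗ ι) := by
      ext a
      rw [LinearMap.ker_comp, Submodule.ker_mkQ]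
      rfl
    rw [this]
    exact Module.Finite.equiv (LinearMap.quotKerEquivRange _).symm
  exact finite_of_le (fun a ha => h4 ha) h5

lemma core_simple (hC : CommByFinite k A H ι) (hp : IsSplitting k A H ι p) (g : A →ₐ[k] k)
    {J : Ideal A} (hJ : IsCore k A H ι (RingHom.ker g) J) {I : Ideal A}
    (hI : IsHStable k A H ι I) (hJI : J ≤ I) (hIg : ¬ I ≤ RingHom.ker g) : I = ⊤ := by
  have hJ2 := rightMul_two hJ.1
  have hI2 := rightMul_two hI
  let X : Submodule k H :=
    { carrier := {x | ∀ y ∈ rightMul k A H ι I, x * y ∈ rightMul k A H ι J}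
      add_mem' := fun ha hb y hy => by rw [add_mul]; exact add_mem (ha y hy) (hb y hy)
      zero_mem' := fun y hy => by simp
      smul_mem' := fun c x hx y hy => by
        rw [smul_mul_assoc]; exact Submodule.smul_mem _ _ (hx y hy) }
  have hX : IsTwo X := by
    intro h x hx
    refine ⟨fun y hy => ?_, fun y hy => ?_⟩
    · rw [mul_assoc]; exact (hJ2 _ _ (hx y hy)).1
    · rw [mul_assoc]; exact hx _ (hI2 _ _ hy).1
  have hXm : ∀ a, (∀ b ∈ I, a * b ∈ J) → a ∈ contract hC X hX := by
    intro a ha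
    rw [mem_contract]
    have : rightMul k A H ι I ≤ (rightMul k A H ι J).comap (LinearMap.mulLeft k (ι a)) := by
      apply rightMul_le
      intro h b hb
      simp only [Submodule.mem_comap, LinearMap.mulLeft_apply, ← mul_assoc, ← hC.ι_mul]
      exact mem_rightMul _ (ha b hb)
    exact fun y hy => this hy
  have hXJ : contract hC X hX ≤ J := by
    apply hJ.2.2 _ (contract_stable hC _ hX)
    have hpr : (RingHom.ker g).IsPrime := RingHom.ker_isPrime _
    obtain ⟨b, hb, hbg⟩ := Set.not_subset.mp hIg
    intro a ha
    have h1 : a * b ∈ J := by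
      apply rightMul_contract hC hp (k := k) (H := H) (ι := ι)
      rw [hC.ι_mul]
      apply ha
      simpa using mem_rightMul (k := k) (ι := ι) (1 : H) hb
    exact (hpr.mem_or_mem (hJ.2.1 h1)).resolve_right hbg
  have hpow : ∀ n : ℕ, ∀ a, (∀ b ∈ I ^ n, a * b ∈ J) → a ∈ J := by
    intro n
    induction n with
    | zero => intro a ha; simpa using ha 1 (by simp)
    | succ n ih =>
      intro a ha
      apply ih
      intro b hb
      apply hXJ
      apply hXm
      intro c hc
      rw [mul_assoc]
      apply ha
      rw [pow_succ]
      exact Ideal.mul_mem_mul hb hc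
  have hfin := core_finite hC hp g hJ
  have hfin' : Module.Finite k (A ⧸ J) := hfin
  have : IsArtinianRing (A ⧸ J) := isArtinian_of_tower k (inferInstance : IsArtinian k (A ⧸ J))
  let q := Ideal.Quotient.mk J
  obtain ⟨n, hn⟩ := IsArtinian.monotone_stabilizes (R := A ⧸ J) (M := A ⧸ J)
    ⟨fun n => OrderDual.toDual ((I.map q) ^ n), fun a b hab => Ideal.pow_le_pow_right hab⟩
  have hn1 : (I.map q) ^ n = (I.map q) ^ (n + 1) := hn (n + 1) (by omega)
  obtain ⟨r, hr1, hr2⟩ := Submodule.exists_sub_one_mem_and_smul_eq_zero_of_fg_of_le_smul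
    (I.map q) ((I.map q) ^ n) (IsNoetherian.noetherian _)
    (by rw [smul_eq_mul, ← pow_succ', ← hn1])
  obtain ⟨r, rfl⟩ := Ideal.Quotient.mk_surjective r
  have hrJ : r ∈ J := by
    apply hpow n
    intro b hb
    rw [← Ideal.Quotient.eq_zero_iff_mem, map_mul]
    apply hr2
    rw [← Ideal.map_pow]
    exact Ideal.mem_map_of_mem _ hb
  rw [Ideal.Quotient.eq_zero_iff_mem.mpr hrJ, zero_sub] at hr1
  have h1 : q 1 ∈ I.map q := by simpa using neg_mem hr1
  rw [Ideal.mem_map_iff_of_surjective q Ideal.Quotient.mk_surjective] at h1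
  obtain ⟨x, hx, hx1⟩ := h1
  have : 1 - x ∈ J := by rw [← Ideal.Quotient.eq_zero_iff_mem, map_sub]; exact sub_eq_zero.mpr hx1.symm
  rw [Ideal.eq_top_iff_one]
  simpa using I.add_mem (hJI this) hx

lemma stable_sup {I J : Ideal A} (hI : IsHStable k A H ι I) (hJ : IsHStable k A H ι J) :
    IsHStable k A H ι (I ⊔ J) := by
  intro h a ha
  obtain ⟨b, hb, c, hc, rfl⟩ := Submodule.mem_sup.mp ha
  obtain ⟨b', hb', hb2⟩ := hI h b hb
  obtain ⟨c', hc', hc2⟩ := hJ h c hc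
  refine ⟨b' + c', Submodule.add_mem_sup hb' hc', ?_⟩
  rw [map_add, hb2, hc2, adl_eq, adl_eq, adl_eq, ← Finset.sum_add_distrib]
  simp [mul_add, add_mul]

lemma core_comax (hC : CommByFinite k A H ι) (hp : IsSplitting k A H ι p) {g g' : A →ₐ[k] k}
    {J J' : Ideal A} (hJ : IsCore k A H ι (RingHom.ker g) J)
    (hJ' : IsCore k A H ι (RingHom.ker g') J') (hne : J ≠ J') : J ⊔ J' = ⊤ := by
  have hs := stable_sup hJ.1 hJ'.1
  by_contra hcon
  have h1 : J ⊔ J' ≤ RingHom.ker g := by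
    by_contra h; exact hcon (core_simple hC hp g hJ hs le_sup_left h)
  have h2 : J ⊔ J' ≤ RingHom.ker g' := by
    by_contra h; exact hcon (core_simple hC hp g' hJ' hs le_sup_right h)
  have h3 := hJ.2.2 _ hs h1
  have h4 := hJ'.2.2 _ hs h2
  exact hne (le_antisymm (le_sup_left.trans h4) (le_sup_right.trans h3))

end Ideals

section Surj
open Paper
variable {k : Type} [Field k] {A : Type} [CommRing A] [HopfAlgebra k A]
  {H : Type} [Ring H] [HopfAlgebra k H] {ι : A →ₗ[k] H} {p : H →ₗ[k] A}

/-- augmentation ideal -/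
noncomputable abbrev mz (k A : Type) [Field k] [CommRing A] [HopfAlgebra k A] : Ideal A :=
  RingHom.ker (Bialgebra.counitAlgHom k A)

lemma mem_mz {a : A} : a ∈ mz k A ↔ counit (R := k) a = 0 := Iff.rfl

lemma mz_stable (hC : CommByFinite k A H ι) : IsHStable k A H ι (mz k A) := by
  intro h a ha
  obtain ⟨b, hb⟩ := hC.normal_left h a
  refine ⟨b, ?_, hb⟩
  rw [mem_mz] at ha ⊢
  rw [← hC.ι_counit, hb, adl_eq, map_sum]
  apply Finset.sum_eq_zero
  intro i _
  simp [hC.ι_counit, ha]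

lemma aug_eq : augHIdeal k A H ι = rightMul k A H ι (mz k A) := by
  unfold augHIdeal rightMul
  congr 1
  ext x
  constructor
  · rintro ⟨a, h, ha, rfl⟩; exact ⟨h, a, ha, rfl⟩
  · rintro ⟨h, a, ha, rfl⟩; exact ⟨a, h, ha, rfl⟩

lemma mz_finite : FiniteDimensional k (A ⧸ (mz k A).restrictScalars k) := by
  have : (mz k A).restrictScalars k = LinearMap.ker (Bialgebra.counitAlgHom k A).toLinearMap := rfl
  rw [this]
  exact Module.Finite.equiv (LinearMap.quotKerEquivRange _).symm

/-- `A⁺H` as a left ideal -/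
def KI (hC : CommByFinite k A H ι) : Ideal H where
  carrier := rightMul k A H ι (mz k A)
  add_mem' := fun ha hb => add_mem ha hb
  zero_mem' := zero_mem _
  smul_mem' := fun c x hx => (rightMul_two (mz_stable hC) c x hx).1

lemma mem_KI {hC : CommByFinite k A H ι} {x : H} : x ∈ KI hC ↔ x ∈ rightMul k A H ι (mz k A) := Iff.rfl

lemma KI_two (hC : CommByFinite k A H ι) : (KI hC).IsTwoSided :=
  ⟨fun b hx => (rightMul_two (mz_stable hC) b _ hx).2⟩

lemma KI_restrict (hC : CommByFinite k A H ι) :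
    (KI hC).restrictScalars k = rightMul k A H ι (mz k A) := rfl

lemma counit_tensor (a : A) : (TensorProduct.lid k k) (TensorProduct.map counit counit (comul (R := k) a))
    = counit (R := k) a := by
  have h1 := Coalgebra.sum_counit_smul (R := k) (ℛ k a)
  have h2 := congr(counit (R := k) $h1)
  rw [← (ℛ k a).eq]
  simpa [map_sum] using h2

lemma KI_hopf (hC : CommByFinite k A H ι) (hp : IsSplitting k A H ι p) : (KI hC).IsHopfIdeal k where
  counit_eq_zero := by
    have : rightMul k A H ι (mz k A) ≤ LinearMap.ker (counit (R := k) (A := H)) := by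
      apply rightMul_le
      intro h a ha
      rw [mem_mz] at ha
      simp [hC.ι_counit, ha]
    intro x hx
    exact this hx
  map_mkQ_comul_eq_zero := by
    intro x hx
    set π := ((KI hC).restrictScalars k).mkQ with hπ
    have hpi : ∀ (a : A) (y : H), π (ι a * y) = counit (R := k) a • π y := by
      intro a y
      rw [← map_smul, hπ, ← sub_eq_zero, ← map_sub, Submodule.mkQ_apply, Submodule.Quotient.mk_eq_zero,
        KI_restrict]
      have : ι a * y - counit (R := k) a • y = ι (a - counit (R := k) a • 1) * y := by
        rw [map_sub, map_smul, hC.ι_one]; simp [sub_mul]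
      rw [this]
      apply mem_rightMul
      rw [mem_mz]; simp
    have h1 : ∀ (u : A ⊗[k] A) (v : H ⊗[k] H), TensorProduct.map π π (TensorProduct.map ι ι u * v)
        = (TensorProduct.lid k k) (TensorProduct.map counit counit u) • TensorProduct.map π π v := by
      intro u v
      induction u using TensorProduct.induction_on with
      | zero => simp
      | add u1 u2 h1 h2 => simp only [map_add, add_mul, h1, h2, add_smul]
      | tmul a b =>
        induction v using TensorProduct.induction_on with
        | zero => simp
        | add v1 v2 h1 h2 => simp only [map_add, mul_add, h1, h2, smul_add]
        | tmul y z =>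
          simp only [TensorProduct.map_tmul, Algebra.TensorProduct.tmul_mul_tmul, hpi,
            TensorProduct.lid_tmul, smul_eq_mul, TensorProduct.smul_tmul_smul]
    have h2 : rightMul k A H ι (mz k A) ≤ LinearMap.ker (TensorProduct.map π π ∘ₗ comul) := by
      apply rightMul_le
      intro h a ha
      rw [mem_mz] at ha
      rw [LinearMap.mem_ker, LinearMap.comp_apply, Bialgebra.comul_mul, hC.ι_comul, h1,
        counit_tensor, ha, zero_smul]
    exact h2 hx
  antipode_mem := by
    have : rightMul k A H ι (mz k A) ≤ (rightMul k A H ι (mz k A)).comap (antipode k) := by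
      apply rightMul_le
      intro h a ha
      rw [mem_mz] at ha
      rw [Submodule.mem_comap, antipode_mul_antidistrib, ← hC.ι_antipode, ← leftMul_eq hC hp (mz_stable hC)]
      apply mem_leftMul
      rw [mem_mz]
      simp [ha]
    intro x hx
    exact this hx

lemma antipode_surj_mod (hC : CommByFinite k A H ι) (hp : IsSplitting k A H ι p) (h : H) :
    ∃ b : H, h - antipode k b ∈ rightMul k A H ι (mz k A) := by
  have := KI_two hC
  have := KI_hopf hC hp
  have hf : FiniteDimensional k (H ⧸ rightMul k A H ι (mz k A)) := finite_rightMul hC mz_finite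
  have hf' : FiniteDimensional k (H ⧸ KI hC) := hf
  obtain ⟨y, hy⟩ := antipode_surj_of_finite (k := k) (H := H ⧸ KI hC) (Ideal.Quotient.mk _ h)
  obtain ⟨b, rfl⟩ := Ideal.Quotient.mk_surjective y
  refine ⟨b, ?_⟩
  rw [← mem_KI (hC := hC)]
  apply Ideal.Quotient.eq.mp
  exact hy.symm

/-- auxiliary map -/
noncomputable def Th (ι : A →ₗ[k] H) (p : H →ₗ[k] A) (x : H) : H ⊗[k] H →ₗ[k] H :=
  LinearMap.mul' k H ∘ₗ TensorProduct.map (ι ∘ₗ p ∘ₗ LinearMap.mulLeft k x ∘ₗ antipode k) LinearMap.id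

lemma Th_tmul (x y z : H) : Th ι p x (y ⊗ₜ z) = ι (p (x * antipode k y)) * z := by
  simp [Th]

lemma Th_mul (hC : CommByFinite k A H ι) (hp : IsSplitting k A H ι p) (x : H) (a : A) (v : H ⊗[k] H) :
    Th ι p x (comul (R := k) (ι a) * v) = counit (R := k) a • Th ι p x v := by
  rw [hC.ι_comul, ← (ℛ k a).eq]
  induction v using TensorProduct.induction_on with
  | zero => simp
  | add v1 v2 h1 h2 => simp only [map_add, mul_add, h1, h2, smul_add]
  | tmul y z =>
    simp only [map_sum, TensorProduct.map_tmul, Finset.sum_mul, Algebra.TensorProduct.tmul_mul_tmul,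
      Th_tmul, antipode_mul_antidistrib, ← hC.ι_antipode, ← mul_assoc, hp.right_linear, hC.ι_mul]
    simp only [mul_assoc _ (ι _) (ι _), ← hC.ι_mul]
    rw [← Finset.sum_mul, ← map_sum]
    simp only [mul_assoc]
    rw [← Finset.mul_sum, sum_antipode_mul_eq_algebraMap_counit, Algebra.algebraMap_eq_smul_one]
    simp

lemma Th_KI (hC : CommByFinite k A H ι) (hp : IsSplitting k A H ι p) (x : H) {y : H}
    (hy : y ∈ rightMul k A H ι (mz k A)) : Th ι p x (comul (R := k) y) = 0 := by
  have : rightMul k A H ι (mz k A) ≤ LinearMap.ker (Th ι p x ∘ₗ comul) := by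
    apply rightMul_le
    intro h a ha
    rw [mem_mz] at ha
    rw [LinearMap.mem_ker, LinearMap.comp_apply, Bialgebra.comul_mul, Th_mul hC hp, ha, zero_smul]
  exact this hy

lemma Th_B (hC : CommByFinite k A H ι) (x y : H) :
    Th ι p x (comul (R := k) (antipode k y)) ∈ LinearMap.range (antipode k (A := H)) := by
  have h1 : comul (R := k) (antipode k y) = _ := congr($(comul_antipode (k := k) (H := H)) y)
  rw [h1]
  simp only [LinearMap.comp_apply]
  generalize comul (R := k) y = v
  induction v using TensorProduct.induction_on with
  | zero => simp
  | add v1 v2 h1 h2 => simp only [map_add]; exact add_mem h1 h2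
  | tmul y z =>
    simp only [LinearEquiv.coe_coe, TensorProduct.comm_tmul, TensorProduct.map_tmul, Th_tmul]
    generalize p (x * antipode k (antipode k z)) = a
    refine ⟨y * ι (antipode k a), ?_⟩
    rw [antipode_mul_antidistrib, ← hC.ι_antipode, antipode_invol]

lemma Th_sum (hC : CommByFinite k A H ι) (hp : IsSplitting k A H ι p) (h : H) :
    ∑ i ∈ (ℛ k h).index, Th ι p ((ℛ k h).left i) (comul (R := k) ((ℛ k h).right i)) = h := by
  let Ψ : H ⊗[k] (H ⊗[k] H) →ₗ[k] H := LinearMap.mul' k H ∘ₗ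
    TensorProduct.map (ι ∘ₗ p ∘ₗ LinearMap.mul' k H ∘ₗ (antipode k).lTensor H) LinearMap.id ∘ₗ
    (TensorProduct.assoc k H H H).symm.toLinearMap
  have hΨ : ∀ x y z, Ψ (x ⊗ₜ (y ⊗ₜ z)) = ι (p (x * antipode k y)) * z := by
    intro x y z; simp [Ψ]
  have h1 := congr(Ψ $(sum_tmul_tmul_eq (ℛ k h) (fun i => ℛ k _) (fun i => ℛ k _)))
  simp only [map_sum, hΨ] at h1
  conv_lhs =>
    enter [2, i]
    rw [← (ℛ k ((ℛ k h).right i)).eq]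
  simp only [map_sum, Th_tmul]
  rw [← h1]
  conv_rhs => rw [← Coalgebra.sum_counit_smul (R := k) (ℛ k h)]
  refine Finset.sum_congr rfl fun i _ => ?_
  rw [← Finset.sum_mul, ← map_sum, ← map_sum, sum_mul_antipode_eq_algebraMap_counit,
    Algebra.algebraMap_eq_smul_one, map_smul, map_smul, ← hC.ι_one, hp.left_inv, hC.ι_one]
  simp

theorem antipode_surj (hC : CommByFinite k A H ι) (hp : IsSplitting k A H ι p) :
    Function.Surjective (antipode k : H →ₗ[k] H) := by
  intro h
  rw [← LinearMap.mem_range, ← Th_sum hC hp h]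
  refine Submodule.sum_mem _ fun i _ => ?_
  obtain ⟨b, hb⟩ := antipode_surj_mod hC hp ((ℛ k h).right i)
  have h1 := Th_KI hC hp ((ℛ k h).left i) hb
  rw [map_sub, map_sub, sub_eq_zero] at h1
  rw [h1]
  exact Th_B hC _ _

end Surj

section Final
open Paper
variable {k : Type} [Field k] {A : Type} [CommRing A] [HopfAlgebra k A]
  {H : Type} [Ring H] [HopfAlgebra k H] {ι : A →ₗ[k] H} {p : H →ₗ[k] A}

lemma ker_max (g : A →ₐ[k] k) : (RingHom.ker g).IsMaximal :=
  RingHom.ker_isMaximal_of_surjective g (fun c => ⟨algebraMap k A c, by simp⟩)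

lemma ker_inj {g h : A →ₐ[k] k} (e : RingHom.ker g = RingHom.ker h) : g = h := by
  ext a
  have h1 : a - algebraMap k A (g a) ∈ RingHom.ker g := by
    rw [RingHom.mem_ker]; simp
  rw [e, RingHom.mem_ker] at h1
  simp [sub_eq_zero] at h1
  exact h1.symm

lemma direct (hC : CommByFinite k A H ι) {n : ℕ} (K : Fin n → Ideal A)
    (hK : ∀ i j, i ≠ j → K i ⊔ K j = ⊤) (F : Fin n → Module.Dual k H)
    (hF : ∀ i, F i ∈ (leftMul k A H ι (K i)).dualAnnihilator) (h0 : ∑ i, F i = 0) (i : Fin n) :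
    F i = 0 := by
  have h1 : K i ⊔ ⨅ j ∈ Finset.univ.erase i, K j = ⊤ := Ideal.sup_iInf_eq_top (by
    intro j hj
    exact hK i j (Finset.ne_of_mem_erase hj).symm)
  obtain ⟨a, ha, b, hb, hab⟩ := Submodule.mem_sup.mp ((Ideal.eq_top_iff_one _).mp h1)
  simp only [Submodule.mem_iInf] at hb
  ext x
  have e1 : x = x * ι a + x * ι b := by rw [← mul_add, ← map_add, hab, hC.ι_one, mul_one]
  have e2 : F i (x * ι a) = 0 := (Submodule.mem_dualAnnihilator _).mp (hF i) _ (mem_leftMul _ ha)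
  have e3 := congr($h0 (x * ι b))
  rw [LinearMap.sum_apply, Finset.sum_eq_single i] at e3
  · rw [e1, map_add, e2, e3]; simp
  · intro j _ hj
    exact (Submodule.mem_dualAnnihilator _).mp (hF j) _
      (mem_leftMul _ (hb j (Finset.mem_erase.mpr ⟨hj, Finset.mem_univ _⟩)))
  · simp

lemma coalg (I : Submodule k H) (hI : IsTwo I) (hf : FiniteDimensional k (H ⧸ I))
    (f : Module.Dual k H) (hfI : ∀ x ∈ I, f x = 0) :
    ∃ (n : ℕ) (s t : Fin n → Module.Dual k H),
      (∀ i, (∀ x ∈ I, s i x = 0) ∧ (∀ x ∈ I, t i x = 0)) ∧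
      ∀ x y : H, f (x * y) = ∑ i, s i x * t i y := by
  let b := Module.finBasis k (H ⧸ I)
  choose e he using fun i => I.mkQ_surjective (b i)
  refine ⟨_, fun i => f ∘ₗ LinearMap.mulRight k (e i), fun i => b.coord i ∘ₗ I.mkQ, ?_, ?_⟩
  · intro i
    refine ⟨fun x hx => hfI _ (hI _ _ hx).2, fun x hx => ?_⟩
    have : I.mkQ x = 0 := by simpa using hx
    rw [LinearMap.comp_apply, this, map_zero]
  · intro x y
    have h1 : y - ∑ i, b.coord i (I.mkQ y) • e i ∈ I := by
      rw [← Submodule.Quotient.mk_eq_zero, ← Submodule.mkQ_apply, map_sub, map_sum]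
      simp only [map_smul, he, Module.Basis.coord_apply]
      rw [b.sum_repr, sub_self]
    have h2 := hfI _ (hI x _ h1).1
    rw [mul_sub, map_sub, sub_eq_zero] at h2
    rw [h2, Finset.mul_sum, map_sum]
    refine Finset.sum_congr rfl fun i _ => ?_
    simp [mul_comm]

lemma finite_inf {α : Type} (s : Finset α) (I : α → Submodule k H)
    (h : ∀ i ∈ s, FiniteDimensional k (H ⧸ I i)) : FiniteDimensional k (H ⧸ ⨅ i ∈ s, I i) := by
  have : ∀ i : s, FiniteDimensional k (H ⧸ I i) := fun i => h i i.2
  have e : (⨅ i ∈ s, I i) = LinearMap.ker (LinearMap.pi fun i : s => (I i).mkQ) := by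
    rw [LinearMap.ker_pi, iInf_subtype]
    simp
  rw [e]
  exact Module.Finite.equiv (LinearMap.quotKerEquivRange _).symm

lemma two_inf {α : Type} (s : Finset α) (I : α → Submodule k H)
    (h : ∀ i ∈ s, IsTwo (I i)) : IsTwo (⨅ i ∈ s, I i) := by
  intro y x hx
  simp only [Submodule.mem_iInf] at hx ⊢
  exact ⟨fun i hi => (h i hi y x (hx i hi)).1, fun i hi => (h i hi y x (hx i hi)).2⟩

lemma span_dual {α : Type} (s : Finset α) (I : α → Submodule k H) (f : Module.Dual k H)
    (hf : ∀ x ∈ ⨅ i ∈ s, I i, f x = 0) : ∃ (n : ℕ) (g : Fin n → α) (F : Fin n → Module.Dual k H),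
      (∀ i, F i ∈ (I (g i)).dualAnnihilator) ∧ f = ∑ i, F i := by
  let e := s.equivFin.symm
  have h1 : (⨅ i ∈ s, I i) = ⨅ j : Fin s.card, I (e j) := by
    rw [e.iInf_comp (g := fun i : s => I i), iInf_subtype]
  rw [h1] at hf
  have h2 : f ∈ (⨅ j : Fin s.card, I (e j)).dualAnnihilator := (Submodule.mem_dualAnnihilator _).mpr hf
  rw [Subspace.dualAnnihilator_iInf_eq] at h2
  have h3 : f ∈ ⨆ j ∈ (Finset.univ : Finset (Fin s.card)), (I (e j)).dualAnnihilator := by simpa using h2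
  rw [Submodule.mem_iSup_finset_iff_exists_sum] at h3
  obtain ⟨μ, hμ⟩ := h3
  exact ⟨_, fun j => e j, fun j => μ j, fun j => (μ j).2, hμ.symm⟩

lemma core_antipode (hC : CommByFinite k A H ι) (hp : IsSplitting k A H ι p) {g g' : A →ₐ[k] k}
    {J J' : Ideal A} (hJ : IsCore k A H ι (RingHom.ker g) J)
    (hJ' : IsCore k A H ι (RingHom.ker g') J') (hg : ∀ a, g' a = g (antipode k a)) {x : H}
    (hx : x ∈ leftMul k A H ι J) : antipode k x ∈ leftMul k A H ι J' := by
  have hL := leftMul_two hC hp hJ.1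
  have hI : IsTwo ((leftMul k A H ι J).comap (antipode k)) := by
    intro h x hx
    simp only [Submodule.mem_comap, antipode_mul_antidistrib] at *
    exact ⟨(hL _ _ hx).2, (hL _ _ hx).1⟩
  have h1 : contract hC _ hI ≤ J' := by
    apply hJ'.2.2 _ (contract_stable hC _ hI)
    intro a ha
    rw [mem_contract, Submodule.mem_comap, ← hC.ι_antipode] at ha
    rw [RingHom.mem_ker, hg]
    exact hJ.2.1 (leftMul_contract hp ha)
  have h2 : leftMul k A H ι J ≤ (leftMul k A H ι J').comap (antipode k) := by
    apply leftMul_le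
    intro h a ha
    rw [Submodule.mem_comap, antipode_mul_antidistrib, ← hC.ι_antipode, leftMul_eq hC hp hJ'.1]
    apply mem_rightMul
    apply h1
    rw [mem_contract, Submodule.mem_comap, ← hC.ι_antipode, antipode_invol]
    simpa using mem_leftMul (k := k) (ι := ι) (1 : H) ha
  exact h2 hx

lemma core_finiteH (hC : CommByFinite k A H ι) (hp : IsSplitting k A H ι p) {g : A →ₐ[k] k}
    {J : Ideal A} (hJ : IsCore k A H ι (RingHom.ker g) J) :
    FiniteDimensional k (H ⧸ leftMul k A H ι J) := by
  rw [leftMul_eq hC hp hJ.1]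
  exact finite_rightMul hC (core_finite hC hp g hJ)

lemma antipode_image (hC : CommByFinite k A H ι) (hp : IsSplitting k A H ι p) {g g' : A →ₐ[k] k}
    {J J' : Ideal A} (hJ : IsCore k A H ι (RingHom.ker g) J)
    (hJ' : IsCore k A H ι (RingHom.ker g') J') (hg : ∀ a, g' a = g (antipode k a)) :
    (fun f : Module.Dual k H => f ∘ₗ antipode k) '' ((leftMul k A H ι J).dualAnnihilator : Set _)
      = ((leftMul k A H ι J').dualAnnihilator : Set (Module.Dual k H)) := by
  have hg' : ∀ a, g a = g' (antipode k a) := fun a => by rw [hg, antipode_invol]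
  have s1 : ∀ x ∈ leftMul k A H ι J, antipode k x ∈ leftMul k A H ι J' :=
    fun x hx => core_antipode hC hp hJ hJ' hg hx
  have s2 : ∀ x ∈ leftMul k A H ι J', antipode k x ∈ leftMul k A H ι J :=
    fun x hx => core_antipode hC hp hJ' hJ hg' hx
  have f1 := core_finiteH hC hp hJ
  have f2 := core_finiteH hC hp hJ'
  set I := leftMul k A H ι J
  set I' := leftMul k A H ι J'
  apply Set.Subset.antisymm
  · rintro _ ⟨f, hf, rfl⟩
    apply (Submodule.mem_dualAnnihilator _).mpr
    intro x hx
    exact (Submodule.mem_dualAnnihilator _).mp hf _ (s2 x hx)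
  · intro f hf
    let T1 : (H ⧸ I) →ₗ[k] (H ⧸ I') := I.mapQ I' (antipode k) s1
    let T2 : (H ⧸ I') →ₗ[k] (H ⧸ I) := I'.mapQ I (antipode k) s2
    have hs := antipode_surj hC hp
    have t1 : Function.Surjective T1 := by
      intro y
      obtain ⟨y, rfl⟩ := I'.mkQ_surjective y
      obtain ⟨z, rfl⟩ := hs y
      exact ⟨I.mkQ z, rfl⟩
    have t2 : Function.Surjective T2 := by
      intro y
      obtain ⟨y, rfl⟩ := I.mkQ_surjective y
      obtain ⟨z, rfl⟩ := hs y
      exact ⟨I'.mkQ z, rfl⟩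
    have hd : Module.finrank k (H ⧸ I') = Module.finrank k (H ⧸ I) :=
      le_antisymm (LinearMap.finrank_le_finrank_of_surjective t1)
        (LinearMap.finrank_le_finrank_of_surjective t2)
    have t2i := (LinearMap.injective_iff_surjective_of_finrank_eq_finrank hd).mpr t2
    let E := LinearEquiv.ofBijective T2 ⟨t2i, t2⟩
    let fb : (H ⧸ I') →ₗ[k] k := I'.liftQ f (fun x hx => (Submodule.mem_dualAnnihilator _).mp hf x hx)
    refine ⟨fb ∘ₗ E.symm.toLinearMap ∘ₗ I.mkQ, ?_, ?_⟩
    · apply (Submodule.mem_dualAnnihilator _).mpr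
      intro x hx
      have : I.mkQ x = 0 := by simpa using hx
      simp only [LinearMap.comp_apply, this, map_zero]
    · ext x
      have h1 : E.symm (I.mkQ (antipode k x)) = I'.mkQ x := by
        rw [LinearEquiv.symm_apply_eq]; rfl
      simp only [LinearMap.comp_apply, LinearEquiv.coe_coe, h1]
      rfl

lemma conv_mem (hC : CommByFinite k A H ι) (hp : IsSplitting k A H ι p) (g : A →ₐ[k] k)
    (t : Module.Dual k H) (ht : t ∈ hbarStar k A H ι) :
    conv k t (PiDual k A H p g.toLinearMap) ∈ (leftMul k A H ι (RingHom.ker g)).dualAnnihilator ∧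
    conv k (PiDual k A H p g.toLinearMap) t
      ∈ (leftMul k A H ι (RingHom.ker g)).dualAnnihilator := by
  have h1 : ∀ (y : H) (a : A), t (y * ι a) = counit (R := k) a * t y := by
    intro y a
    rw [← smul_eq_mul (counit (R := k) a), ← map_smul t, ← sub_eq_zero, ← map_sub]
    apply ht
    have : y * ι a - counit (R := k) a • y = y * ι (a - counit (R := k) a • 1) := by
      rw [map_sub, map_smul, hC.ι_one]; simp [mul_sub]
    rw [this, aug_eq, ← leftMul_eq hC hp (mz_stable hC)]
    apply mem_leftMul
    rw [mem_mz]; simp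
  set q := PiDual k A H p g.toLinearMap with hq
  have h2 : ∀ (y : H) (a : A), q (y * ι a) = g a * q y := by
    intro y a
    simp [hq, PiDual, hp.right_linear, mul_comm]
  have gen : ∀ (t q : Module.Dual k H) (α β : Module.Dual k A),
      (∀ (y : H) (a : A), t (y * ι a) = α a * t y) → (∀ (y : H) (a : A), q (y * ι a) = β a * q y) →
      ∀ (v : H ⊗[k] H) (u : A ⊗[k] A),
        TensorProduct.lid k k (TensorProduct.map t q (v * TensorProduct.map ι ι u)) =
        TensorProduct.lid k k (TensorProduct.map α β u) * TensorProduct.lid k k (TensorProduct.map t q v) := by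
    intro t q α β h1 h2 v u
    induction u using TensorProduct.induction_on with
    | zero => simp
    | add u1 u2 h1 h2 => simp only [map_add, mul_add, add_mul, h1, h2]
    | tmul a b =>
      induction v using TensorProduct.induction_on with
      | zero => simp
      | add v1 v2 h1 h2 => simp only [map_add, mul_add, add_mul, h1, h2]
      | tmul y z =>
        simp only [TensorProduct.map_tmul, Algebra.TensorProduct.tmul_mul_tmul,
          TensorProduct.lid_tmul, smul_eq_mul, h1, h2]
        ring
  have c1 : ∀ a : A, TensorProduct.lid k k (TensorProduct.map counit g.toLinearMap (comul (R := k) a)) = g a := by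
    intro a
    have := congr(g $(Coalgebra.sum_counit_smul (R := k) (ℛ k a)))
    rw [← (ℛ k a).eq]
    simpa [map_sum] using this
  have c2 : ∀ a : A, TensorProduct.lid k k (TensorProduct.map g.toLinearMap counit (comul (R := k) a)) = g a := by
    intro a
    have h := Coalgebra.sum_tmul_counit_eq (R := k) (ℛ k a)
    have := congr(TensorProduct.lid k k (TensorProduct.map g.toLinearMap LinearMap.id $h))
    rw [← (ℛ k a).eq]
    simpa [map_sum] using this
  constructor
  · apply (Submodule.mem_dualAnnihilator _).mpr
    have : leftMul k A H ι (RingHom.ker g) ≤ LinearMap.ker (conv k t q) := by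
      apply leftMul_le
      intro h a ha
      rw [RingHom.mem_ker] at ha
      rw [LinearMap.mem_ker]
      simp only [conv, LinearMap.comp_apply, LinearEquiv.coe_coe]
      rw [Bialgebra.comul_mul, hC.ι_comul, gen t q counit g.toLinearMap h1 h2, c1, ha, zero_mul]
    exact fun x hx => this hx
  · apply (Submodule.mem_dualAnnihilator _).mpr
    have : leftMul k A H ι (RingHom.ker g) ≤ LinearMap.ker (conv k q t) := by
      apply leftMul_le
      intro h a ha
      rw [RingHom.mem_ker] at ha
      rw [LinearMap.mem_ker]
      simp only [conv, LinearMap.comp_apply, LinearEquiv.coe_coe]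
      rw [Bialgebra.comul_mul, hC.ι_comul, gen q t g.toLinearMap counit h2 h1, c2, ha, zero_mul]
    exact fun x hx => this hx

lemma mz_pow (hC : CommByFinite k A H ι) (hp : IsSplitting k A H ι p) (n : ℕ) :
    ∀ (h : H) (c : A), c ∈ (mz k A) ^ (n + 1) → h * ι c ∈ (augHIdeal k A H ι) ^ (n + 1) := by
  have h0 : ∀ (h : H) (c : A), c ∈ mz k A → h * ι c ∈ augHIdeal k A H ι := by
    intro h c hc
    rw [aug_eq, ← leftMul_eq hC hp (mz_stable hC)]
    exact mem_leftMul _ hc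
  induction n with
  | zero => intro h c hc; simp only [zero_add, pow_one] at hc ⊢; exact h0 h c hc
  | succ n ih =>
    intro h c hc
    rw [pow_succ] at hc ⊢
    induction hc using Submodule.mul_induction_on' with
    | mem_mul_mem x hx y hy =>
      rw [hC.ι_mul, ← mul_assoc]
      exact Submodule.mul_mem_mul (ih h x hx) (by simpa using h0 1 y hy)
    | add x _ y _ hx hy => rw [map_add, mul_add]; exact add_mem hx hy

lemma tang (hC : CommByFinite k A H ι) (hp : IsSplitting k A H ι p) (core : Ideal A → Ideal A)
    (hcore : ∀ m : Ideal A, m.IsMaximal → IsCore k A H ι m (core m)) (hmz : core (mz k A) = mz k A)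
    (f : Module.Dual k H) (hf : f ∈ charComp k A H ι core) (hf2 : f ∈ tangential k A H ι) :
    f ∈ hbarStar k A H ι := by
  classical
  obtain ⟨s, -, hs⟩ := hf
  obtain ⟨-, n, hn, hn2⟩ := hf2
  obtain ⟨m, rfl⟩ := Nat.exists_eq_succ_of_ne_zero hn.ne'
  let s' := s.filter fun g => core (RingHom.ker g) ≠ mz k A
  have h1 : mz k A ⊔ ⨅ g ∈ s', core (RingHom.ker g) = ⊤ := Ideal.sup_iInf_eq_top (by
    intro g hg
    have h2 := hcore _ (ker_max (Bialgebra.counitAlgHom k A))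
    rw [hmz] at h2
    exact core_comax hC hp h2 (hcore _ (ker_max g)) (Finset.mem_filter.mp hg).2.symm)
  have h2 := Ideal.pow_sup_eq_top (n := m + 1) h1
  obtain ⟨c, hc, b, hb, hcb⟩ := Submodule.mem_sup.mp ((Ideal.eq_top_iff_one _).mp h2)
  simp only [Submodule.mem_iInf] at hb
  have h3 : leftMul k A H ι (mz k A) ≤ LinearMap.ker f := by
    apply leftMul_le
    intro h a ha
    rw [LinearMap.mem_ker]
    have e1 : h * ι a = h * ι (a * c) + h * ι (a * b) := by
      rw [← mul_add, ← map_add, ← mul_add, hcb, mul_one]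
    rw [e1, map_add, hn2 _ (mz_pow hC hp m h _ (Ideal.mul_mem_left _ _ hc)), zero_add]
    apply hs
    simp only [Submodule.mem_iInf]
    intro g hg
    apply mem_leftMul
    by_cases hgc : core (RingHom.ker g) = mz k A
    · rw [hgc]; exact Ideal.mul_mem_right _ _ ha
    · exact Ideal.mul_mem_left _ _ (hb g (Finset.mem_filter.mpr ⟨hg, hgc⟩))
  intro x hx
  rw [aug_eq, ← leftMul_eq hC hp (mz_stable hC)] at hx
  exact h3 hx

end Final

end Paper12

open Paper in
/-- Basic properties of the character component: (i) `ĝ`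
depends only on the `∼`-class of `g`; (ii) `k̂G_H = ⊕_g ĝ`; (iii) `k̂G_H` is a
subcoalgebra of `H°` and each `ĝ` is a subcoalgebra; (iv) `ĝ` contains
`⊕_{h∼g}(H/Hm_h)*`, and `(H/Hm_g)*` contains `H̄*Π°(χ_g) + Π°(χ_g)H̄*`;
(v) `S°(ĝ) = ĝ⁻¹`; (vi) `k̂G_H ∩ W(H°) = H̄* = 1̂`. -/
theorem statement_12
    (k : Type) [Field k] [IsAlgClosed k]
    (A : Type) [CommRing A] [HopfAlgebra k A]
    (H : Type) [Ring H] [HopfAlgebra k H]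
    (ι : A →ₗ[k] H) (p : H →ₗ[k] A)
    (hCbF : CommByFinite k A H ι)
    (hsplit : IsSplitting k A H ι p)
    -- `core m` is the `H̄`-core `m^{(H̄)}` of each maximal ideal `m`
    (core : Ideal A → Ideal A)
    (hcore : ∀ m : Ideal A, m.IsMaximal → IsCore k A H ι m (core m)) :
    -- (i) if `g ∼ h` then `ĝ = ĥ`
    (∀ g h : A →ₐ[k] k, core (RingHom.ker g) = core (RingHom.ker h) →
      ghat k A H ι core g = ghat k A H ι core h) ∧
    -- (ii) `k̂G_H = ⊕_{g ∈ G_H/∼} ĝ` : spanning ...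
    (∀ f ∈ charComp k A H ι core, ∃ (n : ℕ) (g : Fin n → (A →ₐ[k] k))
        (F : Fin n → Module.Dual k H),
      (∀ i, F i ∈ ghat k A H ι core (g i)) ∧ f = ∑ i, F i) ∧
    -- ... and directness over distinct orbits
    (∀ (n : ℕ) (g : Fin n → (A →ₐ[k] k)) (F : Fin n → Module.Dual k H),
      (∀ i j, i ≠ j → core (RingHom.ker (g i)) ≠ core (RingHom.ker (g j))) →
      (∀ i, F i ∈ ghat k A H ι core (g i)) →
      (∑ i, F i) = 0 → ∀ i, F i = 0) ∧
    -- (iii) `k̂G_H` is a subcoalgebra of `H°` ...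
    charComp k A H ι core ⊆ finDual k H ∧
    (∀ f ∈ charComp k A H ι core, ∃ (n : ℕ) (s t : Fin n → Module.Dual k H),
      (∀ i, s i ∈ charComp k A H ι core ∧ t i ∈ charComp k A H ι core) ∧
      ∀ x y : H, f (x * y) = ∑ i, s i x * t i y) ∧
    -- ... and each `ĝ` is a subcoalgebra
    (∀ g : A →ₐ[k] k, (ghat k A H ι core g : Set (Module.Dual k H)) ⊆ finDual k H ∧
      ∀ f ∈ ghat k A H ι core g, ∃ (n : ℕ) (s t : Fin n → Module.Dual k H),
        (∀ i, s i ∈ ghat k A H ι core g ∧ t i ∈ ghat k A H ι core g) ∧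
        ∀ x y : H, f (x * y) = ∑ i, s i x * t i y) ∧
    -- (iv) `ĝ ⊇ ⊕_{h ∼ g} (H/H m_h)*` ...
    (∀ g h : A →ₐ[k] k, core (RingHom.ker h) = core (RingHom.ker g) →
      (leftMul k A H ι (RingHom.ker h)).dualAnnihilator ≤ ghat k A H ι core g) ∧
    (∀ (n : ℕ) (h : Fin n → (A →ₐ[k] k)) (F : Fin n → Module.Dual k H),
      Function.Injective h →
      (∀ i, F i ∈ (leftMul k A H ι (RingHom.ker (h i))).dualAnnihilator) →
      (∑ i, F i) = 0 → ∀ i, F i = 0) ∧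
    -- ... and `(H/H m_g)* ⊇ H̄* Π°(χ_g) + Π°(χ_g) H̄*`
    (∀ (g : A →ₐ[k] k), ∀ t ∈ finDual k H ∩ hbarStar k A H ι,
      conv k t (PiDual k A H p g.toLinearMap)
        ∈ (leftMul k A H ι (RingHom.ker g)).dualAnnihilator ∧
      conv k (PiDual k A H p g.toLinearMap) t
        ∈ (leftMul k A H ι (RingHom.ker g)).dualAnnihilator) ∧
    -- (v) `S°(ĝ) = ĝ⁻¹`
    (∀ g ginv : A →ₐ[k] k,
      (∀ a : A, ginv a = g (HopfAlgebra.antipode (R := k) a)) →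
      (fun f : Module.Dual k H => f ∘ₗ HopfAlgebra.antipode (R := k)) ''
          (ghat k A H ι core g : Set (Module.Dual k H))
        = (ghat k A H ι core ginv : Set (Module.Dual k H))) ∧
    -- (vi) `k̂G_H ∩ W(H°) = H̄* = 1̂`
    charComp k A H ι core ∩ tangential k A H ι
      = finDual k H ∩ hbarStar k A H ι ∧
    (ghat k A H ι core (Bialgebra.counitAlgHom k A) : Set (Module.Dual k H))
        ∩ finDual k H
      = finDual k H ∩ hbarStar k A H ι := by
  have hc : ∀ g : A →ₐ[k] k, IsCore k A H ι (RingHom.ker g) (core (RingHom.ker g)) :=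
    fun g => hcore _ (Paper12.ker_max g)
  have htwo := fun g : A →ₐ[k] k => Paper12.leftMul_two hCbF hsplit (hc g).1
  have hfin := fun g : A →ₐ[k] k => Paper12.core_finiteH hCbF hsplit (hc g)
  have hmz : core (Paper12.mz k A) = Paper12.mz k A := by
    have h1 := hc (Bialgebra.counitAlgHom k A)
    exact le_antisymm h1.2.1 (h1.2.2 _ (Paper12.mz_stable hCbF) le_rfl)
  have hgh : ∀ f : Module.Dual k H, f ∈ ghat k A H ι core (Bialgebra.counitAlgHom k A) ↔
      f ∈ hbarStar k A H ι := by
    intro f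
    unfold ghat hbarStar
    change f ∈ (leftMul k A H ι (core (Paper12.mz k A))).dualAnnihilator ↔ _
    rw [hmz, Submodule.mem_dualAnnihilator, Paper12.leftMul_eq hCbF hsplit
      (Paper12.mz_stable hCbF), ← Paper12.aug_eq]
    rfl
  refine ⟨?_, ?_, ?_, ?_, ?_, ?_, ?_, ?_, ?_, ?_, ?_, ?_⟩
  · intro g h e
    unfold ghat
    rw [e]
  · rintro f ⟨s, -, hs⟩
    exact Paper12.span_dual s (fun g : A →ₐ[k] k => leftMul k A H ι (core (RingHom.ker g))) f hs
  · intro n g F hne hF h0 i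
    exact Paper12.direct hCbF (fun i => core (RingHom.ker (g i)))
      (fun i j hij => Paper12.core_comax hCbF hsplit (hc _) (hc _) (hne i j hij)) F hF h0 i
  · rintro f ⟨s, -, hs⟩
    exact ⟨_, Paper12.two_inf s (fun g : A →ₐ[k] k => leftMul k A H ι (core (RingHom.ker g))) (fun g _ => htwo g), fun x hx => hs x hx,
      Paper12.finite_inf s (fun g : A →ₐ[k] k => leftMul k A H ι (core (RingHom.ker g))) (fun g _ => hfin g)⟩
  · rintro f ⟨s, hne, hs⟩
    obtain ⟨n, u, v, huv, hxy⟩ := Paper12.coalg _ (Paper12.two_inf s (fun g : A →ₐ[k] k => leftMul k A H ι (core (RingHom.ker g))) (fun g _ => htwo g))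
      (Paper12.finite_inf s (fun g : A →ₐ[k] k => leftMul k A H ι (core (RingHom.ker g))) (fun g _ => hfin g)) f hs
    exact ⟨n, u, v, fun i => ⟨⟨s, hne, (huv i).1⟩, ⟨s, hne, (huv i).2⟩⟩, hxy⟩
  · intro g
    refine ⟨fun f hf => ⟨_, htwo g, fun x hx => (Submodule.mem_dualAnnihilator _).mp hf x hx, hfin g⟩, ?_⟩
    intro f hf
    obtain ⟨n, u, v, huv, hxy⟩ := Paper12.coalg _ (htwo g) (hfin g) f
      (fun x hx => (Submodule.mem_dualAnnihilator _).mp hf x hx)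
    exact ⟨n, u, v, fun i => ⟨(Submodule.mem_dualAnnihilator _).mpr (huv i).1,
      (Submodule.mem_dualAnnihilator _).mpr (huv i).2⟩, hxy⟩
  · intro g h e
    unfold ghat
    rw [← e]
    exact Submodule.dualAnnihilator_anti (Paper12.leftMul_mono (hc h).2.1)
  · intro n h F hinj hF h0 i
    refine Paper12.direct hCbF (fun i => RingHom.ker (h i)) (fun i j hij => ?_) F hF h0 i
    exact (Paper12.ker_max (h i)).coprime_of_ne (Paper12.ker_max (h j))
      (fun e => hij (hinj (Paper12.ker_inj e)))
  · intro g t ht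
    exact Paper12.conv_mem hCbF hsplit g t ht.2
  · intro g ginv hg
    exact Paper12.antipode_image hCbF hsplit (hc g) (hc ginv) hg
  · apply Set.Subset.antisymm
    · rintro f ⟨h1, h2⟩
      exact ⟨h2.1, Paper12.tang hCbF hsplit core hcore hmz f h1 h2⟩
    · rintro f ⟨h1, h2⟩
      refine ⟨⟨{Bialgebra.counitAlgHom k A}, by simp, ?_⟩, h1, 1, one_pos, ?_⟩
      · intro x hx
        have h3 := (Submodule.mem_dualAnnihilator _).mp ((hgh f).mpr h2)
        apply h3
        simp only [Submodule.mem_iInf] at hx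
        exact hx _ (Finset.mem_singleton_self _)
      · rw [pow_one]; exact h2
  · ext f
    constructor
    · rintro ⟨h1, h2⟩
      exact ⟨h2, (hgh f).mp h1⟩
    · rintro ⟨h1, h2⟩
      exact ⟨(hgh f).mpr h2, h1⟩
end

section
/- Let A ⊆ H be an affine commutative-by-finite Hopf algebra with A a domain, and let d_A(H) be the minimal number of generators of H as a (right or left) A-module. Then for every g ∈ G_H: dim_k(H/Hm_g) = dim_k(H/m_gH) = dim_k(H̄), and dim_k(ĝ) = dim_k(A/m_g^(H̄))·dim_k(H̄) ≤ d_A(H)·dim_k(H̄). If moreover H is prime, then dim_k(ĝ) ≤ (dim_k(H̄))². -/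
open TensorProduct LinearMap Coalgebra

namespace Sub13

theorem trdeg_quot (k A : Type) [Field k] [CommRing A] [IsDomain A] [Algebra k A]
    (P : Ideal A) [P.IsPrime] (t : A) (ht : t ≠ 0) (htP : t ∈ P)
    [Algebra.FiniteType k A] : ¬ (Algebra.trdeg k A ≤ Algebra.trdeg k (A ⧸ P)) := by
  intro hle
  have hfin : Algebra.trdeg k A < Cardinal.aleph0 := trdeg_lt_aleph0_of_finiteType
  have hfs : FaithfulSMul k (A ⧸ P) := (faithfulSMul_iff_algebraMap_injective _ _).2
    (algebraMap k (A ⧸ P)).injective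
  obtain ⟨s, hs⟩ := exists_isTranscendenceBasis k (A ⧸ P)
  have hsurj : Function.Surjective (Ideal.Quotient.mkₐ k P) := Ideal.Quotient.mkₐ_surjective k P
  let x : s → A := fun i => Function.surjInv hsurj i.1
  have hx : (Ideal.Quotient.mkₐ k P) ∘ x = (Subtype.val : s → A ⧸ P) := by
    funext i
    exact Function.surjInv_eq hsurj i.1
  have hxi : AlgebraicIndependent k x := by
    apply AlgebraicIndependent.of_comp (Ideal.Quotient.mkₐ k P)
    rw [hx]; exact hs.1
  have hb : IsTranscendenceBasis k x := by
    apply hxi.isTranscendenceBasis_of_trdeg_le hfin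
    rw [hs.cardinalMk_eq_trdeg]; exact hle
  have halg := hb.isAlgebraic
  obtain ⟨r, hr0, hr⟩ := (halg.isAlgebraic t).exists_nonzero_dvd (mem_nonZeroDivisors_of_ne_zero ht)
  have hrP : (r : A) ∈ P := P.mem_of_dvd hr htP
  obtain ⟨p, hp⟩ : ∃ p : MvPolynomial s k, MvPolynomial.aeval x p = (r : A) := by
    have h := Algebra.adjoin_range_eq_range_aeval k x
    have h2 : (r : A) ∈ (MvPolynomial.aeval x : MvPolynomial s k →ₐ[k] A).range := h ▸ r.2
    exact h2
  have h0 : MvPolynomial.aeval (Subtype.val : s → A ⧸ P) p = 0 := by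
    have : MvPolynomial.aeval ((Ideal.Quotient.mkₐ k P) ∘ x) p
      = (Ideal.Quotient.mkₐ k P) (MvPolynomial.aeval x p) := by
      exact (MvPolynomial.comp_aeval_apply x (Ideal.Quotient.mkₐ k P) p).symm
    rw [hx] at this
    refine Eq.trans this ?_
    rw [hp]
    exact Ideal.Quotient.eq_zero_iff_mem.mpr hrP
  have hp0 : p = 0 := (injective_iff_map_eq_zero _).1 hs.1 p h0
  apply hr0
  apply Subtype.ext
  rw [← hp, hp0]; simp

theorem not_inj (k A C : Type) [Field k] [CommRing A] [IsDomain A] [Algebra k A]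
    [Algebra.FiniteType k A] [CommRing C] [Algebra k C] (f g : A →ₐ[k] C)
    (hf : f.toRingHom.Finite) (t : A) (ht : t ≠ 0) (hft : f t = 0) :
    ∃ a : A, a ≠ 0 ∧ g a = 0 := by
  by_contra hcon
  push Not at hcon
  have hg : Function.Injective g := (injective_iff_map_eq_zero g).2 fun a ha => by
    by_contra h; exact hcon a h ha
  obtain ⟨Q, hQ, hQc⟩ := Ideal.exists_comap_eq_of_mem_minimalPrimes_of_injective
    (f := g.toRingHom) hg ⊥ (by
      rw [IsDomain.minimalPrimes_eq_singleton_bot]; rfl)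
  let P := Q.comap f
  have hP : P.IsPrime := Ideal.IsPrime.comap f
  let alg : Algebra (A ⧸ P) (C ⧸ Q) := (Ideal.quotientMap Q f.toRingHom (le_refl P)).toAlgebra
  have : IsScalarTower k (A ⧸ P) (C ⧸ Q) := by
    apply IsScalarTower.of_algebraMap_eq
    intro c
    change Ideal.Quotient.mk Q (algebraMap k C c) = Ideal.Quotient.mk Q (f (algebraMap k A c))
    rw [f.commutes]
  have hinj : Function.Injective (algebraMap (A ⧸ P) (C ⧸ Q)) :=
    Ideal.quotientMap_injective' (le_refl _)
  have : FaithfulSMul (A ⧸ P) (C ⧸ Q) := (faithfulSMul_iff_algebraMap_injective _ _).2 hinj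
  have hint : Algebra.IsIntegral (A ⧸ P) (C ⧸ Q) := by
    constructor
    have h1 : f.toRingHom.IsIntegral := hf.to_isIntegral
    exact RingHom.IsIntegral.quotient (f := f.toRingHom) (I := Q) h1
  have hfs : FaithfulSMul k (A ⧸ P) := (faithfulSMul_iff_algebraMap_injective _ _).2
    (algebraMap k (A ⧸ P)).injective
  have h1 : Algebra.trdeg k (A ⧸ P) + Algebra.trdeg (A ⧸ P) (C ⧸ Q) = Algebra.trdeg k (C ⧸ Q) :=
    trdeg_add_eq k (A ⧸ P) 
  have h2 : Algebra.trdeg (A ⧸ P) (C ⧸ Q) = 0 := trdeg_eq_zero (R := A ⧸ P) (A := C ⧸ Q)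
  rw [h2, add_zero] at h1
  refine trdeg_quot k A P t ht (by change f t ∈ Q; rw [hft]; exact Q.zero_mem) ?_
  rw [h1]
  refine trdeg_le_of_injective ((Ideal.Quotient.mkₐ k Q).comp g) ?_
  rw [injective_iff_map_eq_zero]
  intro a ha
  have : g a ∈ Q := Ideal.Quotient.eq_zero_iff_mem.mp ha
  have : a ∈ Q.comap g.toRingHom := this
  rw [hQc] at this
  exact this

theorem lemG (k A M : Type) [Field k] [CommRing A] [IsDomain A] [Algebra k A]
    [Algebra.FiniteType k A] [AddCommGroup M] [Module k M] [Module A M] [IsScalarTower k A M]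
    [Module.Finite A M] (l : A →ₐ[k] Module.End A M) (t : A) (ht : t ≠ 0) :
    ∃ a : A, a ≠ 0 ∧ ∀ m : M, ∃ m' : M, l a m = t • m' := by
  have : IsNoetherianRing A := Algebra.FiniteType.isNoetherianRing k A
  let N : Submodule A M := (⊤ : Submodule A M).map (t • (LinearMap.id : M →ₗ[A] M))
  have hN : ∀ a : A, N ≤ N.comap (l a) := by
    rintro a _ ⟨m, -, rfl⟩
    exact ⟨l a m, trivial, by simp⟩
  let lb : A →ₐ[k] Module.End A (M ⧸ N) := AlgHom.ofLinearMap
    { toFun := fun a => N.mapQ N (l a) (hN a)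
      map_add' := fun a b => by
        ext m; simp
      map_smul' := fun c a => by
        ext m; simp
         }
    (by ext m; simp)
    (fun a b => by ext m; simp)
  let L : A ⊗[k] A →ₐ[k] Module.End A (M ⧸ N) :=
    Algebra.TensorProduct.lift (IsScalarTower.toAlgHom k A (Module.End A (M ⧸ N))) lb
      (fun a b => Algebra.commutes a (lb b))
  let I := RingHom.ker L
  let C := (A ⊗[k] A) ⧸ I
  let f : A →ₐ[k] C := (Ideal.Quotient.mkₐ k I).comp Algebra.TensorProduct.includeLeft
  let g : A →ₐ[k] C := (Ideal.Quotient.mkₐ k I).comp Algebra.TensorProduct.includeRight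
  have hL1 : ∀ a, L (a ⊗ₜ 1) = algebraMap A (Module.End A (M ⧸ N)) a := by
    intro a; exact (Algebra.TensorProduct.lift_tmul ..).trans (by simp)
  have hL2 : ∀ a, L (1 ⊗ₜ a) = lb a := by
    intro a; exact (Algebra.TensorProduct.lift_tmul ..).trans (by simp)
  have hft : f t = 0 := by
    apply Ideal.Quotient.eq_zero_iff_mem.mpr
    change L (t ⊗ₜ 1) = 0
    rw [hL1]
    ext m
    simp only [LinearMap.coe_comp, Function.comp_apply, Submodule.mkQ_apply]
    change t • (Submodule.Quotient.mk m : M ⧸ N) = 0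
    rw [← Submodule.Quotient.mk_smul, Submodule.Quotient.mk_eq_zero]
    exact ⟨m, trivial, rfl⟩
  have hff : f.toRingHom.Finite := by
    have hfa : f.toRingHom = algebraMap A C := rfl
    rw [hfa]
    rw [RingHom.finite_algebraMap]
    let Lc : C →+* Module.End A (M ⧸ N) := RingHom.kerLift L.toRingHom
    have hLc : Function.Injective Lc := RingHom.kerLift_injective L.toRingHom
    let Ll : C →ₗ[A] Module.End A (M ⧸ N) :=
      { toFun := Lc
        map_add' := map_add Lc
        map_smul' := fun a c => by
          have e : a • c = algebraMap A C a * c := Algebra.smul_def a c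
          rw [e, map_mul]
          have : Lc (algebraMap A C a) = algebraMap A _ a := hL1 a
          rw [this, RingHom.id_apply, Algebra.smul_def] }
    exact Module.Finite.of_injective Ll hLc
  obtain ⟨a, ha0, ha⟩ := not_inj k A C f g hff t ht hft
  refine ⟨a, ha0, fun m => ?_⟩
  have h1 : L (1 ⊗ₜ a) = 0 := Ideal.Quotient.eq_zero_iff_mem.mp ha
  rw [hL2] at h1
  have h2 := LinearMap.congr_fun h1 (Submodule.Quotient.mk m)
  have h3 : (Submodule.Quotient.mk (l a m) : M ⧸ N) = 0 := h2
  rw [Submodule.Quotient.mk_eq_zero] at h3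
  obtain ⟨m', -, hm'⟩ := h3
  exact ⟨m', hm'.symm⟩

theorem lemR (A M : Type) [CommRing A] [IsDomain A] [IsNoetherianRing A]
    [AddCommGroup M] [Module A M] [Module.Finite A M] :
    ∃ (r : ℕ) (s : A) (E : Fin r → A →ₗ[A] M) (F : Fin r → M →ₗ[A] A), s ≠ 0 ∧
      (∀ m, ∑ i, E i (F i m) = s • m) ∧ (∀ i a, F i (E i a) = s • a) ∧
      (∀ i j a, i ≠ j → F i (E j a) = 0) := by
  classical
  obtain ⟨S, hS, hmax⟩ := exists_maximal_linearIndepOn A (id : M → M)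
  have hfin : S.Finite := LinearIndependent.set_finite_of_isNoetherian (R := A) (s := S) hS
  have := hfin.fintype
  have hall : ∀ m : M, ∃ a : A, a ≠ 0 ∧ a • m ∈ Submodule.span A S := by
    intro m
    by_cases hm : m ∈ S
    · exact ⟨1, one_ne_zero, by rw [one_smul]; exact Submodule.subset_span hm⟩
    · simpa using hmax m hm
  obtain ⟨s, hs0, hs⟩ : ∃ s : A, s ≠ 0 ∧ ∀ m : M, s • m ∈ Submodule.span A S := by
    obtain ⟨T, hT⟩ := (Module.Finite.fg_top : (⊤ : Submodule A M).FG)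
    choose a ha0 ha using hall
    refine ⟨∏ m ∈ T, a m, Finset.prod_ne_zero_iff.2 fun m _ => ha0 m, fun m => ?_⟩
    have hm : m ∈ Submodule.span A (T : Set M) := by rw [hT]; trivial
    induction hm using Submodule.span_induction with
    | mem x hx =>
      rw [← Finset.prod_erase_mul T a hx, mul_smul]
      exact Submodule.smul_mem _ _ (ha x)
    | zero => simp
    | add x y _ _ hx hy => rw [smul_add]; exact add_mem hx hy
    | smul c x _ hx => rw [smul_comm]; exact Submodule.smul_mem _ _ hx
  let e := (Fintype.equivFin S).symm
  let v : Fin (Fintype.card S) → M := fun i => (e i : M)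
  have hv : LinearIndependent A v := LinearIndependent.comp hS e e.injective
  have hvs : Submodule.span A (Set.range v) = Submodule.span A S := by
    congr 1
    ext x
    constructor
    · rintro ⟨i, rfl⟩; exact (e i).2
    · intro hx; exact ⟨e.symm ⟨x, hx⟩, by simp [v]⟩
  let b := Module.Basis.span hv
  let Fm : M →ₗ[A] Submodule.span A (Set.range v) :=
    (s • (LinearMap.id : M →ₗ[A] M)).codRestrict _ (fun m => by rw [hvs]; exact hs m)
  refine ⟨Fintype.card S, s, fun i => LinearMap.toSpanSingleton A M (v i),
    fun i => b.coord i ∘ₗ Fm, hs0, ?_, ?_, ?_⟩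
  · intro m
    have h1 := congrArg Subtype.val (b.sum_repr (Fm m))
    simp only [Submodule.coe_sum, Submodule.coe_smul] at h1
    have h2 : ∀ i, ((b i : Submodule.span A (Set.range v)) : M) = v i := fun i =>
      congrArg Subtype.val (Module.Basis.span_apply hv i)
    simp only [h2] at h1
    simpa [Fm] using h1
  · intro i a
    have : Fm (a • v i) = (s • a) • b i := by
      apply Subtype.ext
      have h2 : ((b i : Submodule.span A (Set.range v)) : M) = v i :=
        congrArg Subtype.val (Module.Basis.span_apply hv i)
      change s • (a • v i) = (s • a) • ((b i : Submodule.span A (Set.range v)) : M)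
      rw [h2, smul_assoc]
    change b.repr (Fm (a • v i)) i = _
    rw [this]; simp
  · intro i j a hij
    have : Fm (a • v j) = (s • a) • b j := by
      apply Subtype.ext
      have h2 : ((b j : Submodule.span A (Set.range v)) : M) = v j :=
        congrArg Subtype.val (Module.Basis.span_apply hv j)
      change s • (a • v j) = (s • a) • ((b j : Submodule.span A (Set.range v)) : M)
      rw [h2, smul_assoc]
    change b.repr (Fm (a • v j)) i = _
    rw [this]; simp [hij.symm]


theorem lemT (k A : Type) [Field k] [CommRing A] [IsDomain A] [Algebra k A]
    (τ θ : (A ⊗[k] A) ≃ₐ[k] (A ⊗[k] A)) (hτ : ∀ x : A, τ (x ⊗ₜ 1) = x ⊗ₜ 1)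
    (hθ1 : ∀ x : A, θ (x ⊗ₜ 1) = τ.symm (1 ⊗ₜ x)) (hθ2 : ∀ x : A, θ (1 ⊗ₜ x) = 1 ⊗ₜ x)
    (I : Ideal A) [Module.Finite k (A ⧸ I)] (s : A) (hs : s ≠ 0) :
    ∃ t : A, t ≠ 0 ∧ ∃ u : A ⊗[k] A, ∃ j ∈ Ideal.span {x | ∃ a ∈ I, x = τ (1 ⊗ₜ[k] a)},
      t ⊗ₜ[k] (1 : A) = (1 ⊗ₜ s) * u + j := by
  let q : A ⊗[k] A →ₐ[A] A ⊗[k] (A ⧸ I) :=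
    Algebra.TensorProduct.map (AlgHom.id A A) (Ideal.Quotient.mkₐ k I)
  have hqs : Function.Surjective q := by
    intro x
    induction x with
    | zero => exact ⟨0, map_zero _⟩
    | tmul a b =>
      obtain ⟨b, rfl⟩ := Ideal.Quotient.mkₐ_surjective k I b
      exact ⟨a ⊗ₜ b, Algebra.TensorProduct.map_tmul ..⟩
    | add x y hx hy =>
      obtain ⟨x, rfl⟩ := hx
      obtain ⟨y, rfl⟩ := hy
      exact ⟨x + y, map_add ..⟩
  let K : Ideal (A ⊗[k] A) := Ideal.span {x | ∃ a ∈ I, x = 1 ⊗ₜ[k] a}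
  have hK : ∀ x, q x = 0 ↔ x ∈ K := by
    intro x
    have h := Algebra.TensorProduct.lTensor_ker (R := k) (A := A) (Ideal.Quotient.mkₐ k I)
      (Ideal.Quotient.mkₐ_surjective k I)
    have h2 : Ideal.map (Algebra.TensorProduct.includeRight : A →ₐ[k] A ⊗[k] A)
      (RingHom.ker (Ideal.Quotient.mkₐ k I)) = K := by
      unfold Ideal.map
      congr 1
      ext y
      constructor
      · rintro ⟨a, ha, rfl⟩
        exact ⟨a, Ideal.Quotient.eq_zero_iff_mem.mp ha, rfl⟩
      · rintro ⟨a, ha, rfl⟩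
        exact ⟨a, Ideal.Quotient.eq_zero_iff_mem.mpr ha, rfl⟩
    rw [← h2, ← h]
    exact Iff.rfl
  have hθK : ∀ x ∈ K, θ x ∈ K := by
    intro x hx
    induction hx using Submodule.span_induction with
    | mem x hx =>
      obtain ⟨a, ha, rfl⟩ := hx
      rw [hθ2]; exact Ideal.subset_span ⟨a, ha, rfl⟩
    | zero => simp
    | add x y _ _ hx hy => rw [map_add]; exact add_mem hx hy
    | smul c x _ hx => rw [smul_eq_mul, map_mul]; exact K.mul_mem_left _ hx
  have hθK' : ∀ x ∈ K, θ.symm x ∈ K := by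
    intro x hx
    induction hx using Submodule.span_induction with
    | mem x hx =>
      obtain ⟨a, ha, rfl⟩ := hx
      rw [← hθ2, AlgEquiv.symm_apply_apply]; exact Ideal.subset_span ⟨a, ha, rfl⟩
    | zero => simp
    | add x y _ _ hx hy => rw [map_add]; exact add_mem hx hy
    | smul c x _ hx => rw [smul_eq_mul, map_mul]; exact K.mul_mem_left _ hx
  have hτK : ∀ x ∈ K, τ x ∈ Ideal.span {x | ∃ a ∈ I, x = τ (1 ⊗ₜ[k] a)} := by
    intro x hx
    induction hx using Submodule.span_induction with
    | mem x hx =>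
      obtain ⟨a, ha, rfl⟩ := hx
      exact Ideal.subset_span ⟨a, ha, rfl⟩
    | zero => simp
    | add x y _ _ hx hy => rw [map_add]; exact add_mem hx hy
    | smul c x _ hx => rw [smul_eq_mul, map_mul]; exact Ideal.mul_mem_left _ _ hx
  let z := q (τ.symm (1 ⊗ₜ s))
  have hz : z ∈ nonZeroDivisors (A ⊗[k] (A ⧸ I)) := by
    rw [mem_nonZeroDivisors_iff_right]
    intro x hx
    obtain ⟨w, rfl⟩ := hqs x
    rw [← map_mul, hK, ← hθ1] at hx
    have h1 := hθK' _ hx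
    rw [map_mul, AlgEquiv.symm_apply_apply, ← hK, map_mul] at h1
    have h2 : q (s ⊗ₜ 1) = algebraMap A _ s := by simp [q]
    rw [h2, mul_comm, ← Algebra.smul_def] at h1
    have h3 := (smul_eq_zero.1 h1).resolve_left hs
    rw [hK] at h3 ⊢
    simpa using hθK _ h3
  have hza : IsAlgebraic A z := (Algebra.IsIntegral.isIntegral z).isAlgebraic
  obtain ⟨t, ht, htd⟩ := hza.exists_nonzero_dvd hz
  obtain ⟨y, hy⟩ := htd
  obtain ⟨w, rfl⟩ := hqs y
  have h2 : q (t ⊗ₜ 1) = algebraMap A _ t := by simp [q]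
  rw [← h2, ← map_mul, ← sub_eq_zero, ← map_sub, hK] at hy
  refine ⟨t, ht, τ w, _, hτK _ hy, ?_⟩
  rw [map_sub, map_mul, hτ, AlgEquiv.apply_symm_apply]
  ring


noncomputable section

section
variable {k A V M N : Type} [Field k] [CommRing A] [Algebra k A]
  [AddCommGroup V] [Module k V] [AddCommGroup M] [Module k M] [Module A M] [IsScalarTower k A M]
  [AddCommGroup N] [Module k N] [Module A N] [IsScalarTower k A N]

/-- action of the tensor square -/
def act (σ : A →ₐ[k] Module.End k V) (M : Type) [AddCommGroup M] [Module k M] [Module A M]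
    [IsScalarTower k A M] : A ⊗[k] A →ₐ[k] Module.End k (V ⊗[k] M) :=
  (Module.endTensorEndAlgHom (R := k) (A := k) (S := k) (M := V) (N := M)).comp
    (Algebra.TensorProduct.map σ (Algebra.lsmul k k M))

theorem act_tmul (σ : A →ₐ[k] Module.End k V) (x y : A) (v : V) (m : M) :
    act σ M (x ⊗ₜ y) (v ⊗ₜ m) = σ x v ⊗ₜ (y • m) := by
  simp only [act, AlgHom.comp_apply, Algebra.TensorProduct.map_tmul]
  rw [Module.endTensorEndAlgHom_apply]
  rfl

theorem act_nat (σ : A →ₐ[k] Module.End k V) (φ : M →ₗ[A] N) (c : A ⊗[k] A) (z : V ⊗[k] M) :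
    (φ.restrictScalars k).lTensor V (act σ M c z) =
      act σ N c ((φ.restrictScalars k).lTensor V z) := by
  induction c with
  | zero => simp
  | add x y hx hy => simp [hx, hy]
  | tmul x y =>
    induction z with
    | zero => simp
    | add x y hx hy => simp [hx, hy]
    | tmul v m => simp [act_tmul]

/-- the submodule -/
def JQ (σ : A →ₐ[k] Module.End k V) (M : Type) [AddCommGroup M] [Module k M] [Module A M]
    [IsScalarTower k A M] (τ : (A ⊗[k] A) ≃ₐ[k] (A ⊗[k] A)) (I : Ideal A) :
    Submodule k (V ⊗[k] M) :=
  Submodule.span k {x | ∃ a ∈ I, ∃ z, x = act σ M (τ (1 ⊗ₜ a)) z}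

theorem JQ_stable (σ : A →ₐ[k] Module.End k V) (τ : (A ⊗[k] A) ≃ₐ[k] (A ⊗[k] A)) (I : Ideal A)
    (c : A ⊗[k] A) : JQ σ M τ I ≤ (JQ σ M τ I).comap (act σ M c) := by
  refine Submodule.span_le.2 ?_
  rintro _ ⟨a, ha, z, rfl⟩
  refine Submodule.subset_span ⟨a, ha, act σ M c z, ?_⟩
  rw [← Module.End.mul_apply, ← Module.End.mul_apply, ← map_mul, ← map_mul, mul_comm]

theorem JQ_nat (σ : A →ₐ[k] Module.End k V) (τ : (A ⊗[k] A) ≃ₐ[k] (A ⊗[k] A)) (I : Ideal A)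
    (φ : M →ₗ[A] N) : JQ σ M τ I ≤ (JQ σ N τ I).comap ((φ.restrictScalars k).lTensor V) := by
  refine Submodule.span_le.2 ?_
  rintro _ ⟨a, ha, z, rfl⟩
  exact Submodule.subset_span ⟨a, ha, _, act_nat ..⟩

theorem JQ_mem (σ : A →ₐ[k] Module.End k V) (τ : (A ⊗[k] A) ≃ₐ[k] (A ⊗[k] A)) (I : Ideal A)
    (j : A ⊗[k] A) (hj : j ∈ Ideal.span {x | ∃ a ∈ I, x = τ (1 ⊗ₜ[k] a)}) (z : V ⊗[k] M) :
    act σ M j z ∈ JQ σ M τ I := by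
  induction hj using Submodule.span_induction with
  | mem x hx =>
    obtain ⟨a, ha, rfl⟩ := hx
    exact Submodule.subset_span ⟨a, ha, z, rfl⟩
  | zero => simp
  | add x y _ _ hx hy => rw [map_add]; exact add_mem hx hy
  | smul c x _ hx =>
    rw [smul_eq_mul, map_mul]; exact JQ_stable σ τ I c hx

/-- `I M`. -/
def IM (k : Type) {A : Type} [Field k] [CommRing A] (M : Type) [AddCommGroup M] [Module k M]
    [Module A M] (I : Ideal A) : Submodule k M :=
  Submodule.span k {x | ∃ a ∈ I, ∃ m : M, x = a • m}

theorem dimF (σ : A →ₐ[k] Module.End k V) (τ : (A ⊗[k] A) ≃ₐ[k] (A ⊗[k] A)) (I : Ideal A)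
    (T : (V ⊗[k] M) ≃ₗ[k] (V ⊗[k] M))
    (hT : ∀ (v : V) (a : A) (m : M), T (v ⊗ₜ (a • m)) = act σ M (τ (1 ⊗ₜ a)) (T (v ⊗ₜ m))) :
    Nonempty (((V ⊗[k] M) ⧸ JQ σ M τ I) ≃ₗ[k] (V ⊗[k] (M ⧸ IM k M I))) := by
  have hT' : ∀ (a : A) (z : V ⊗[k] M),
      T (((Algebra.lsmul k k M a).lTensor V) z) = act σ M (τ (1 ⊗ₜ a)) (T z) := by
    intro a z
    induction z with
    | zero => simp
    | add x y hx hy => simp only [map_add, hx, hy]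
    | tmul v m => simpa using hT v a m
  have hmap : (LinearMap.range ((IM k M I).subtype.lTensor V)).map
      (T : (V ⊗[k] M) →ₗ[k] (V ⊗[k] M)) = JQ σ M τ I := by
    apply le_antisymm
    · rw [Submodule.map_le_iff_le_comap]
      rintro _ ⟨z, rfl⟩
      induction z with
      | zero => simp
      | add x y hx hy => rw [map_add]; exact add_mem hx hy
      | tmul v m =>
        obtain ⟨m, hm⟩ := m
        simp only [LinearMap.lTensor_tmul, Submodule.subtype_apply]
        unfold IM at hm
        induction hm using Submodule.span_induction with
        | mem x hx =>
          obtain ⟨a, ha, m, rfl⟩ := hx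
          exact Submodule.subset_span ⟨a, ha, _, hT v a m⟩
        | zero => simp
        | add x y _ _ hx hy => rw [tmul_add]; exact add_mem hx hy
        | smul c x _ hx => rw [tmul_smul]; exact Submodule.smul_mem _ _ hx
    · refine Submodule.span_le.2 ?_
      rintro _ ⟨a, ha, z, rfl⟩
      obtain ⟨z, rfl⟩ := T.surjective z
      refine ⟨((Algebra.lsmul k k M a).lTensor V) z, ?_, hT' a z⟩
      induction z with
      | zero => simp
      | add x y hx hy => rw [map_add]; exact add_mem hx hy
      | tmul v m =>
        exact ⟨v ⊗ₜ ⟨a • m, Submodule.subset_span ⟨a, ha, m, rfl⟩⟩, rfl⟩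
  let e1 := Submodule.Quotient.equiv (LinearMap.range ((IM k M I).subtype.lTensor V))
    (JQ σ M τ I) T hmap
  let e2 := lTensor.equiv V (f := (IM k M I).subtype) (g := (IM k M I).mkQ)
    (LinearMap.exact_subtype_mkQ (IM k M I)) (Submodule.mkQ_surjective _)
  exact ⟨e1.symm.trans e2⟩

/-- the twist on `V ⊗ A` -/
def TA (σ : A →ₐ[k] Module.End k V) (τ : (A ⊗[k] A) →ₐ[k] (A ⊗[k] A)) :
    (V ⊗[k] A) →ₗ[k] (V ⊗[k] A) :=
  TensorProduct.lift (LinearMap.flip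
    { toFun := fun a => (act σ A (τ (1 ⊗ₜ a))) ∘ₗ (TensorProduct.mk k V A).flip 1
      map_add' := fun a b => by ext; simp [tmul_add]
      map_smul' := fun a b => by ext; simp })

theorem TA_tmul (σ : A →ₐ[k] Module.End k V) (τ : (A ⊗[k] A) →ₐ[k] (A ⊗[k] A)) (v : V) (a : A) :
    TA σ τ (v ⊗ₜ a) = act σ A (τ (1 ⊗ₜ a)) (v ⊗ₜ 1) := rfl

theorem TA_act (σ : A →ₐ[k] Module.End k V) (τ : (A ⊗[k] A) →ₐ[k] (A ⊗[k] A))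
    (hτ : ∀ x : A, τ (x ⊗ₜ 1) = x ⊗ₜ 1) (c : A ⊗[k] A) (v : V) :
    TA σ τ (act σ A c (v ⊗ₜ 1)) = act σ A (τ c) (v ⊗ₜ 1) := by
  induction c with
  | zero => simp
  | add x y hx hy => simp only [map_add, LinearMap.add_apply, hx, hy]
  | tmul x y =>
    rw [act_tmul, smul_eq_mul, mul_one, TA_tmul]
    have h1 : x ⊗ₜ[k] y = (1 ⊗ₜ y) * (x ⊗ₜ 1) := by simp
    rw [h1, map_mul, map_mul, Module.End.mul_apply, hτ, act_tmul, one_smul]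

theorem dimFA (σ : A →ₐ[k] Module.End k V) (τ : (A ⊗[k] A) ≃ₐ[k] (A ⊗[k] A)) (I : Ideal A)
    (hτ : ∀ x : A, τ (x ⊗ₜ 1) = x ⊗ₜ 1) :
    Nonempty (((V ⊗[k] A) ⧸ JQ σ A τ I) ≃ₗ[k] (V ⊗[k] (A ⧸ IM k A I))) := by
  have hτ' : ∀ x : A, τ.symm (x ⊗ₜ 1) = x ⊗ₜ 1 := fun x => by
    rw [AlgEquiv.symm_apply_eq, hτ]
  refine dimF σ τ I (LinearEquiv.ofLinearMap (TA σ τ.toAlgHom) (TA σ τ.symm.toAlgHom) ?_ ?_) ?_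
  · ext v a
    simp only [TensorProduct.AlgebraTensorModule.curry_apply, LinearMap.restrictScalars_self,
      TensorProduct.curry_apply, LinearMap.comp_apply, LinearMap.id_apply]
    rw [TA_tmul, TA_act _ _ hτ]
    simp [act_tmul]
  · ext v a
    simp only [TensorProduct.AlgebraTensorModule.curry_apply, LinearMap.restrictScalars_self,
      TensorProduct.curry_apply, LinearMap.comp_apply, LinearMap.id_apply]
    rw [TA_tmul, TA_act _ _ hτ']
    simp [act_tmul]
  · intro v a b
    simp only [LinearEquiv.coe_ofLinearMap, TA_tmul]
    have h1 : (1 : A) ⊗ₜ[k] (a • b) = (1 ⊗ₜ a) * (1 ⊗ₜ b) := by simp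
    rw [h1, map_mul, map_mul]; rfl

theorem lemF [Module.Finite k V] [Nontrivial V]
    (σ : A →ₐ[k] Module.End k V) (τ : (A ⊗[k] A) ≃ₐ[k] (A ⊗[k] A)) (I : Ideal A)
    [Module.Finite k (A ⧸ IM k A I)]
    (hτ : ∀ x : A, τ (x ⊗ₜ 1) = x ⊗ₜ 1)
    (T : (V ⊗[k] M) ≃ₗ[k] (V ⊗[k] M))
    (hT : ∀ (v : V) (a : A) (m : M), T (v ⊗ₜ (a • m)) = act σ M (τ (1 ⊗ₜ a)) (T (v ⊗ₜ m)))
    (s t : A) (u j : A ⊗[k] A) (hj : j ∈ Ideal.span {x | ∃ a ∈ I, x = τ (1 ⊗ₜ[k] a)})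
    (htu : t ⊗ₜ[k] (1 : A) = (1 ⊗ₜ s) * u + j) (ht : Function.Surjective (σ t))
    (r : ℕ) (E : Fin r → A →ₗ[A] M) (F : Fin r → M →ₗ[A] A)
    (h1 : ∀ m, ∑ i, E i (F i m) = s • m) (h2 : ∀ i a, F i (E i a) = s • a)
    (h3 : ∀ i j a, i ≠ j → F i (E j a) = 0) :
    Module.finrank k (M ⧸ IM k M I) = r * Module.finrank k (A ⧸ IM k A I) ∧
      Module.Finite k (M ⧸ IM k M I) := by
  have key : ∀ (N : Type) [AddCommGroup N] [Module k N] [Module A N] [IsScalarTower k A N]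
      (z : V ⊗[k] N), ∃ w, act σ N (1 ⊗ₜ s) w - z ∈ JQ σ N τ I := by
    intro N _ _ _ _ z
    have hw : ∃ w, act σ N (t ⊗ₜ 1) w = z := by
      induction z with
      | zero => exact ⟨0, map_zero _⟩
      | add x y hx hy =>
        obtain ⟨x', rfl⟩ := hx
        obtain ⟨y', rfl⟩ := hy
        exact ⟨x' + y', map_add ..⟩
      | tmul v n =>
        obtain ⟨v, rfl⟩ := ht v
        exact ⟨v ⊗ₜ n, by rw [act_tmul, one_smul]⟩
    obtain ⟨w, rfl⟩ := hw
    refine ⟨act σ N u w, ?_⟩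
    rw [htu, map_add, map_mul]
    have := JQ_mem (M := N) σ τ I j hj w
    simpa using this
  have hss : ∀ (N : Type) [AddCommGroup N] [Module k N] [Module A N] [IsScalarTower k A N]
      (z : V ⊗[k] N), act σ N (1 ⊗ₜ s) z = (Algebra.lsmul k k N s).lTensor V z := by
    intro N _ _ _ _ z
    induction z with
    | zero => simp
    | add x y hx hy => simp only [map_add, hx, hy]
    | tmul v n => simp [act_tmul]
  let eE : Fin r → ((V ⊗[k] A) ⧸ JQ σ A τ I) →ₗ[k] ((V ⊗[k] M) ⧸ JQ σ M τ I) := fun i =>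
    Submodule.mapQ _ _ _ (JQ_nat σ τ I (E i))
  let eF : Fin r → ((V ⊗[k] M) ⧸ JQ σ M τ I) →ₗ[k] ((V ⊗[k] A) ⧸ JQ σ A τ I) := fun i =>
    Submodule.mapQ _ _ _ (JQ_nat σ τ I (F i))
  let f1 : (Fin r → ((V ⊗[k] A) ⧸ JQ σ A τ I)) →ₗ[k] ((V ⊗[k] M) ⧸ JQ σ M τ I) :=
    ∑ i, eE i ∘ₗ LinearMap.proj i
  let f2 : ((V ⊗[k] M) ⧸ JQ σ M τ I) →ₗ[k] (Fin r → ((V ⊗[k] A) ⧸ JQ σ A τ I)) :=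
    LinearMap.pi eF
  have hEF : ∀ w : V ⊗[k] M, ∑ i, ((E i).restrictScalars k).lTensor V
      (((F i).restrictScalars k).lTensor V w) = act σ M (1 ⊗ₜ s) w := by
    intro w
    induction w with
    | zero => simp
    | add x y hx hy => simp only [map_add, Finset.sum_add_distrib, hx, hy]
    | tmul v m =>
      simp only [LinearMap.lTensor_tmul, LinearMap.coe_restrictScalars, act_tmul, ← tmul_sum, h1,
        map_one, Module.End.one_apply]
  have hFE : ∀ i (w : V ⊗[k] A), ((F i).restrictScalars k).lTensor V
      (((E i).restrictScalars k).lTensor V w) = act σ A (1 ⊗ₜ s) w := by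
    intro i w
    induction w with
    | zero => simp
    | add x y hx hy => simp only [map_add, hx, hy]
    | tmul v m =>
      simp only [LinearMap.lTensor_tmul, LinearMap.coe_restrictScalars, act_tmul, h2,
        map_one, Module.End.one_apply]
  have hFE' : ∀ i j (w : V ⊗[k] A), i ≠ j → ((F i).restrictScalars k).lTensor V
      (((E j).restrictScalars k).lTensor V w) = 0 := by
    intro i j w hij
    induction w with
    | zero => simp
    | add x y hx hy => simp only [map_add, hx, hy, add_zero]
    | tmul v m =>
      simp only [LinearMap.lTensor_tmul, LinearMap.coe_restrictScalars, h3 i j _ hij, tmul_zero]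
  have hf1 : Function.Surjective f1 := by
    intro z
    obtain ⟨z, rfl⟩ := Submodule.mkQ_surjective _ z
    obtain ⟨w, hw⟩ := key M z
    refine ⟨fun i => Submodule.mkQ _ (((F i).restrictScalars k).lTensor V w), ?_⟩
    have e1 : f1 (fun i => Submodule.mkQ _ (((F i).restrictScalars k).lTensor V w)) =
        Submodule.mkQ _ (∑ i, ((E i).restrictScalars k).lTensor V
      (((F i).restrictScalars k).lTensor V w)) := by
      rw [map_sum]
      simp [f1, eE]
    rw [e1, hEF]
    exact (Submodule.Quotient.eq _).2 hw
  have hf2 : Function.Surjective f2 := by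
    intro y
    have h4 : ∀ i, ∃ w, Submodule.mkQ _ (act σ A (1 ⊗ₜ s) w) = y i := by
      intro i
      obtain ⟨z, hz⟩ := Submodule.mkQ_surjective _ (y i)
      obtain ⟨w, hw⟩ := key A z
      exact ⟨w, by rw [← hz]; exact (Submodule.Quotient.eq _).2 hw⟩
    choose w hw using h4
    refine ⟨Submodule.mkQ _ (∑ j, ((E j).restrictScalars k).lTensor V (w j)), ?_⟩
    funext i
    have e1 : f2 (Submodule.mkQ _ (∑ j, ((E j).restrictScalars k).lTensor V (w j))) i =
      Submodule.mkQ _ (((F i).restrictScalars k).lTensor V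
        (∑ j, ((E j).restrictScalars k).lTensor V (w j))) := rfl
    rw [e1, map_sum, Finset.sum_eq_single i (fun j _ hj => hFE' i j _ hj.symm) (by simp), hFE, hw]
  obtain ⟨e1⟩ := dimF (M := M) σ τ I T hT
  obtain ⟨e2⟩ := dimFA σ τ I hτ
  have fA : Module.Finite k ((V ⊗[k] A) ⧸ JQ σ A τ I) := Module.Finite.equiv e2.symm
  have fM : Module.Finite k ((V ⊗[k] M) ⧸ JQ σ M τ I) := Module.Finite.of_surjective f1 hf1
  have l1 := LinearMap.finrank_le_finrank_of_surjective hf1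
  have l2 := LinearMap.finrank_le_finrank_of_surjective hf2
  have l3 := le_antisymm l1 l2
  rw [Module.finrank_pi_fintype, Finset.sum_const, Finset.card_univ, Fintype.card_fin,
    smul_eq_mul, e1.finrank_eq, e2.finrank_eq, Module.finrank_tensorProduct,
    Module.finrank_tensorProduct] at l3
  have hV : 0 < Module.finrank k V := Module.finrank_pos
  constructor
  · apply Nat.eq_of_mul_eq_mul_left hV
    rw [l3]; ring
  · have fVM : Module.Finite k (V ⊗[k] (M ⧸ IM k M I)) := Module.Finite.equiv e1
    obtain ⟨v, hv⟩ := exists_ne (0 : V)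
    obtain ⟨f, hf⟩ := Module.Projective.exists_dual_eq_one k hv
    refine Module.Finite.of_surjective ((TensorProduct.lid k (M ⧸ IM k M I)).toLinearMap ∘ₗ
      f.rTensor (M ⧸ IM k M I)) fun n => ⟨v ⊗ₜ n, ?_⟩
    simp [hf]


end
end

theorem exists_char (k A : Type) [Field k] [IsAlgClosed k] [CommRing A] [IsDomain A] [Algebra k A]
    [Algebra.FiniteType k A] (a : A) (ha : a ≠ 0) : ∃ p : A →ₐ[k] k, p a ≠ 0 := by
  have : Nontrivial (Localization.Away a) :=
    (IsLocalization.injective (Localization.Away a)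
      (powers_le_nonZeroDivisors_of_noZeroDivisors ha)).nontrivial
  obtain ⟨m, hm⟩ := Ideal.exists_maximal (Localization.Away a)
  let _ := Ideal.Quotient.field m
  have hft : Algebra.FiniteType A (Localization.Away a) := inferInstance
  have hft2 : Algebra.FiniteType k (Localization.Away a) := 
    Algebra.FiniteType.trans (S := A) inferInstance hft
  have hft3 : Algebra.FiniteType k (Localization.Away a ⧸ m) :=
    Algebra.FiniteType.of_surjective (Ideal.Quotient.mkₐ k m) (Ideal.Quotient.mkₐ_surjective k m)
  have hfin : Module.Finite k (Localization.Away a ⧸ m) := finite_of_finite_type_of_isJacobsonRing k _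
  have hb := IsAlgClosed.algebraMap_bijective_of_isIntegral (k := k) (K := Localization.Away a ⧸ m)
  let e := AlgEquiv.ofBijective (Algebra.ofId k (Localization.Away a ⧸ m)) hb
  let q : A →ₐ[k] (Localization.Away a ⧸ m) :=
    (Ideal.Quotient.mkₐ k m).comp (IsScalarTower.toAlgHom k A (Localization.Away a))
  refine ⟨(e.symm : (Localization.Away a ⧸ m) →ₐ[k] k).comp q, ?_⟩
  intro h
  have h1 : e.symm (q a) = 0 := h
  rw [map_eq_zero_iff _ e.symm.injective] at h1
  have h2 : IsUnit (q a) := (IsLocalization.Away.algebraMap_isUnit a).map (Ideal.Quotient.mkₐ k m)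
  exact h2.ne_zero h1

theorem lemV (k A R M : Type) [Field k] [IsAlgClosed k] [CommRing A] [IsDomain A] [Algebra k A]
    [Algebra.FiniteType k A] [Ring R] [Algebra k R] (j : A →ₐ[k] R) (hj : Function.Injective j)
    [Module A R] [IsScalarTower k A R] (hjR : ∀ (a : A) (x : R), a • x = j a * x)
    [Module.Finite A R] [AddCommGroup M] [Module k M] [Module A M] [IsScalarTower k A M]
    [Module.Finite A M] (e : R ≃ₗ[k] M) (he : ∀ (a : A) (x : R), e (x * j a) = a • e x)
    (r : ℕ) (s : A) (hs : s ≠ 0) (E : Fin r → A →ₗ[A] M) (F : Fin r → M →ₗ[A] A)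
    (h1 : ∀ m, ∑ i, E i (F i m) = s • m) (h2 : ∀ i a, F i (E i a) = s • a) (t : A) (ht : t ≠ 0) :
    ∃ (V : Type) (_ : AddCommGroup V) (_ : Module k V) (ρ : R →ₐ[k] Module.End k V),
      Module.Finite k V ∧ Nontrivial V ∧ Function.Surjective (ρ (j t)) := by
  let l : A →ₐ[k] Module.End A R := AlgHom.ofLinearMap
    { toFun := fun a =>
        { toFun := fun x => x * j a
          map_add' := fun x y => add_mul ..
          map_smul' := fun b x => by simp [hjR, mul_assoc] }
      map_add' := fun a b => by ext x; simp [mul_add]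
      map_smul' := fun c a => by ext x; simp }
    (by ext x; simp)
    (fun a b => by
      ext x
      change x * j (a * b) = x * j b * j a
      rw [mul_comm, map_mul, mul_assoc])
  obtain ⟨a, ha0, ha⟩ := lemG k A R l t ht
  have hr : r ≠ 0 := by
    rintro rfl
    have h := h1 (e 1)
    rw [← he, Finset.univ_eq_empty, Finset.sum_empty, one_mul, eq_comm, map_eq_zero_iff _ e.injective,
      map_eq_zero_iff _ hj] at h
    exact hs h
  let i0 : Fin r := ⟨0, Nat.pos_of_ne_zero hr⟩
  obtain ⟨p, hp⟩ := exists_char k A (a * s) (mul_ne_zero ha0 hs)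
  rw [map_mul] at hp
  have hpa := left_ne_zero_of_mul hp
  have hps := right_ne_zero_of_mul hp
  let W : Submodule R R := Submodule.span R {x | ∃ b, p b = 0 ∧ x = j b}
  have hW : ∀ (x : R) (c : A), (Submodule.Quotient.mk (x * j c) : R ⧸ W) =
      p c • Submodule.Quotient.mk x := by
    intro x c
    rw [← Submodule.Quotient.mk_smul, Submodule.Quotient.eq]
    have : x * j c - p c • x = x • j (c - algebraMap k A (p c)) := by
      simp [mul_sub, Algebra.commutes, Algebra.smul_def]
    rw [this]
    exact W.smul_mem _ (Submodule.subset_span ⟨_, by simp, rfl⟩)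
  refine ⟨R ⧸ W, inferInstance, inferInstance, Algebra.lsmul k k (R ⧸ W), ?_, ?_, ?_⟩
  · obtain ⟨S, hS⟩ := (Module.Finite.fg_top : (⊤ : Submodule A M).FG)
    classical
    refine ⟨⟨S.image (fun m => (Submodule.Quotient.mk (e.symm m) : R ⧸ W)), ?_⟩⟩
    rw [eq_top_iff]
    rintro x -
    obtain ⟨x, rfl⟩ := Submodule.mkQ_surjective _ x
    obtain ⟨m, rfl⟩ := e.symm.surjective x
    have hm : m ∈ Submodule.span A (S : Set M) := by rw [hS]; trivial
    induction hm using Submodule.span_induction with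
    | mem x hx =>
      refine Submodule.subset_span ?_
      rw [Finset.coe_image]
      exact ⟨x, hx, rfl⟩
    | zero => simp
    | add x y _ _ hx hy => rw [map_add, map_add]; exact add_mem hx hy
    | smul c x _ hx =>
      have h3 : e.symm (c • x) = e.symm x * j c := by
        rw [LinearEquiv.symm_apply_eq, he, LinearEquiv.apply_symm_apply]
      rw [h3]
      have := hW (e.symm x) c
      rw [Submodule.mkQ_apply, this]
      exact Submodule.smul_mem _ _ hx
  · rw [Submodule.Quotient.nontrivial_iff]
    intro hWt
    let φ : R →+ k := (p : A →+ k).comp ((F i0).toAddMonoidHom.comp (e : R →+ M))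
    have hφ : ∀ (x : R) (b : A), φ (x * j b) = p b * φ x := by
      intro x b
      change p (F i0 (e (x * j b))) = _
      rw [he, map_smul, smul_eq_mul, map_mul]; rfl
    have h4 : ∀ x ∈ W, ∀ y : R, φ (y * x) = 0 := by
      intro x hx
      induction hx using Submodule.span_induction with
      | mem x hx =>
        obtain ⟨b, hb, rfl⟩ := hx
        intro y; rw [hφ, hb, zero_mul]
      | zero => simp
      | add x y _ _ hx hy => intro z; rw [mul_add, map_add, hx, hy, add_zero]
      | smul c x _ hx => intro y; rw [smul_eq_mul, ← mul_assoc, hx]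
    have h5 := h4 (e.symm (E i0 1)) (by rw [hWt]; trivial) 1
    rw [one_mul] at h5
    change p (F i0 (e (e.symm (E i0 1)))) = 0 at h5
    rw [LinearEquiv.apply_symm_apply, h2, smul_eq_mul, mul_one] at h5
    exact hps h5
  · intro v
    obtain ⟨x, rfl⟩ := Submodule.mkQ_surjective _ v
    obtain ⟨x', hx'⟩ := ha x
    have hx2 : x * j a = j t * x' := by rw [← hjR]; exact hx'
    refine ⟨(p a)⁻¹ • Submodule.Quotient.mk x', ?_⟩
    rw [map_smul]
    change (p a)⁻¹ • (Submodule.Quotient.mk (j t * x') : R ⧸ W) = Submodule.Quotient.mk x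
    rw [← hx2, hW, smul_smul, inv_mul_cancel₀ hpa, one_smul]


theorem main5 (k A R M : Type) [Field k] [IsAlgClosed k] [CommRing A] [IsDomain A] [Algebra k A]
    [Algebra.FiniteType k A] [Ring R] [Algebra k R] (j : A →ₐ[k] R) (hj : Function.Injective j)
    [Module A R] [IsScalarTower k A R] (hjR : ∀ (a : A) (x : R), a • x = j a * x)
    [Module.Finite A R] [AddCommGroup M] [Module k M] [Module A M] [IsScalarTower k A M]
    [Module.Finite A M] (e : R ≃ₗ[k] M) (he : ∀ (a : A) (x : R), e (x * j a) = a • e x)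
    (τ θ : (A ⊗[k] A) ≃ₐ[k] (A ⊗[k] A)) (hτ : ∀ x : A, τ (x ⊗ₜ 1) = x ⊗ₜ 1)
    (hθ1 : ∀ x : A, θ (x ⊗ₜ 1) = τ.symm (1 ⊗ₜ x)) (hθ2 : ∀ x : A, θ (1 ⊗ₜ x) = 1 ⊗ₜ x)
    (hT : ∀ (V : Type) [AddCommGroup V] [Module k V] (ρ : R →ₐ[k] Module.End k V),
      ∃ T : (V ⊗[k] M) ≃ₗ[k] (V ⊗[k] M), ∀ (v : V) (a : A) (m : M),
        T (v ⊗ₜ (a • m)) = act (ρ.comp j) M (τ (1 ⊗ₜ a)) (T (v ⊗ₜ m))) :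
    ∃ r : ℕ, ∀ I : Ideal A, Module.Finite k (A ⧸ I) →
      Module.finrank k (M ⧸ IM k M I) = r * Module.finrank k (A ⧸ I.restrictScalars k) ∧
      Module.Finite k (M ⧸ IM k M I) := by
  have : IsNoetherianRing A := Algebra.FiniteType.isNoetherianRing k A
  obtain ⟨r, s, E, F, hs, h1, h2, h3⟩ := lemR A M
  refine ⟨r, fun I hI => ?_⟩
  obtain ⟨t, ht, u, j', hj', htu⟩ := lemT k A τ θ hτ hθ1 hθ2 I s hs
  obtain ⟨V, _, _, ρ, _, _, hsurj⟩ := lemV k A R M j hj hjR e he r s hs E F h1 h2 t ht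
  obtain ⟨T, hT⟩ := hT V ρ
  have hIM : IM k A I = I.restrictScalars k := by
    apply le_antisymm
    · refine Submodule.span_le.2 ?_
      rintro _ ⟨a, ha, m, rfl⟩
      exact I.mul_mem_right m ha
    · intro a ha
      exact Submodule.subset_span ⟨a, ha, 1, by simp⟩
  have hf : Module.Finite k (A ⧸ IM k A I) := by
    rw [hIM]; exact hI
  have := lemF (ρ.comp j) τ I hτ T hT s t u j' hj' htu hsurj r E F h1 h2 h3
  rw [hIM] at this
  exact this

end Sub13

namespace Sub13
noncomputable section

section
variable {k C V : Type} [Field k] [AddCommGroup C] [Module k C] [AddCommGroup V] [Module k V]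

/-- twisting operator -/
def TT (D : C →ₗ[k] C ⊗[k] C) (f : C →ₗ[k] Module.End k V) : (V ⊗[k] C) →ₗ[k] (V ⊗[k] C) :=
  TensorProduct.lift (LinearMap.lcomp k _ D ∘ₗ LinearMap.rTensorHom C ∘ₗ f.flip)

theorem TT_tmul (D : C →ₗ[k] C ⊗[k] C) (f : C →ₗ[k] Module.End k V) (v : V) (h : C) :
    TT D f (v ⊗ₜ h) = (f.flip v).rTensor C (D h) := rfl

theorem TT_comp (D : C →ₗ[k] C ⊗[k] C) (ε : C →ₗ[k] k)
    (hco : ∀ h, TensorProduct.assoc k C C C (D.rTensor C (D h)) = D.lTensor C (D h))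
    (hcu : ∀ h, TensorProduct.lid k C (ε.rTensor C (D h)) = h)
    (f g : C →ₗ[k] Module.End k V)
    (hfg : ∀ h, LinearMap.mul' k (Module.End k V)
      (TensorProduct.map f g (TensorProduct.comm k C C (D h))) = ε h • 1) :
    TT D f ∘ₗ TT D g = LinearMap.id := by
  ext v h
  simp only [TensorProduct.AlgebraTensorModule.curry_apply, LinearMap.restrictScalars_self,
      TensorProduct.curry_apply, LinearMap.comp_apply, LinearMap.id_apply]
  rw [TT_tmul]
  let φ : C ⊗[k] C →ₗ[k] V := LinearMap.applyₗ v ∘ₗ LinearMap.mul' k (Module.End k V) ∘ₗ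
    TensorProduct.map f g ∘ₗ (TensorProduct.comm k C C).toLinearMap
  have hφ : ∀ a b, φ (a ⊗ₜ b) = f b (g a v) := fun a b => rfl
  have hφD : ∀ h, φ (D h) = ε h • v := fun h => by
    change LinearMap.mul' k (Module.End k V)
      (TensorProduct.map f g (TensorProduct.comm k C C (D h))) v = _
    rw [hfg]; rfl
  let Ψ : C ⊗[k] (C ⊗[k] C) →ₗ[k] V ⊗[k] C := φ.rTensor C ∘ₗ
    (TensorProduct.assoc k C C C).symm.toLinearMap
  have s1 : ∀ z : C ⊗[k] C, TT D f ((g.flip v).rTensor C z) = Ψ (D.lTensor C z) := by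
    intro z
    induction z with
    | zero => simp
    | add x y hx hy => simp only [map_add, hx, hy]
    | tmul x y =>
      rw [LinearMap.rTensor_tmul, LinearMap.lTensor_tmul, TT_tmul]
      generalize D y = w
      induction w with
      | zero => simp
      | add x y hx hy => simp only [map_add, tmul_add, hx, hy]
      | tmul a b => simp [Ψ, hφ]
  have s2 : ∀ z : C ⊗[k] C, Ψ (TensorProduct.assoc k C C C (D.rTensor C z)) =
      v ⊗ₜ (TensorProduct.lid k C (ε.rTensor C z)) := by
    intro z
    induction z with
    | zero => simp
    | add x y hx hy => simp only [map_add, hx, hy, tmul_add]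
    | tmul x y =>
      simp only [Ψ, LinearMap.comp_apply, LinearEquiv.coe_coe, LinearEquiv.symm_apply_apply,
        LinearMap.rTensor_tmul, hφD, lid_tmul, smul_tmul]
  rw [s1, ← hco, s2, hcu]

theorem TT_intertwine {A : Type} [CommRing A] [Algebra k A] [Module A C] [IsScalarTower k A C]
    (D : C →ₗ[k] C ⊗[k] C) (DA : A →ₗ[k] A ⊗[k] A) (S : A →ₗ[k] A)
    (hD : ∀ (a : A) (m : C), D (a • m) = TensorProduct.homTensorHomMap (RingHom.id k) C C C C
      (TensorProduct.map (Algebra.lsmul k k C).toLinearMap (Algebra.lsmul k k C).toLinearMap (DA a))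
        (D m))
    (σ : A →ₐ[k] Module.End k V) (f : C →ₗ[k] Module.End k V)
    (hf : ∀ (a : A) (m : C) (v : V), f (a • m) v = σ (S a) (f m v)) (v : V) (a : A) (m : C) :
    TT D f (v ⊗ₜ (a • m)) = act σ C (S.rTensor A (DA a)) (TT D f (v ⊗ₜ m)) := by
  rw [TT_tmul, TT_tmul, hD]
  generalize D m = w
  generalize DA a = z
  induction z with
  | zero => simp
  | add x y hx hy => simp only [map_add, LinearMap.add_apply, hx, hy]
  | tmul x y =>
    induction w with
    | zero => simp
    | add x y hx hy => simp only [map_add, hx, hy]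
    | tmul b c => simp [act_tmul, hf]

theorem cop_co (D : C →ₗ[k] C ⊗[k] C)
    (hco : ∀ h, TensorProduct.assoc k C C C (D.rTensor C (D h)) = D.lTensor C (D h)) (h : C) :
    TensorProduct.assoc k C C C (((TensorProduct.comm k C C).toLinearMap ∘ₗ D).rTensor C
      (((TensorProduct.comm k C C).toLinearMap ∘ₗ D) h)) =
    ((TensorProduct.comm k C C).toLinearMap ∘ₗ D).lTensor C
      (((TensorProduct.comm k C C).toLinearMap ∘ₗ D) h) := by
  let s3 : C ⊗[k] (C ⊗[k] C) →ₗ[k] C ⊗[k] (C ⊗[k] C) :=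
    (TensorProduct.assoc k C C C).toLinearMap ∘ₗ
    ((TensorProduct.comm k C C).toLinearMap).rTensor C ∘ₗ
    (TensorProduct.comm k C (C ⊗[k] C)).toLinearMap
  have e1 : ∀ z : C ⊗[k] C, TensorProduct.assoc k C C C
      (((TensorProduct.comm k C C).toLinearMap ∘ₗ D).rTensor C (TensorProduct.comm k C C z)) =
      s3 (D.lTensor C z) := by
    intro z
    induction z with
    | zero => simp
    | add x y hx hy => simp only [map_add, hx, hy]
    | tmul x y => simp [s3]
  have e2 : ∀ z : C ⊗[k] C, ((TensorProduct.comm k C C).toLinearMap ∘ₗ D).lTensor C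
      (TensorProduct.comm k C C z) =
      s3 (TensorProduct.assoc k C C C (D.rTensor C z)) := by
    intro z
    induction z with
    | zero => simp
    | add x y hx hy => simp only [map_add, hx, hy]
    | tmul x y =>
      simp only [comm_tmul, LinearMap.lTensor_tmul, LinearMap.rTensor_tmul, LinearMap.comp_apply]
      generalize D x = w
      induction w with
      | zero => simp
      | add x y hx hy => simp only [map_add, add_tmul, tmul_add, hx, hy]
      | tmul a b => simp [s3]
  simp only [LinearMap.comp_apply, LinearEquiv.coe_coe]
  rw [e1, e2, hco]

end

section
variable {k A : Type} [Field k] [CommRing A] [HopfAlgebra k A]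

/-- `x ⊗ y ↦ x y₁ ⊗ y₂` -/
def tauInv (D : A →ₐ[k] A ⊗[k] A) : A ⊗[k] A →ₐ[k] A ⊗[k] A :=
  Algebra.TensorProduct.lift Algebra.TensorProduct.includeLeft D (fun _ _ => Commute.all _ _)

theorem tauInv_tmul (D : A →ₐ[k] A ⊗[k] A) (x y : A) :
    tauInv D (x ⊗ₜ y) = (x ⊗ₜ 1) * D y := rfl

theorem tauInv_eq (D : A →ₐ[k] A ⊗[k] A) :
    (tauInv D).toLinearMap = TT D.toLinearMap (LinearMap.mul k A) := by
  ext x y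
  change tauInv D (x ⊗ₜ y) = TT D.toLinearMap (LinearMap.mul k A) (x ⊗ₜ y)
  rw [tauInv_tmul, TT_tmul]
  change _ = ((LinearMap.mul k A).flip x).rTensor A (D y)
  generalize D y = w
  induction w with
  | zero => simp
  | add x y hx hy => simp only [map_add, mul_add, hx, hy]
  | tmul a b => simp [mul_comm]

/-- `x ⊗ y ↦ x S(y₁) ⊗ y₂` -/
def tauD (D : A →ₐ[k] A ⊗[k] A) : A ⊗[k] A →ₐ[k] A ⊗[k] A :=
  tauInv ((Algebra.TensorProduct.map (HopfAlgebra.antipodeAlgHom k A) (AlgHom.id k A)).comp D)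

theorem tauD_eq (D : A →ₐ[k] A ⊗[k] A) :
    (tauD D).toLinearMap = TT D.toLinearMap
      (LinearMap.mul k A ∘ₗ HopfAlgebra.antipode k) := by
  ext x y
  change tauD D (x ⊗ₜ y) = TT D.toLinearMap _ (x ⊗ₜ y)
  rw [tauD, tauInv_tmul, TT_tmul]
  change _ * (Algebra.TensorProduct.map (HopfAlgebra.antipodeAlgHom k A) (AlgHom.id k A)) (D y)
    = ((LinearMap.mul k A ∘ₗ HopfAlgebra.antipode k).flip x).rTensor A (D y)
  generalize D y = w
  induction w with
  | zero => simp
  | add x y hx hy => simp only [map_add, mul_add, hx, hy]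
  | tmul a b => simp [mul_comm]

theorem tau_aux1 (z : A ⊗[k] A) : LinearMap.mul' k (Module.End k A)
    (TensorProduct.map (LinearMap.mul k A ∘ₗ HopfAlgebra.antipode k) (LinearMap.mul k A)
      (TensorProduct.comm k A A z)) =
    LinearMap.mul k A (LinearMap.mul' k A ((HopfAlgebra.antipode k).lTensor A z)) := by
  induction z with
  | zero => simp
  | add x y hx hy => simp only [map_add, hx, hy]
  | tmul x y => ext b; simp [mul_left_comm, mul_assoc]

theorem tau_aux2 (z : A ⊗[k] A) : LinearMap.mul' k (Module.End k A)
    (TensorProduct.map (LinearMap.mul k A) (LinearMap.mul k A ∘ₗ HopfAlgebra.antipode k)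
      (TensorProduct.comm k A A z)) =
    LinearMap.mul k A (LinearMap.mul' k A ((HopfAlgebra.antipode k).rTensor A z)) := by
  induction z with
  | zero => simp
  | add x y hx hy => simp only [map_add, hx, hy]
  | tmul x y => ext b; simp [mul_left_comm, mul_assoc]

/-- the equivalence `τ` -/
def tauE (D : A →ₐ[k] A ⊗[k] A)
    (hco : ∀ h, TensorProduct.assoc k A A A (D.toLinearMap.rTensor A (D h)) =
      D.toLinearMap.lTensor A (D h))
    (hcu : ∀ h, TensorProduct.lid k A ((counit : A →ₗ[k] k).rTensor A (D h)) = h)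
    (h1 : ∀ h, LinearMap.mul' k A ((HopfAlgebra.antipode k).rTensor A (D h)) =
      algebraMap k A (counit h))
    (h2 : ∀ h, LinearMap.mul' k A ((HopfAlgebra.antipode k).lTensor A (D h)) =
      algebraMap k A (counit h)) :
    (A ⊗[k] A) ≃ₐ[k] (A ⊗[k] A) :=
  AlgEquiv.ofAlgHom (tauD D) (tauInv D)
    (by
      apply AlgHom.toLinearMap_injective
      rw [AlgHom.comp_toLinearMap, tauInv_eq, tauD_eq]
      apply TT_comp _ counit hco hcu
      intro h
      have e := congrArg (LinearMap.mul k A) (h2 h)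
      rw [← tau_aux1] at e
      refine e.trans ?_
      ext x; simp [Algebra.smul_def])
    (by
      apply AlgHom.toLinearMap_injective
      rw [AlgHom.comp_toLinearMap, tauInv_eq, tauD_eq]
      apply TT_comp _ counit hco hcu
      intro h
      have e := congrArg (LinearMap.mul k A) (h1 h)
      rw [← tau_aux2] at e
      refine e.trans ?_
      ext x; simp [Algebra.smul_def])

theorem tauE_one (D : A →ₐ[k] A ⊗[k] A) (hco hcu h1 h2) (x : A) :
    tauE D hco hcu h1 h2 (x ⊗ₜ 1) = x ⊗ₜ 1 := by
  change tauD D (x ⊗ₜ 1) = _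
  rw [tauD, tauInv_tmul, map_one, mul_one]

theorem tauE_one' (D : A →ₐ[k] A ⊗[k] A) (hco hcu h1 h2) (x : A) :
    (tauE D hco hcu h1 h2).symm (x ⊗ₜ 1) = x ⊗ₜ 1 := by
  change tauInv D (x ⊗ₜ 1) = _
  rw [tauInv_tmul, map_one, mul_one]

theorem tauE_symm (D : A →ₐ[k] A ⊗[k] A) (hco hcu h1 h2) (x : A) :
    (tauE D hco hcu h1 h2).symm (1 ⊗ₜ x) = D x := by
  change tauInv D (1 ⊗ₜ x) = _
  rw [tauInv_tmul, ← Algebra.TensorProduct.one_def, one_mul]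

theorem tauE_apply (D : A →ₐ[k] A ⊗[k] A) (hco hcu h1 h2) (x : A) :
    tauE D hco hcu h1 h2 (1 ⊗ₜ x) = (HopfAlgebra.antipode k).rTensor A (D x) := by
  change tauD D (1 ⊗ₜ x) = _
  rw [tauD, tauInv_tmul, ← Algebra.TensorProduct.one_def, one_mul]
  rfl

end

end
end Sub13

namespace Sub13
noncomputable section

theorem D1_co (k : Type) {C : Type} [Field k] [AddCommGroup C] [Module k C] [Coalgebra k C] (h : C) :
    TensorProduct.assoc k C C C ((comul : C →ₗ[k] _).rTensor C (comul (R := k) h)) =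
      (comul : C →ₗ[k] _).lTensor C (comul (R := k) h) := Coalgebra.coassoc_apply h

theorem D1_cu (k : Type) {C : Type} [Field k] [AddCommGroup C] [Module k C] [Coalgebra k C] (h : C) :
    TensorProduct.lid k C ((counit : C →ₗ[k] k).rTensor C (comul (R := k) h)) = h := by
  rw [Coalgebra.rTensor_counit_comul]; simp

theorem D2_cu (k : Type) {C : Type} [Field k] [AddCommGroup C] [Module k C] [Coalgebra k C] (h : C) :
    TensorProduct.lid k C ((counit : C →ₗ[k] k).rTensor C
      (TensorProduct.comm k C C (comul (R := k) h))) = h := by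
  have : ∀ z : C ⊗[k] C, TensorProduct.lid k C ((counit : C →ₗ[k] k).rTensor C
      (TensorProduct.comm k C C z)) = TensorProduct.rid k C ((counit : C →ₗ[k] k).lTensor C z) := by
    intro z
    induction z with
    | zero => simp
    | add x y hx hy => simp only [map_add, hx, hy]
    | tmul x y => simp
  rw [this, Coalgebra.lTensor_counit_comul]; simp

section
variable (k A : Type) [Field k] [CommRing A] [HopfAlgebra k A]

/-- comultiplication -/
def D1 : A →ₐ[k] A ⊗[k] A := Bialgebra.comulAlgHom k A

/-- opposite comultiplication -/
def D2 : A →ₐ[k] A ⊗[k] A :=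
  (Algebra.TensorProduct.comm k A A).toAlgHom.comp (Bialgebra.comulAlgHom k A)

theorem comm_aux1 (z : A ⊗[k] A) : LinearMap.mul' k A ((HopfAlgebra.antipode k).rTensor A
    (TensorProduct.comm k A A z)) = LinearMap.mul' k A ((HopfAlgebra.antipode k).lTensor A z) := by
  induction z with
  | zero => simp
  | add x y hx hy => simp only [map_add, hx, hy]
  | tmul x y => simp [mul_comm]

theorem comm_aux2 (z : A ⊗[k] A) : LinearMap.mul' k A ((HopfAlgebra.antipode k).lTensor A
    (TensorProduct.comm k A A z)) = LinearMap.mul' k A ((HopfAlgebra.antipode k).rTensor A z) := by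
  induction z with
  | zero => simp
  | add x y hx hy => simp only [map_add, hx, hy]
  | tmul x y => simp [mul_comm]

/-- tau 1 -/
def tau1 : (A ⊗[k] A) ≃ₐ[k] (A ⊗[k] A) := tauE (D1 k A) (D1_co k) (D1_cu k)
  (fun h => HopfAlgebra.mul_antipode_rTensor_comul_apply h)
  (fun h => HopfAlgebra.mul_antipode_lTensor_comul_apply h)

/-- tau 2 -/
def tau2 : (A ⊗[k] A) ≃ₐ[k] (A ⊗[k] A) := tauE (D2 k A) (cop_co comul (D1_co k)) (D2_cu k)
  (fun h => (comm_aux1 k A (comul h)).trans (HopfAlgebra.mul_antipode_lTensor_comul_apply h))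
  (fun h => (comm_aux2 k A (comul h)).trans (HopfAlgebra.mul_antipode_rTensor_comul_apply h))

theorem tau1_one (x : A) : tau1 k A (x ⊗ₜ 1) = x ⊗ₜ 1 := tauE_one (D1 k A) _ _ _ _ x
theorem tau1_one' (x : A) : (tau1 k A).symm (x ⊗ₜ 1) = x ⊗ₜ 1 := tauE_one' (D1 k A) _ _ _ _ x
theorem tau1_symm (x : A) : (tau1 k A).symm (1 ⊗ₜ x) = D1 k A x := tauE_symm (D1 k A) _ _ _ _ x
theorem tau1_apply (x : A) : tau1 k A (1 ⊗ₜ x) = (HopfAlgebra.antipode k).rTensor A (D1 k A x) :=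
  tauE_apply (D1 k A) _ _ _ _ x
theorem tau2_one (x : A) : tau2 k A (x ⊗ₜ 1) = x ⊗ₜ 1 := tauE_one (D2 k A) _ _ _ _ x
theorem tau2_one' (x : A) : (tau2 k A).symm (x ⊗ₜ 1) = x ⊗ₜ 1 := tauE_one' (D2 k A) _ _ _ _ x
theorem tau2_symm (x : A) : (tau2 k A).symm (1 ⊗ₜ x) = D2 k A x := tauE_symm (D2 k A) _ _ _ _ x
theorem tau2_apply (x : A) : tau2 k A (1 ⊗ₜ x) = (HopfAlgebra.antipode k).rTensor A (D2 k A x) :=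
  tauE_apply (D2 k A) _ _ _ _ x

/-- theta 1 -/
def theta1 : (A ⊗[k] A) ≃ₐ[k] (A ⊗[k] A) := (Algebra.TensorProduct.comm k A A).trans
  ((tau2 k A).symm.trans (Algebra.TensorProduct.comm k A A))

/-- theta 2 -/
def theta2 : (A ⊗[k] A) ≃ₐ[k] (A ⊗[k] A) := (Algebra.TensorProduct.comm k A A).trans
  ((tau1 k A).symm.trans (Algebra.TensorProduct.comm k A A))

theorem theta1_l (x : A) : theta1 k A (x ⊗ₜ 1) = (tau1 k A).symm (1 ⊗ₜ x) := by
  change Algebra.TensorProduct.comm k A A ((tau2 k A).symm (1 ⊗ₜ x)) = _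
  rw [tau1_symm, tau2_symm]
  exact AlgEquiv.apply_symm_apply (Algebra.TensorProduct.comm k A A) _

theorem theta1_r (x : A) : theta1 k A (1 ⊗ₜ x) = 1 ⊗ₜ x := by
  change Algebra.TensorProduct.comm k A A ((tau2 k A).symm (x ⊗ₜ 1)) = _
  rw [tau2_one']; rfl

theorem theta2_l (x : A) : theta2 k A (x ⊗ₜ 1) = (tau2 k A).symm (1 ⊗ₜ x) := by
  change Algebra.TensorProduct.comm k A A ((tau1 k A).symm (1 ⊗ₜ x)) = _
  rw [tau1_symm, tau2_symm]; rfl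

theorem theta2_r (x : A) : theta2 k A (1 ⊗ₜ x) = 1 ⊗ₜ x := by
  change Algebra.TensorProduct.comm k A A ((tau1 k A).symm (x ⊗ₜ 1)) = _
  rw [tau1_one']; rfl

end

/-- opposite algebra, as a synonym -/
def OM (H : Type) : Type := Hᵐᵒᵖ

section
variable (k H : Type) [Field k] [Ring H] [HopfAlgebra k H]
instance instRingOM : Ring (OM H) := inferInstanceAs (Ring Hᵐᵒᵖ)
instance instAlgOM : Algebra k (OM H) := inferInstanceAs (Algebra k Hᵐᵒᵖ)
instance instCoalgOM : Coalgebra k (OM H) := inferInstanceAs (Coalgebra k Hᵐᵒᵖ)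
/-- the identity map -/
def opE : H ≃ₗ[k] OM H := MulOpposite.opLinearEquiv k
@[simp] theorem opE_mul (x y : H) : opE k H (x * y) = opE k H y * opE k H x := rfl
@[simp] theorem opE_one : opE k H 1 = 1 := rfl
@[simp] theorem opE_smul_mul (x y : OM H) : (opE k H).symm (x * y) = (opE k H).symm y * (opE k H).symm x := rfl
theorem OM_comul (x : OM H) : comul (R := k) x =
  TensorProduct.map (opE k H).toLinearMap (opE k H).toLinearMap (comul ((opE k H).symm x)) := rfl
end

section
variable {k A H : Type} [Field k] [IsAlgClosed k] [CommRing A] [IsDomain A] [HopfAlgebra k A]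
  [Algebra.FiniteType k A] [Ring H] [HopfAlgebra k H]

/-- opposite of j -/
def jop (j : A →ₐ[k] H) : A →ₐ[k] (OM H) := AlgHom.ofLinearMap
  ((opE k H).toLinearMap ∘ₗ j.toLinearMap)
  (by simp) (fun a b => by simp [mul_comm a b])

theorem jop_apply (j : A →ₐ[k] H) (a : A) : jop j a = opE k H (j a) := rfl

theorem leftDim (j : A →ₐ[k] H) (hj : Function.Injective j)
    (hco : ∀ a, comul (R := k) (j a) = TensorProduct.map j.toLinearMap j.toLinearMap (comul a))
    (hS : ∀ a, j (HopfAlgebra.antipode k a) = HopfAlgebra.antipode k (j a))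
    [Module A H] (hm : ∀ (a : A) (h : H), a • h = j a * h)
    [Module A (OM H)] (hm' : ∀ (a : A) (h : (OM H)), a • h = jop j a * h)
    [Module.Finite A H] [Module.Finite A (OM H)] :
    ∃ r : ℕ, ∀ I : Ideal A, Module.Finite k (A ⧸ I) →
      Module.finrank k (H ⧸ IM k H I) = r * Module.finrank k (A ⧸ I.restrictScalars k) ∧
      Module.Finite k (H ⧸ IM k H I) := by
  have : IsScalarTower k A H := ⟨fun c a h => by simp [hm]⟩
  have : IsScalarTower k A (OM H) := ⟨fun c a h => by simp [hm']⟩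
  refine main5 k A (OM H) H (jop j) (fun a b h => hj ((opE k H).injective h)) hm'
    (opE k H).symm (fun a x => by simp [jop_apply, hm])
    (tau1 k A) (theta1 k A) (tau1_one k A) (theta1_l k A) (theta1_r k A) ?_
  intro V _ _ ρ
  let g : H →ₗ[k] Module.End k V := ρ.toLinearMap ∘ₗ (opE k H).toLinearMap
  let f : H →ₗ[k] Module.End k V := g ∘ₗ HopfAlgebra.antipode k
  have hg : ∀ x y, g x * g y = g (y * x) := fun x y => by
    simp [g]
  have a1 : ∀ z : H ⊗[k] H, LinearMap.mul' k (Module.End k V)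
      (TensorProduct.map f g (TensorProduct.comm k H H z)) =
      g (LinearMap.mul' k H ((HopfAlgebra.antipode k).lTensor H z)) := by
    intro z
    induction z with
    | zero => simp
    | add x y hx hy => simp only [map_add, hx, hy]
    | tmul x y => simp [f, hg]
  have a2 : ∀ z : H ⊗[k] H, LinearMap.mul' k (Module.End k V)
      (TensorProduct.map g f (TensorProduct.comm k H H z)) =
      g (LinearMap.mul' k H ((HopfAlgebra.antipode k).rTensor H z)) := by
    intro z
    induction z with
    | zero => simp
    | add x y hx hy => simp only [map_add, hx, hy]
    | tmul x y => simp [f, hg]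
  have hg1 : ∀ c : k, g (algebraMap k H c) = c • 1 := fun c => by
    rw [Algebra.algebraMap_eq_smul_one, map_smul]; simp [g]
  refine ⟨LinearEquiv.ofLinearMap (TT comul f) (TT comul g) ?_ ?_, ?_⟩
  · refine TT_comp _ counit (D1_co k) (D1_cu k) _ _ fun h => ?_
    rw [a1, HopfAlgebra.mul_antipode_lTensor_comul_apply, hg1]
  · refine TT_comp _ counit (D1_co k) (D1_cu k) _ _ fun h => ?_
    rw [a2, HopfAlgebra.mul_antipode_rTensor_comul_apply, hg1]
  · intro v a m
    rw [tau1_apply]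
    refine TT_intertwine comul comul (HopfAlgebra.antipode k) ?_ (ρ.comp (jop j)) f ?_ v a m
    · intro a m
      rw [hm, Bialgebra.comul_mul, hco]
      generalize comul (R := k) m = w
      generalize comul (R := k) a = z
      induction z with
      | zero => simp
      | add x y hx hy => simp only [map_add, LinearMap.add_apply, add_mul, hx, hy]
      | tmul x y =>
        induction w with
        | zero => simp
        | add x y hx hy => simp only [map_add, mul_add, hx, hy]
        | tmul b c => simp [hm]
    · intro a m v
      rw [hm]
      simp only [f, g, LinearMap.comp_apply, HopfAlgebra.antipode_mul_antidistrib, ← hS]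
      simp [jop_apply]

theorem rightDim (j : A →ₐ[k] H) (hj : Function.Injective j)
    (hco : ∀ a, comul (R := k) (j a) = TensorProduct.map j.toLinearMap j.toLinearMap (comul a))
    (hS : ∀ a, j (HopfAlgebra.antipode k a) = HopfAlgebra.antipode k (j a))
    [Module A H] (hm : ∀ (a : A) (h : H), a • h = j a * h)
    [Module A (OM H)] (hm' : ∀ (a : A) (h : (OM H)), a • h = jop j a * h)
    [Module.Finite A H] [Module.Finite A (OM H)] :
    ∃ r : ℕ, ∀ I : Ideal A, Module.Finite k (A ⧸ I) →
      Module.finrank k ((OM H) ⧸ IM k (OM H) I) = r * Module.finrank k (A ⧸ I.restrictScalars k) ∧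
      Module.Finite k ((OM H) ⧸ IM k (OM H) I) := by
  have : IsScalarTower k A H := ⟨fun c a h => by simp [hm]⟩
  have : IsScalarTower k A (OM H) := ⟨fun c a h => by simp [hm']⟩
  refine main5 k A H (OM H) j hj hm
    (opE k H) (fun a x => by simp [jop_apply, hm'])
    (tau2 k A) (theta2 k A) (tau2_one k A) (theta2_l k A) (theta2_r k A) ?_
  intro V _ _ ρ
  let C := (OM H)
  let un : (OM H) →ₗ[k] H := (opE k H).symm.toLinearMap
  let op : H →ₗ[k] (OM H) := (opE k H).toLinearMap
  let g : (OM H) →ₗ[k] Module.End k V := ρ.toLinearMap ∘ₗ un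
  let f : (OM H) →ₗ[k] Module.End k V := ρ.toLinearMap ∘ₗ HopfAlgebra.antipode k ∘ₗ un
  let D : (OM H) →ₗ[k] (OM H) ⊗[k] (OM H) :=
    (TensorProduct.comm k (OM H) (OM H)).toLinearMap ∘ₗ comul
  have hD : ∀ h, D h = TensorProduct.comm k (OM H) (OM H) (TensorProduct.map op op (comul (un h))) :=
    fun h => rfl
  have a1 : ∀ z : H ⊗[k] H, LinearMap.mul' k (Module.End k V)
      (TensorProduct.map f g (TensorProduct.comm k _ _ (TensorProduct.comm k _ _
        (TensorProduct.map op op z)))) =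
      ρ (LinearMap.mul' k H ((HopfAlgebra.antipode k).rTensor H z)) := by
    intro z
    induction z with
    | zero => simp
    | add x y hx hy => simp only [map_add, hx, hy]
    | tmul x y => simp [f, g, op, un]
  have a2 : ∀ z : H ⊗[k] H, LinearMap.mul' k (Module.End k V)
      (TensorProduct.map g f (TensorProduct.comm k _ _ (TensorProduct.comm k _ _
        (TensorProduct.map op op z)))) =
      ρ (LinearMap.mul' k H ((HopfAlgebra.antipode k).lTensor H z)) := by
    intro z
    induction z with
    | zero => simp
    | add x y hx hy => simp only [map_add, hx, hy]
    | tmul x y => simp [f, g, op, un]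
  have hg1 : ∀ c : k, ρ (algebraMap k H c) = c • 1 := fun c => by
    rw [Algebra.algebraMap_eq_smul_one, map_smul]; simp
  refine ⟨LinearEquiv.ofLinearMap (TT D f) (TT D g) ?_ ?_, ?_⟩
  · refine TT_comp _ counit (cop_co comul (D1_co k)) (D2_cu k) _ _ fun h => ?_
    rw [hD, a1, HopfAlgebra.mul_antipode_rTensor_comul_apply, hg1]; rfl
  · refine TT_comp _ counit (cop_co comul (D1_co k)) (D2_cu k) _ _ fun h => ?_
    rw [hD, a2, HopfAlgebra.mul_antipode_lTensor_comul_apply, hg1]; rfl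
  · intro v a m
    rw [tau2_apply]
    refine TT_intertwine D (D2 k A).toLinearMap (HopfAlgebra.antipode k) ?_ (ρ.comp j) f ?_ v a m
    · intro a m
      have e1 : (D2 k A).toLinearMap a = TensorProduct.comm k A A (comul a) := rfl
      have e2 : un (a • m) = un m * j a := by rw [hm']; simp [un, jop_apply]
      rw [hD, hD, e1, e2, Bialgebra.comul_mul, hco]
      generalize comul (R := k) (un m) = w
      generalize comul (R := k) a = z
      induction z with
      | zero => simp
      | add x y hx hy => simp only [map_add, LinearMap.add_apply, mul_add, hx, hy]
      | tmul x y =>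
        induction w with
        | zero => simp
        | add x y hx hy => simp only [map_add, add_mul, hx, hy]
        | tmul b c => simp [hm', jop_apply, op]
    · intro a m v
      have e2 : un (a • m) = un m * j a := by rw [hm']; simp [un, jop_apply]
      simp only [f, LinearMap.comp_apply, e2, HopfAlgebra.antipode_mul_antidistrib, ← hS]
      simp

end

end
end Sub13

namespace Sub13
noncomputable section

section
variable {k A H : Type} [Field k] [CommRing A] [HopfAlgebra k A] [Ring H] [HopfAlgebra k H]

theorem mem_of_tmul (N : Submodule k H) (F : H ⊗[k] H →ₗ[k] H) (hF : ∀ a b, F (a ⊗ₜ b) ∈ N)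
    (z : H ⊗[k] H) : F z ∈ N := by
  induction z with
  | zero => simp
  | add x y hx hy => rw [map_add]; exact add_mem hx hy
  | tmul x y => exact hF x y

theorem adl_add_right (h x y : H) : Paper.adl k H h (x + y) =
    Paper.adl k H h x + Paper.adl k H h y := by
  unfold Paper.adl
  generalize comul (R := k) h = z
  induction z with
  | zero => simp
  | add a b ha hb => simp only [map_add, ha, hb]; abel
  | tmul a b => simp [mul_add, add_mul]

theorem adl_smul_right (h : H) (c : k) (x : H) : Paper.adl k H h (c • x) =
    c • Paper.adl k H h x := by
  unfold Paper.adl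
  generalize comul (R := k) h = z
  induction z with
  | zero => simp
  | add a b ha hb => simp only [map_add, ha, hb, smul_add]
  | tmul a b => simp

variable (k H) in
/-- bilinear adjoint action -/
def adlB : H →ₗ[k] H →ₗ[k] H := LinearMap.mk₂ k (Paper.adl k H)
  (fun a b x => by simp [Paper.adl]) (fun c a x => by simp [Paper.adl])
  adl_add_right (fun c a x => adl_smul_right a c x)

theorem adlB_apply (h x : H) : adlB k H h x = Paper.adl k H h x := rfl

theorem adl_mul (h h' x : H) : Paper.adl k H (h * h') x =
    Paper.adl k H h (Paper.adl k H h' x) := by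
  unfold Paper.adl
  rw [Bialgebra.comul_mul]
  generalize comul (R := k) h = z
  generalize comul (R := k) h' = w
  induction z with
  | zero => simp
  | add a b ha hb => simp only [map_add, add_mul, ha, hb]
  | tmul a b =>
    induction w with
    | zero => simp
    | add a b ha hb => 
      simp only [map_add, mul_add, ha, hb]
      simp [mul_add, add_mul]
    | tmul c d => simp [HopfAlgebra.antipode_mul_antidistrib, mul_assoc]

theorem counit_adl (h x : H) (hx : counit (R := k) x = 0) : 
    counit (R := k) (Paper.adl k H h x) = 0 := by
  unfold Paper.adl
  generalize comul (R := k) h = z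
  induction z with
  | zero => simp
  | add a b ha hb => simp only [map_add, ha, hb, add_zero]
  | tmul a b => simp [hx]

theorem counit_adr (h x : H) (hx : counit (R := k) x = 0) : 
    counit (R := k) (Paper.adr k H h x) = 0 := by
  unfold Paper.adr
  generalize comul (R := k) h = z
  induction z with
  | zero => simp
  | add a b ha hb => simp only [map_add, ha, hb, add_zero]
  | tmul a b => simp [hx]

theorem mul_eq_adl (h x : H) : ∃ F : H ⊗[k] H →ₗ[k] H,
    (∀ a b, F (a ⊗ₜ b) = Paper.adl k H a x * b) ∧ F (comul h) = h * x := by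
  let F : H ⊗[k] H →ₗ[k] H := LinearMap.mul' k H ∘ₗ ((adlB k H).flip x).rTensor H
  refine ⟨F, fun a b => by simp [F, adlB_apply], ?_⟩
  let Ψ : H ⊗[k] (H ⊗[k] H) →ₗ[k] H := LinearMap.mul' k H ∘ₗ
    TensorProduct.map (LinearMap.mulRight k x)
      (LinearMap.mul' k H ∘ₗ (HopfAlgebra.antipode k).rTensor H)
  have e1 : ∀ z : H ⊗[k] H, F z = Ψ (TensorProduct.assoc k H H H (comul.rTensor H z)) := by
    intro z
    induction z with
    | zero => simp
    | add a b ha hb => simp only [map_add, ha, hb]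
    | tmul a b =>
      simp only [F, LinearMap.comp_apply, LinearMap.rTensor_tmul, LinearMap.flip_apply,
        adlB_apply, LinearMap.mul'_apply, Paper.adl]
      generalize comul (R := k) a = w
      induction w with
      | zero => simp
      | add a b ha hb => simp only [map_add, add_mul, add_tmul, ha, hb]
      | tmul c d => simp [Ψ, mul_assoc]
  have e2 : ∀ z : H ⊗[k] H, Ψ (comul.lTensor H z) =
      TensorProduct.rid k H (counit.lTensor H z) * x := by
    intro z
    induction z with
    | zero => simp
    | add a b ha hb => simp only [map_add, add_mul, ha, hb]
    | tmul a b => 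
      simp [Ψ, HopfAlgebra.mul_antipode_rTensor_comul_apply, Algebra.algebraMap_eq_smul_one]
  rw [e1, Coalgebra.coassoc_apply, e2, Coalgebra.lTensor_counit_comul]
  simp

theorem mul_eq_adr (h x : H) : ∃ F : H ⊗[k] H →ₗ[k] H,
    (∀ a b, F (a ⊗ₜ b) = a * Paper.adr k H b x) ∧ F (comul h) = x * h := by
  let R : H →ₗ[k] H := TensorProduct.lift ((LinearMap.mul k H).comp ((LinearMap.mulRight k x) ∘ₗ
    (HopfAlgebra.antipode (R := k)))) ∘ₗ Coalgebra.comul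
  let F : H ⊗[k] H →ₗ[k] H := LinearMap.mul' k H ∘ₗ R.lTensor H
  refine ⟨F, fun a b => by simp [F, R, Paper.adr], ?_⟩
  let Ψ : H ⊗[k] (H ⊗[k] H) →ₗ[k] H := LinearMap.mul' k H ∘ₗ
    TensorProduct.map (LinearMap.mul' k H ∘ₗ (HopfAlgebra.antipode k).lTensor H)
      (LinearMap.mulLeft k x) ∘ₗ (TensorProduct.assoc k H H H).symm.toLinearMap
  have e1 : ∀ z : H ⊗[k] H, F z = Ψ (comul.lTensor H z) := by
    intro z
    induction z with
    | zero => simp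
    | add a b ha hb => simp only [map_add, ha, hb]
    | tmul a b =>
      simp only [F, R, LinearMap.comp_apply, LinearMap.lTensor_tmul, LinearMap.mul'_apply]
      generalize comul (R := k) b = w
      induction w with
      | zero => simp
      | add a b ha hb => simp only [map_add, mul_add, tmul_add, ha, hb]
      | tmul c d => simp [Ψ, mul_assoc]
  have e2 : ∀ z : H ⊗[k] H, Ψ (TensorProduct.assoc k H H H (comul.rTensor H z)) =
      x * TensorProduct.lid k H (counit.rTensor H z) := by
    intro z
    induction z with
    | zero => simp
    | add a b ha hb => simp only [map_add, mul_add, ha, hb]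
    | tmul a b => 
      simp [Ψ, HopfAlgebra.mul_antipode_lTensor_comul_apply, Algebra.algebraMap_eq_smul_one]
  rw [e1, ← Coalgebra.coassoc_apply, e2, Coalgebra.rTensor_counit_comul]
  simp

variable {ι : A →ₗ[k] H}

theorem adl_iota (hC : Paper.CommByFinite k A H ι) (a b : A) :
    Paper.adl k H (ι a) (ι b) = counit (R := k) a • ι b := by
  unfold Paper.adl
  rw [hC.ι_comul]
  have : ∀ z : A ⊗[k] A, (TensorProduct.lift (((LinearMap.mul k H).comp
      (LinearMap.mulRight k (ι b))).compl₂ (HopfAlgebra.antipode (R := k))))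
      (TensorProduct.map ι ι z) =
      ι (LinearMap.mul' k A ((HopfAlgebra.antipode k).lTensor A z) * b) := by
    intro z
    induction z with
    | zero => simp
    | add a b ha hb => simp only [map_add, add_mul, ha, hb]
    | tmul c d => 
      simp [← hC.ι_antipode, ← hC.ι_mul]
      congr 1; ring
  rw [this, HopfAlgebra.mul_antipode_lTensor_comul_apply, ← Algebra.smul_def, map_smul]

theorem aug_right (hC : Paper.CommByFinite k A H ι) :
    Paper.leftMul k A H ι (RingHom.ker (Bialgebra.counitAlgHom k A)) =
      Paper.augHIdeal k A H ι := by
  apply le_antisymm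
  · refine Submodule.span_le.2 ?_
    rintro _ ⟨h, a, ha, rfl⟩
    have ha : counit (R := k) a = 0 := ha
    obtain ⟨F, hF, he⟩ := mul_eq_adl (k := k) h (ι a)
    rw [SetLike.mem_coe, ← he]
    refine mem_of_tmul _ _ (fun x y => ?_) _
    rw [hF]
    obtain ⟨b, hb⟩ := hC.normal_left x a
    rw [← hb]
    refine Submodule.subset_span ⟨b, y, ?_, rfl⟩
    rw [← hC.ι_counit, hb]
    exact counit_adl _ _ (by rw [hC.ι_counit, ha])
  · refine Submodule.span_le.2 ?_
    rintro _ ⟨a, h, ha, rfl⟩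
    obtain ⟨F, hF, he⟩ := mul_eq_adr (k := k) h (ι a)
    rw [SetLike.mem_coe, ← he]
    refine mem_of_tmul _ _ (fun x y => ?_) _
    rw [hF]
    obtain ⟨b, hb⟩ := hC.normal_right y a
    rw [← hb]
    refine Submodule.subset_span ⟨x, b, ?_, rfl⟩
    change counit (R := k) b = 0
    rw [← hC.ι_counit, hb]
    exact counit_adr _ _ (by rw [hC.ι_counit, ha])

theorem aug_left :
    Paper.rightMul k A H ι (RingHom.ker (Bialgebra.counitAlgHom k A)) =
      Paper.augHIdeal k A H ι := by
  unfold Paper.rightMul Paper.augHIdeal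
  congr 1
  ext x
  constructor
  · rintro ⟨h, a, ha, e⟩; exact ⟨a, h, ha, e⟩
  · rintro ⟨a, h, ha, e⟩; exact ⟨h, a, ha, e⟩

/-- the algebra map -/
def jj (hC : Paper.CommByFinite k A H ι) : A →ₐ[k] H := AlgHom.ofLinearMap ι hC.ι_one hC.ι_mul

theorem jj_apply (hC : Paper.CommByFinite k A H ι) (a : A) : jj hC a = ι a := rfl

theorem dims [IsAlgClosed k] [IsDomain A] (hC : Paper.CommByFinite k A H ι) :
    (∃ r : ℕ, ∀ I : Ideal A, Module.Finite k (A ⧸ I) →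
      Module.finrank k (H ⧸ Paper.rightMul k A H ι I) =
        r * Module.finrank k (A ⧸ I.restrictScalars k) ∧
      Module.Finite k (H ⧸ Paper.rightMul k A H ι I)) ∧
    (∃ r : ℕ, ∀ I : Ideal A, Module.Finite k (A ⧸ I) →
      Module.finrank k (H ⧸ Paper.leftMul k A H ι I) =
        r * Module.finrank k (A ⧸ I.restrictScalars k) ∧
      Module.Finite k (H ⧸ Paper.leftMul k A H ι I)) := by
  have hft : Algebra.FiniteType k A := ⟨hC.affine⟩
  let j := jj hC
  let i1 : Module A H := Module.compHom H (j : A →+* H)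
  let i2 : Module A (OM H) := Module.compHom (OM H) (jop j : A →+* OM H)
  have hm : ∀ (a : A) (h : H), a • h = ι a * h := fun _ _ => rfl
  have hm' : ∀ (a : A) (h : OM H), a • h = jop j a * h := fun _ _ => rfl
  have hm2 : ∀ (a : A) (h : H), a • (opE k H h) = opE k H (h * ι a) := fun _ _ => rfl
  have hs1 : IsScalarTower k A H := ⟨fun c a h => by simp [hm]⟩
  have hs2 : IsScalarTower k A (OM H) := ⟨fun c a h => by simp [hm']⟩
  obtain ⟨s, hs⟩ := hC.finiteOver
  have f1 : Module.Finite A H := by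
    refine ⟨⟨s, ?_⟩⟩
    rw [eq_top_iff]
    intro x _
    have hx : x ∈ Submodule.span k {x : H | ∃ (a : A), ∃ y ∈ s, x = ι a * y} := by
      rw [hs]; trivial
    have : Submodule.span k {x : H | ∃ (a : A), ∃ y ∈ s, x = ι a * y} ≤
        (Submodule.span A (s : Set H)).restrictScalars k := by
      refine Submodule.span_le.2 ?_
      rintro _ ⟨a, y, hy, rfl⟩
      exact Submodule.smul_mem (Submodule.span A (s : Set H)) a (Submodule.subset_span hy)
    exact this hx
  have f2 : Module.Finite A (OM H) := by
    classical
    let rp := fun y : H => Coalgebra.Repr.arbitrary k y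
    let N : Submodule A (OM H) := Submodule.span A
      (⋃ y ∈ s, (fun i => opE k H ((rp y).left i)) '' ((rp y).index : Set _))
    have hfin : (⋃ y ∈ s, (fun i => opE k H ((rp y).left i)) ''
        ((rp y).index : Set _)).Finite := by
      refine Set.Finite.biUnion s.finite_toSet fun y _ => ?_
      exact (Finset.finite_toSet _).image _
    have hN : N = ⊤ := by
      rw [eq_top_iff]
      intro x _
      have hx : (opE k H).symm x ∈ Submodule.span k
          {x : H | ∃ (a : A), ∃ y ∈ s, x = ι a * y} := by
        rw [hs]; trivial
      have : Submodule.span k {x : H | ∃ (a : A), ∃ y ∈ s, x = ι a * y} ≤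
          (N.restrictScalars k).comap (opE k H).toLinearMap := by
        refine Submodule.span_le.2 ?_
        rintro _ ⟨a, y, hy, rfl⟩
        obtain ⟨F, hF, he⟩ := mul_eq_adr (k := k) y (ι a)
        rw [SetLike.mem_coe, ← he, ← (rp y).eq, map_sum]
        refine Submodule.sum_mem _ fun i hi => ?_
        rw [hF]
        obtain ⟨b, hb⟩ := hC.normal_right ((rp y).right i) a
        rw [← hb]
        change opE k H _ ∈ N
        rw [← hm2]
        refine Submodule.smul_mem _ _ (Submodule.subset_span ?_)
        simp only [Set.mem_iUnion]
        exact ⟨y, hy, i, hi, rfl⟩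
      have h2 := this hx
      change opE k H ((opE k H).symm x) ∈ N at h2
      simpa using h2
    refine ⟨?_⟩
    rw [← hN]
    exact Submodule.fg_span hfin
  constructor
  · obtain ⟨r, hr⟩ := leftDim j hC.ι_inj hC.ι_comul hC.ι_antipode hm hm'
    refine ⟨r, fun I hI => ?_⟩
    have : IM k H I = Paper.rightMul k A H ι I := by
      unfold IM Paper.rightMul
      congr 1
      ext x
      constructor
      · rintro ⟨a, ha, h, e⟩; exact ⟨h, a, ha, e⟩
      · rintro ⟨h, a, ha, e⟩; exact ⟨a, ha, h, e⟩
    rw [← this]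
    exact hr I hI
  · obtain ⟨r, hr⟩ := rightDim j hC.ι_inj hC.ι_comul hC.ι_antipode hm hm'
    refine ⟨r, fun I hI => ?_⟩
    have h1 : (Paper.leftMul k A H ι I).map (opE k H).toLinearMap = IM k (OM H) I := by
      unfold IM Paper.leftMul
      rw [Submodule.map_span]
      congr 1
      ext x
      constructor
      · rintro ⟨_, ⟨h, a, ha, rfl⟩, rfl⟩; exact ⟨a, ha, opE k H h, rfl⟩
      · rintro ⟨a, ha, h, rfl⟩; exact ⟨_, ⟨(opE k H).symm h, a, ha, rfl⟩, rfl⟩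
    let E : (H ⧸ Paper.leftMul k A H ι I) ≃ₗ[k] (OM H ⧸ IM k (OM H) I) :=
      Submodule.Quotient.equiv _ _ (opE k H) h1
    obtain ⟨h2, h3⟩ := hr I hI
    exact ⟨by rw [E.finrank_eq, h2], Module.Finite.equiv E.symm⟩

end
end
end Sub13
namespace Sub13
noncomputable section

theorem char_quot {k A : Type} [Field k] [CommRing A] [Algebra k A] (g : A →ₐ[k] k) :
    Module.finrank k (A ⧸ (RingHom.ker g).restrictScalars k) = 1 ∧
    Module.Finite k (A ⧸ RingHom.ker g) ∧ (RingHom.ker g).IsMaximal := by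
  have hs : Function.Surjective g := fun c => ⟨algebraMap k A c, by simp⟩
  let E : (A ⧸ (RingHom.ker g).restrictScalars k) ≃ₗ[k] k :=
    LinearMap.quotKerEquivOfSurjective g.toLinearMap hs
  refine ⟨by rw [E.finrank_eq]; simp, ?_, RingHom.ker_isMaximal_of_surjective g hs⟩
  exact Module.Finite.equiv E.symm

theorem lin_aux {k A H : Type} [Field k] [AddCommGroup A] [Module k A] [AddCommGroup H]
    [Module k H] (W : Submodule k H) [Module.Finite k (H ⧸ W)] (Φ : A →ₗ[k] Module.Dual k H)
    (hr : ∀ a, Φ a ∈ W.dualAnnihilator) (c : Submodule k A) (hk0 : ∀ a, Φ a = 0 → a ∈ c) :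
    Module.Finite k (A ⧸ c) ∧ Module.finrank k (A ⧸ c) ≤ Module.finrank k (H ⧸ W) := by
  have hk : LinearMap.ker Φ ≤ c := fun a ha => hk0 a ha
  have hf : Module.Finite k W.dualAnnihilator :=
    Module.Finite.equiv W.dualQuotEquivDualAnnihilator
  have hle : LinearMap.range Φ ≤ W.dualAnnihilator := by
    rintro _ ⟨a, rfl⟩; exact hr a
  have hf1 : Module.Finite k (LinearMap.range Φ) := Submodule.finiteDimensional_of_le hle
  have hf2 : Module.Finite k (A ⧸ LinearMap.ker Φ) :=
    Module.Finite.equiv Φ.quotKerEquivRange.symm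
  have hq : Function.Surjective (Submodule.factor hk) := Submodule.factor_surjective hk
  have e0 : Module.finrank k W.dualAnnihilator = Module.finrank k (H ⧸ W) := by
    rw [← W.dualQuotEquivDualAnnihilator.finrank_eq, Subspace.dual_finrank_eq]
  have e1 : Module.finrank k (LinearMap.range Φ) ≤ Module.finrank k W.dualAnnihilator :=
    Submodule.finrank_mono hle
  have e2 := Φ.quotKerEquivRange.finrank_eq
  have e3 := LinearMap.finrank_le_finrank_of_surjective hq
  exact ⟨Module.Finite.of_surjective _ hq, by omega⟩

section
variable {k A H : Type} [Field k] [CommRing A] [HopfAlgebra k A] [Ring H] [HopfAlgebra k H]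
variable {ι : A →ₗ[k] H}

/-- the annihilating ideal -/
def Jp (hC : Paper.CommByFinite k A H ι) (m : Ideal A) : Ideal A where
  carrier := {a | ∀ h : H, h * ι a ∈ Paper.rightMul k A H ι m}
  add_mem' := fun {a b} ha hb h => by
    rw [map_add, mul_add]; exact add_mem (ha h) (hb h)
  zero_mem' := fun h => by simp
  smul_mem' := fun c a ha h => by
    rw [smul_eq_mul, hC.ι_mul, ← mul_assoc]; exact ha _

theorem rightMul_mul (m : Ideal A) (x h : H) (hx : x ∈ Paper.rightMul k A H ι m) :
    x * h ∈ Paper.rightMul k A H ι m := by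
  have : Paper.rightMul k A H ι m ≤
      (Paper.rightMul k A H ι m).comap (LinearMap.mulRight k h) := by
    refine Submodule.span_le.2 ?_
    rintro _ ⟨y, a, ha, rfl⟩
    exact Submodule.subset_span ⟨y * h, a, ha, by simp [mul_assoc]⟩
  exact this hx

theorem Jp_stable (hC : Paper.CommByFinite k A H ι) (m : Ideal A) :
    Paper.IsHStable k A H ι (Jp hC m) := by
  intro h a ha
  obtain ⟨b, hb⟩ := hC.normal_left h a
  refine ⟨b, fun h' => ?_, hb⟩
  rw [hb]
  unfold Paper.adl
  refine mem_of_tmul _ (LinearMap.mulLeft k h' ∘ₗ _) (fun x y => ?_) _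
  have := rightMul_mul (ι := ι) m _ (HopfAlgebra.antipode k y) (ha (h' * x))
  simpa [mul_assoc] using this

theorem core_dim [Module.Finite k (H ⧸ Paper.augHIdeal k A H ι)]
    (hC : Paper.CommByFinite k A H ι) (g : A →ₐ[k] k)
    (h1 : Paper.rightMul k A H ι (RingHom.ker g) ≠ ⊤) (c : Ideal A)
    (hc : Paper.IsCore k A H ι (RingHom.ker g) c) :
    Module.Finite k (A ⧸ c) ∧ Module.finrank k (A ⧸ c.restrictScalars k) ≤
      Module.finrank k (H ⧸ Paper.augHIdeal k A H ι) := by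
  have hJ : Jp hC (RingHom.ker g) ≤ c := by
    refine hc.2.2 _ (Jp_stable hC _) fun a ha => ?_
    by_contra hga
    have hga : g a ≠ 0 := hga
    apply h1
    have h2 : (1 : H) ∈ Paper.rightMul k A H ι (RingHom.ker g) := by
      have e1 : ι a ∈ Paper.rightMul k A H ι (RingHom.ker g) := by simpa using ha 1
      have e2 : ι (a - algebraMap k A (g a)) ∈ Paper.rightMul k A H ι (RingHom.ker g) :=
        Submodule.subset_span ⟨1, a - algebraMap k A (g a), by simp [RingHom.mem_ker], by simp⟩
      have e3 := sub_mem e1 e2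
      rw [← map_sub, sub_sub_cancel, Algebra.algebraMap_eq_smul_one, map_smul, hC.ι_one] at e3
      have e4 := Submodule.smul_mem _ (g a)⁻¹ e3
      rwa [smul_smul, inv_mul_cancel₀ hga, one_smul] at e4
    rw [eq_top_iff]
    intro x _
    simpa using rightMul_mul _ _ x h2
  obtain ⟨p, hp⟩ := LinearMap.exists_leftInverse_of_injective ι (LinearMap.ker_eq_bot.2 hC.ι_inj)
  have hp : ∀ a, p (ι a) = a := fun a => LinearMap.congr_fun hp a
  let Φ : A →ₗ[k] Module.Dual k H :=
    (LinearMap.compr₂ ((adlB k H).flip ∘ₗ ι) (g.toLinearMap ∘ₗ p))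
  have hΦ : ∀ a h, Φ a h = g (p (Paper.adl k H h (ι a))) := fun a h => rfl
  have hr : ∀ a, Φ a ∈ (Paper.augHIdeal k A H ι).dualAnnihilator := by
    intro a
    rw [Submodule.mem_dualAnnihilator]
    have : Paper.augHIdeal k A H ι ≤ LinearMap.ker (Φ a) := by
      refine Submodule.span_le.2 ?_
      rintro _ ⟨b, h, hb, rfl⟩
      change Φ a _ = 0
      rw [hΦ, adl_mul]
      obtain ⟨d, hd⟩ := hC.normal_left h a
      rw [← hd, adl_iota hC, hb]; simp
    exact fun w hw => this hw
  have hk : ∀ a, Φ a = 0 → a ∈ c.restrictScalars k := by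
    intro a ha
    refine hJ fun h => ?_
    have ha : ∀ h, g (p (Paper.adl k H h (ι a))) = 0 := fun h => by
      rw [← hΦ]
      rw [ha]; rfl
    obtain ⟨F, hF, he⟩ := mul_eq_adl (k := k) h (ι a)
    rw [← he]
    refine mem_of_tmul _ _ (fun x y => ?_) _
    rw [hF]
    obtain ⟨b, hb⟩ := hC.normal_left x a
    have h3 := ha x
    rw [← hb, hp] at h3
    rw [← hb]
    exact Submodule.subset_span ⟨y, b, h3, rfl⟩
  exact lin_aux _ Φ hr _ hk

theorem gen_bound (hC : Paper.CommByFinite k A H ι) (s : Finset H)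
    (hs : Submodule.span k {x : H | ∃ (a : A), ∃ y ∈ s, x = ι a * y} = ⊤) :
    Module.finrank k (H ⧸ Paper.augHIdeal k A H ι) ≤ s.card := by
  classical
  let π := (Paper.augHIdeal k A H ι).mkQ
  have h : Submodule.span k ((s.image π : Finset _) : Set (H ⧸ Paper.augHIdeal k A H ι)) = ⊤ := by
    rw [eq_top_iff]
    have h1 : (⊤ : Submodule k (H ⧸ Paper.augHIdeal k A H ι)) =
        (⊤ : Submodule k H).map π := by
      rw [Submodule.map_top, Submodule.range_mkQ]
    rw [h1, ← hs, Submodule.map_span]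
    refine Submodule.span_le.2 ?_
    rintro _ ⟨_, ⟨a, y, hy, rfl⟩, rfl⟩
    have h2 : π (ι a * y) = counit (R := k) a • π y := by
      rw [← map_smul, ← sub_eq_zero, ← map_sub]
      refine (Submodule.Quotient.mk_eq_zero _).2 (Submodule.subset_span
        ⟨a - algebraMap k A (counit a), y, by simp, ?_⟩)
      rw [Algebra.algebraMap_eq_smul_one, map_sub, map_smul, hC.ι_one, sub_mul, smul_mul_assoc,
        one_mul]
    rw [h2]
    refine Submodule.smul_mem _ _ (Submodule.subset_span ?_)
    simp only [Finset.coe_image]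
    exact ⟨y, hy, rfl⟩
  rw [← finrank_top, ← h]
  exact (finrank_span_finset_le_card _).trans Finset.card_image_le

end
end
end Sub13


open Paper in
/-- If `A` is a domain then for every `g ∈ G_H`:
`dim H/Hm_g = dim H/m_gH = dim H̄`, and
`dim ĝ = dim(A/m_g^{(H̄)})·dim H̄ ≤ d_A(H)·dim H̄`; if moreover `H` is prime
then `dim ĝ ≤ (dim H̄)²`. -/
theorem statement_13
    (k : Type) [Field k] [IsAlgClosed k]
    (A : Type) [CommRing A] [HopfAlgebra k A] [IsDomain A]
    (H : Type) [Ring H] [HopfAlgebra k H]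
    (ι : A →ₗ[k] H)
    (hCbF : CommByFinite k A H ι)
    (core : Ideal A → Ideal A)
    (hcore : ∀ m : Ideal A, m.IsMaximal → IsCore k A H ι m (core m))
    (g : A →ₐ[k] k) :
    -- `dim_k (H/Hm_g) = dim_k (H/m_gH) = dim_k H̄`
    Module.finrank k (H ⧸ leftMul k A H ι (RingHom.ker g))
      = Module.finrank k (H ⧸ augHIdeal k A H ι) ∧
    Module.finrank k (H ⧸ rightMul k A H ι (RingHom.ker g))
      = Module.finrank k (H ⧸ augHIdeal k A H ι) ∧
    -- `dim_k ĝ = dim_k (A/m_g^{(H̄)}) · dim_k H̄`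
    Module.finrank k ↥(ghat k A H ι core g)
      = Module.finrank k (A ⧸ (core (RingHom.ker g)).restrictScalars k)
          * Module.finrank k (H ⧸ augHIdeal k A H ι) ∧
    -- `≤ d_A(H) · dim_k H̄` where `d_A(H)` is the minimal number of
    -- generators of `H` as an `A`-module
    (∀ d : ℕ,
      IsLeast {n : ℕ | ∃ s : Finset H, s.card = n ∧
        Submodule.span k {x : H | ∃ (a : A), ∃ y ∈ s, x = ι a * y} = ⊤} d →
      Module.finrank k ↥(ghat k A H ι core g)
        ≤ d * Module.finrank k (H ⧸ augHIdeal k A H ι)) ∧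
    -- if `H` is prime then `dim_k ĝ ≤ (dim_k H̄)²`
    ((∀ x y : H, (∀ h : H, x * h * y = 0) → x = 0 ∨ y = 0) →
      Module.finrank k ↥(ghat k A H ι core g)
        ≤ Module.finrank k (H ⧸ augHIdeal k A H ι) ^ 2) := by
  obtain ⟨⟨r, hr⟩, ⟨r', hr'⟩⟩ := Sub13.dims hCbF
  obtain ⟨c1, c2, -⟩ := Sub13.char_quot (Bialgebra.counitAlgHom k A)
  obtain ⟨g1, g2, g3⟩ := Sub13.char_quot g
  have er := hr _ c2
  have er' := hr' _ c2
  rw [c1, mul_one, Sub13.aug_left] at er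
  rw [c1, mul_one, Sub13.aug_right hCbF] at er'
  have hfin := er.2
  have hn : 0 < Module.finrank k (H ⧸ augHIdeal k A H ι) := by
    have h1 : augHIdeal k A H ι ≤ LinearMap.ker (counit : H →ₗ[k] k) := by
      refine Submodule.span_le.2 ?_
      rintro _ ⟨a, h, ha, rfl⟩
      change counit (R := k) (ι a * h) = 0
      rw [Bialgebra.counit_mul, hCbF.ι_counit, ha, zero_mul]
    have h2 : Nontrivial (H ⧸ augHIdeal k A H ι) := by
      refine Submodule.Quotient.nontrivial_iff.2 fun h => ?_
      have h3 : (1 : H) ∈ augHIdeal k A H ι := by rw [h]; trivial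
      have h4 : counit (R := k) (1 : H) = 0 := h1 h3
      simp at h4
    exact Module.finrank_pos
  have eg := hr _ g2
  have eg' := hr' _ g2
  rw [g1, mul_one, ← er.1] at eg
  rw [g1, mul_one, ← er'.1] at eg'
  have hne : rightMul k A H ι (RingHom.ker g) ≠ ⊤ := by
    intro h
    have h1 := eg.1
    have h2 : Subsingleton (H ⧸ rightMul k A H ι (RingHom.ker g)) :=
      Submodule.Quotient.subsingleton_iff.2 h
    rw [Module.finrank_zero_of_subsingleton] at h1
    omega
  obtain ⟨d1, d2⟩ := Sub13.core_dim hCbF g hne _ (hcore _ g3)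
  obtain ⟨e1, e2⟩ := hr' _ d1
  rw [← er'.1, mul_comm] at e1
  have e3 : Module.finrank k ↥(ghat k A H ι core g)
      = Module.finrank k (A ⧸ (core (RingHom.ker g)).restrictScalars k)
          * Module.finrank k (H ⧸ augHIdeal k A H ι) := by
    rw [← e1, ← Subspace.dual_finrank_eq]
    exact (leftMul k A H ι (core (RingHom.ker g))).dualQuotEquivDualAnnihilator.finrank_eq.symm
  refine ⟨eg'.1, eg.1, e3, ?_, ?_⟩
  · rintro d ⟨⟨s, hs, hsp⟩, -⟩
    rw [e3]
    refine Nat.mul_le_mul_right _ (d2.trans ?_)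
    rw [← hs]
    exact Sub13.gen_bound hCbF s hsp
  · intro _
    rw [e3, sq]
    exact Nat.mul_le_mul_right _ d2
end
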